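/- Fix a prime ℓ, an algebraically closed field k of characteristic ℓ, and an integer n > 1. Let H₁, …, H_t be pairwise non-isomorphic finite quasisimple groups such that for each i there is a prime power q_i ∉ {2,3,4,5,9} with ℓ not dividing q_i and H_i/Z(H_i) ≅ PSL₂(F_{q_i}). Then the total number, summed over i, of isomorphism classes of faithful irreducible k-linear representations of H_i of dimension n is at most n + 3. -/

import Mathlib

/-- A representation is irreducible if the only invariant submodules are `⊥` and `⊤`. -/
def Representation.IsIrred {k H V : Type*} [Field k] [Group H] [AddCommGroup V] [Module k V]
    (ρ : Representation k H V) : Prop :=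
  ∀ U : Submodule k V, (∀ h : H, ∀ v ∈ U, ρ h v ∈ U) → U = ⊥ ∨ U = ⊤

/-- The setoid identifying isomorphic (equivariantly linearly equivalent) representations
of `H` on `Fin n → k` satisfying a property `P`.  The classes of this setoid are exactly the
isomorphism classes of `n`-dimensional representations of `H` over `k` satisfying `P`. -/
def repIsoSetoid (k H : Type*) [Field k] [Group H] (n : ℕ)
    (P : Representation k H (Fin n → k) → Prop) :
    Setoid {ρ : Representation k H (Fin n → k) // P ρ} where
  r ρ₁ ρ₂ := ∃ e : (Fin n → k) ≃ₗ[k] (Fin n → k), ∀ (h : H) (v : Fin n → k),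
    e (ρ₁.1 h v) = ρ₂.1 h (e v)
  iseqv := by
    constructor
    · exact fun ρ => ⟨LinearEquiv.refl k _, fun _ _ => rfl⟩
    · rintro a b ⟨e, he⟩
      refine ⟨e.symm, fun h v => ?_⟩
      rw [LinearEquiv.symm_apply_eq, he, e.apply_symm_apply]
    · rintro a b c ⟨e, he⟩ ⟨f, hf⟩
      refine ⟨e.trans f, fun h v => ?_⟩
      simp [LinearEquiv.trans_apply, he, hf]

namespace SLTwo

open Matrix

/-- The group `SL₂(F)`. -/
abbrev SL2 (F : Type*) [Field F] := Matrix.SpecialLinearGroup (Fin 2) F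

section Generators

variable {F : Type*} [Field F]

/-- The upper unipotent matrix with upper right entry `a`. -/
def upper (a : F) : SL2 F := ⟨!![1, a; 0, 1], by simp [det_fin_two]⟩

/-- The diagonal matrix with entries `r` and `r⁻¹`. -/
def torus (r : Fˣ) : SL2 F := ⟨!![(r : F), 0; 0, (r⁻¹ : Fˣ)], by simp [det_fin_two]⟩

/-- The antidiagonal matrix with entries `s` and `-s⁻¹`. -/
def weyl (s : Fˣ) : SL2 F := ⟨!![0, (s : F); -(s⁻¹ : Fˣ), 0], by simp [det_fin_two]⟩

theorem SL2.ext {g h : SL2 F} (h₀ : g.1 0 0 = h.1 0 0) (h₁ : g.1 0 1 = h.1 0 1)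
    (h₂ : g.1 1 0 = h.1 1 0) (h₃ : g.1 1 1 = h.1 1 1) : g = h := by
  apply Subtype.ext
  ext i j
  fin_cases i <;> fin_cases j <;> assumption

theorem mul_entry (g h : SL2 F) (i j : Fin 2) :
    (g * h).1 i j = g.1 i 0 * h.1 0 j + g.1 i 1 * h.1 1 j := by
  change (g.1 * h.1) i j = _
  rw [mul_apply, Fin.sum_univ_two]

theorem upper_val (a : F) : (upper a).1 = !![1, a; 0, 1] := rfl

theorem torus_val (r : Fˣ) : (torus r).1 = !![(r : F), 0; 0, (r⁻¹ : Fˣ)] := rfl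

theorem weyl_val (s : Fˣ) : (weyl s).1 = !![0, (s : F); -(s⁻¹ : Fˣ), 0] := rfl

theorem upper_mul_upper (a b : F) : upper a * upper b = upper (a + b) := by
  apply SL2.ext <;> simp [mul_entry, upper_val, add_comm]

@[simp] theorem upper_zero : upper (0 : F) = 1 := by
  apply SL2.ext <;> simp [upper_val]

theorem upper_inv (a : F) : (upper a)⁻¹ = upper (-a) := by
  rw [inv_eq_iff_mul_eq_one, upper_mul_upper, add_neg_cancel, upper_zero]

@[simp] theorem torus_one : torus (1 : Fˣ) = 1 := by
  apply SL2.ext <;> simp [torus_val]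

theorem torus_mul_torus (r s : Fˣ) : torus r * torus s = torus (r * s) := by
  apply SL2.ext <;> simp [mul_entry, torus_val, mul_comm]

theorem torus_mul_upper (r : Fˣ) (a : F) :
    torus r * upper a = upper (r ^ 2 * a) * torus r := by
  apply SL2.ext <;> simp [mul_entry, torus_val, upper_val]
  field_simp

theorem upper_mul_torus (r : Fˣ) (a : F) :
    upper a * torus r = torus r * upper ((r⁻¹ : Fˣ) ^ 2 * a) := by
  rw [torus_mul_upper]
  congr 2
  simp

theorem torus_mul_weyl (r s : Fˣ) : torus r * weyl s = weyl (r * s) := by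
  apply SL2.ext <;> simp [mul_entry, torus_val, weyl_val, mul_comm]

theorem weyl_mul_torus (r s : Fˣ) : weyl s * torus r = weyl (s * r⁻¹) := by
  apply SL2.ext <;> simp [mul_entry, torus_val, weyl_val, mul_comm]

theorem weyl_mul_weyl (r s : Fˣ) : weyl s * weyl r = torus (-(s * r⁻¹)) := by
  apply SL2.ext <;> simp [mul_entry, torus_val, weyl_val, mul_comm]

theorem weyl_mul_upper_mul_weyl (s r x : Fˣ) :
    weyl s * upper (x : F) * weyl r =
      upper (-((s ^ 2 * x⁻¹ : Fˣ) : F)) * weyl (-(s * r * x⁻¹)) *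
        upper (-((r ^ 2 * x⁻¹ : Fˣ) : F)) := by
  apply SL2.ext <;> simp [mul_entry, upper_val, weyl_val] <;> (field_simp; try ring)

theorem det_eq_one (g : SL2 F) : g.1 0 0 * g.1 1 1 - g.1 0 1 * g.1 1 0 = 1 := by
  rw [← det_fin_two]; exact g.2

/-- Elements with lower left entry zero. -/
theorem eq_torus_mul_upper {g : SL2 F} (h : g.1 1 0 = 0) :
    ∃ (r : Fˣ) (b : F), g = torus r * upper b := by
  have hd := det_eq_one g
  rw [h, mul_zero, sub_zero] at hd
  have ha : g.1 0 0 ≠ 0 := left_ne_zero_of_mul_eq_one hd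
  refine ⟨Units.mk0 _ ha, (g.1 0 0)⁻¹ * g.1 0 1, ?_⟩
  apply SL2.ext <;> simp [mul_entry, upper_val, torus_val, h]
  · field_simp
  · field_simp; linear_combination hd

/-- Elements of the big Bruhat cell. -/
theorem eq_upper_mul_weyl_mul_upper {g : SL2 F} (h : g.1 1 0 ≠ 0) :
    ∃ (a : F) (s : Fˣ) (b : F), g = upper a * weyl s * upper b := by
  have hd := det_eq_one g
  refine ⟨g.1 0 0 / g.1 1 0, Units.mk0 (-(g.1 1 0)⁻¹) (by simpa using h), g.1 1 1 / g.1 1 0, ?_⟩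
  apply SL2.ext <;> simp [mul_entry, upper_val, weyl_val, h]
  · field_simp; linear_combination -hd
  · field_simp

theorem bruhat (g : SL2 F) : (∃ (r : Fˣ) (b : F), g = torus r * upper b) ∨
    ∃ (a : F) (s : Fˣ) (b : F), g = upper a * weyl s * upper b := by
  by_cases h : g.1 1 0 = 0
  · exact Or.inl (eq_torus_mul_upper h)
  · exact Or.inr (eq_upper_mul_weyl_mul_upper h)

end Generators

end SLTwo

namespace SLTwo

open Module

section General

variable {k G V V' : Type*} [Field k] [Group G] [AddCommGroup V] [Module k V]
  [AddCommGroup V'] [Module k V'] {ρ : Representation k G V} {ρ' : Representation k G V'}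

/-- Isomorphism of representations. -/
def IsoRep (ρ : Representation k G V) (ρ' : Representation k G V') : Prop :=
  ∃ e : V ≃ₗ[k] V', ∀ h v, e (ρ h v) = ρ' h (e v)

theorem span_orbit_eq_top (hρ : ρ.IsIrred) {v : V} (hv : v ≠ 0) :
    Submodule.span k (Set.range fun g => ρ g v) = ⊤ := by
  refine (hρ _ ?_).resolve_left ?_
  · intro h w hw
    induction hw using Submodule.span_induction with
    | mem x hx =>
      obtain ⟨g, rfl⟩ := hx
      refine Submodule.subset_span ⟨h * g, ?_⟩
      simp
    | zero => simp
    | add x y _ _ hx hy => rw [map_add]; exact Submodule.add_mem _ hx hy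
    | smul a x _ hx => rw [map_smul]; exact Submodule.smul_mem _ _ hx
  · intro h
    refine hv ((Submodule.mem_bot k).1 ?_)
    rw [← h]
    exact Submodule.subset_span ⟨1, by simp⟩

theorem eq_zero_of_functional (hρ : ρ.IsIrred) {l : V →ₗ[k] k} (hl : l ≠ 0) {w : V}
    (hw : ∀ g, l (ρ g w) = 0) : w = 0 := by
  by_contra h0
  refine hl (LinearMap.ext_on_range (span_orbit_eq_top hρ h0) fun g => ?_)
  simpa using hw g

/-- The linear map `k[G] → V` attached to a vector. -/
noncomputable def orbitMap (ρ : Representation k G V) (v : V) : MonoidAlgebra k G →ₗ[k] V :=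
  (LinearMap.applyₗ v).comp ρ.asAlgebraHom.toLinearMap

theorem orbitMap_apply (ρ : Representation k G V) (v : V) (x : MonoidAlgebra k G) :
    orbitMap ρ v x = ρ.asAlgebraHom x v := rfl

theorem orbitMap_single (ρ : Representation k G V) (v : V) (g : G) (a : k) :
    orbitMap ρ v (MonoidAlgebra.single g a) = a • ρ g v := by
  simp [orbitMap_apply, Representation.asAlgebraHom_single]

theorem orbitMap_mul (ρ : Representation k G V) (v : V) (g : G) (x : MonoidAlgebra k G) :
    orbitMap ρ v (MonoidAlgebra.single g 1 * x) = ρ g (orbitMap ρ v x) := by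
  simp [orbitMap_apply, Representation.asAlgebraHom_single]

theorem orbitMap_surjective (hρ : ρ.IsIrred) {v : V} (hv : v ≠ 0) :
    Function.Surjective (orbitMap ρ v) := by
  rw [← LinearMap.range_eq_top, eq_top_iff, ← span_orbit_eq_top hρ hv, Submodule.span_le]
  rintro _ ⟨g, rfl⟩
  exact ⟨MonoidAlgebra.single g 1, by simp [orbitMap_single]⟩

theorem functional_orbitMap_eq {v : V} {v' : V'} {l : V →ₗ[k] k} {l' : V' →ₗ[k] k}
    (h : ∀ g, l (ρ g v) = l' (ρ' g v')) (x : MonoidAlgebra k G) :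
    l (orbitMap ρ v x) = l' (orbitMap ρ' v' x) := by
  have : l.comp (orbitMap ρ v) = l'.comp (orbitMap ρ' v') := by
    refine MonoidAlgebra.lhom_ext' fun g => LinearMap.ext fun a => ?_
    simp [orbitMap_single, h]
  exact LinearMap.congr_fun this x

theorem orbitMap_eq_zero_iff (hρ : ρ.IsIrred) {v : V} {l : V →ₗ[k] k} (hl : l ≠ 0)
    (x : MonoidAlgebra k G) : orbitMap ρ v x = 0 ↔
      ∀ g, l (orbitMap ρ v (MonoidAlgebra.single g 1 * x)) = 0 := by
  constructor
  · intro h g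
    rw [orbitMap_mul, h, map_zero, map_zero]
  · intro h
    refine eq_zero_of_functional hρ hl fun g => ?_
    rw [← orbitMap_mul, h]

/-- Irreducible representations sharing a nonzero matrix coefficient are isomorphic. -/
theorem isoRep_of_coeff_eq (hρ : ρ.IsIrred) (hρ' : ρ'.IsIrred) {v : V} {v' : V'}
    (hv : v ≠ 0) (hv' : v' ≠ 0) {l : V →ₗ[k] k} {l' : V' →ₗ[k] k} (hl : l ≠ 0) (hl' : l' ≠ 0)
    (h : ∀ g, l (ρ g v) = l' (ρ' g v')) : IsoRep ρ ρ' := by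
  have hker : LinearMap.ker (orbitMap ρ v) = LinearMap.ker (orbitMap ρ' v') := by
    ext x
    rw [LinearMap.mem_ker, LinearMap.mem_ker, orbitMap_eq_zero_iff hρ hl,
      orbitMap_eq_zero_iff hρ' hl']
    simp only [functional_orbitMap_eq h]
  have hs := orbitMap_surjective hρ hv
  have hs' := orbitMap_surjective hρ' hv'
  let e := ((orbitMap ρ v).quotKerEquivOfSurjective hs).symm.trans
    ((Submodule.quotEquivOfEq _ _ hker).trans ((orbitMap ρ' v').quotKerEquivOfSurjective hs'))
  have he : ∀ x, e (orbitMap ρ v x) = orbitMap ρ' v' x := by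
    intro x
    have : ((orbitMap ρ v).quotKerEquivOfSurjective hs).symm (orbitMap ρ v x) =
        Submodule.Quotient.mk x := by
      rw [LinearEquiv.symm_apply_eq]
      rfl
    simp only [e, LinearEquiv.trans_apply, this]
    rfl
  refine ⟨e, fun g w => ?_⟩
  obtain ⟨x, rfl⟩ := hs w
  rw [← orbitMap_mul, he, he, orbitMap_mul]

/-- If an element `e` of the group algebra acts as a rank one idempotent in each member of a
family of pairwise non-isomorphic irreducible representations, the attached matrix coefficients
are linearly independent. -/
theorem linearIndependent_coeff {ι : Type*} [Finite ι] {W : ι → Type*}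
    [∀ i, AddCommGroup (W i)] [∀ i, Module k (W i)] {σ : ∀ i, Representation k G (W i)}
    (hσ : ∀ i, (σ i).IsIrred) (hne : ∀ i j, IsoRep (σ i) (σ j) → i = j)
    (e : MonoidAlgebra k G) {v : ∀ i, W i} {l : ∀ i, W i →ₗ[k] k} (hlv : ∀ i, l i (v i) = 1)
    (he : ∀ i w, (σ i).asAlgebraHom e w = l i w • v i) :
    LinearIndependent k fun i (g : G) => l i (σ i g (v i)) := by
  have hv : ∀ i, v i ≠ 0 := fun i h0 => by simpa [h0] using hlv i
  have hl : ∀ i, l i ≠ 0 := fun i h0 => by simpa [h0] using hlv i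
  have hev : ∀ i, (σ i).asAlgebraHom e (v i) = v i := fun i => by rw [he, hlv, one_smul]
  let C : Submonoid (MonoidAlgebra k G) :=
    { carrier := {x | ∀ i, (σ i).asAlgebraHom x (v i) = l i ((σ i).asAlgebraHom x (v i)) • v i}
      one_mem' := fun i => by simp [hlv]
      mul_mem' := by
        intro x y hx hy i
        simp only [map_mul, Module.End.mul_apply]
        rw [hy i, map_smul, hx i]
        simp only [map_smul, smul_eq_mul, hlv, mul_one, smul_smul] }
  have hC : ∀ x ∈ C, ∀ i, (σ i).asAlgebraHom x (v i) =
      l i ((σ i).asAlgebraHom x (v i)) • v i := fun x hx => hx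
  let χ : ι → C →* k := fun i =>
    { toFun := fun x => l i ((σ i).asAlgebraHom x (v i))
      map_one' := by simp [hlv]
      map_mul' := by
        intro x y
        simp only [Submonoid.coe_mul, map_mul, Module.End.mul_apply]
        rw [hC y y.2 i, map_smul, map_smul, smul_eq_mul, mul_comm, map_smul, smul_eq_mul, hlv,
          mul_one] }
  have hχinj : Function.Injective χ := by
    intro i j hij
    refine hne i j (isoRep_of_coeff_eq (hσ i) (hσ j) (hv i) (hv j) (hl i) (hl j) fun g => ?_)
    have heg : e * MonoidAlgebra.single g 1 ∈ C := by
      intro i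
      rw [map_mul, Module.End.mul_apply, he, map_smul, hlv, smul_eq_mul, mul_one]
    have := DFunLike.congr_fun hij ⟨_, heg⟩
    simpa [χ, he, hlv, Representation.asAlgebraHom_single] using this
  have hli := (linearIndependent_monoidHom C k).comp χ hχinj
  cases nonempty_fintype ι
  rw [Fintype.linearIndependent_iff] at hli ⊢
  intro a ha
  apply hli
  have hall : (∑ i, a i • (l i).comp (orbitMap (σ i) (v i))) = 0 := by
    refine MonoidAlgebra.lhom_ext' fun g => LinearMap.ext fun b => ?_
    have := congr_fun ha g
    simp only [Finset.sum_apply, Pi.smul_apply, smul_eq_mul, Pi.zero_apply] at this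
    simp only [LinearMap.sum_apply, LinearMap.smul_apply, LinearMap.comp_apply,
      MonoidAlgebra.lsingle_apply, orbitMap_single, map_smul, smul_eq_mul, LinearMap.zero_apply]
    rw [← mul_zero b, ← this, Finset.mul_sum]
    exact Finset.sum_congr rfl fun i _ => by ring
  ext x
  have := LinearMap.congr_fun hall (x : MonoidAlgebra k G)
  simpa [LinearMap.sum_apply, orbitMap_apply, χ] using this

end General

end SLTwo

namespace SLTwo

open Module

section Projections

variable {F k V : Type*} [Field F] [Fintype F] [Field k] [AddCommGroup V]
  [Module k V]

/-- The projection onto the vectors on which `upper a` acts as `ψ (a * x)`. -/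
noncomputable def proj (ψ : AddChar F k) (ρ : Representation k (SL2 F) V) (x : F) : V →ₗ[k] V :=
  (Fintype.card F : k)⁻¹ • ∑ a, ψ (-(a * x)) • ρ (upper a)

variable {ψ : AddChar F k} {ρ : Representation k (SL2 F) V}

theorem proj_apply (x : F) (v : V) :
    proj ψ ρ x v = (Fintype.card F : k)⁻¹ • ∑ a, ψ (-(a * x)) • ρ (upper a) v := by
  simp [proj, LinearMap.sum_apply]

theorem rep_mul_apply {G : Type*} [Group G] (σ : Representation k G V) (g h : G) (v : V) :
    σ g (σ h v) = σ (g * h) v := by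
  rw [map_mul]; rfl

theorem proj_upper (x a : F) (v : V) :
    proj ψ ρ x (ρ (upper a) v) = ψ (a * x) • proj ψ ρ x v := by
  rw [proj_apply, proj_apply, smul_comm (ψ (a * x)), Finset.smul_sum (r := ψ (a * x))]
  refine congrArg (fun w : V => (Fintype.card F : k)⁻¹ • w)
    (Fintype.sum_equiv (Equiv.addRight a) _ _ fun b => ?_)
  rw [rep_mul_apply, upper_mul_upper, smul_smul, ← AddChar.map_add_eq_mul, Equiv.coe_addRight]
  congr 2
  ring

theorem upper_proj (x a : F) (v : V) :
    ρ (upper a) (proj ψ ρ x v) = ψ (a * x) • proj ψ ρ x v := by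
  rw [← proj_upper, proj_apply, proj_apply, map_smul, map_sum (ρ (upper a))]
  refine congrArg ((Fintype.card F : k)⁻¹ • ·) (Finset.sum_congr rfl fun b _ => ?_)
  rw [map_smul, rep_mul_apply, rep_mul_apply, upper_mul_upper, upper_mul_upper, add_comm]

theorem proj_eq_smul_sum {x y : F} {v : V} (hv : ∀ a, ρ (upper a) v = ψ (a * x) • v) :
    proj ψ ρ y v = ((Fintype.card F : k)⁻¹ * ∑ a, ψ (a * (x - y))) • v := by
  rw [proj_apply, mul_smul, Finset.sum_smul]
  congr 1
  refine Finset.sum_congr rfl fun b _ => ?_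
  rw [hv, smul_smul, ← AddChar.map_add_eq_mul]
  congr 2
  ring

variable (hψ : ψ.IsPrimitive) (hq : (Fintype.card F : k) ≠ 0)
include hψ hq

theorem proj_eq_self {x : F} {v : V} (hv : ∀ a, ρ (upper a) v = ψ (a * x) • v) :
    proj ψ ρ x v = v := by
  classical
  rw [proj_eq_smul_sum hv, AddChar.sum_mulShift _ hψ]
  simp [hq]

omit hq in
theorem proj_eq_zero {x y : F} (hxy : x ≠ y) {v : V} (hv : ∀ a, ρ (upper a) v = ψ (a * x) • v) :
    proj ψ ρ y v = 0 := by
  classical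
  rw [proj_eq_smul_sum hv, AddChar.sum_mulShift _ hψ]
  simp [sub_eq_zero, hxy]

theorem proj_proj_self (x : F) (v : V) : proj ψ ρ x (proj ψ ρ x v) = proj ψ ρ x v :=
  proj_eq_self hψ hq fun a => upper_proj x a v

omit hq in
theorem proj_proj_of_ne {x y : F} (hxy : x ≠ y) (v : V) : proj ψ ρ y (proj ψ ρ x v) = 0 :=
  proj_eq_zero hψ hxy fun a => upper_proj x a v

theorem sum_proj (v : V) : ∑ x, proj ψ ρ x v = v := by
  classical
  simp only [proj_apply]
  rw [← Finset.smul_sum, Finset.sum_comm]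
  simp only [← Finset.sum_smul]
  have : ∀ a : F, ∑ x, ψ (-(a * x)) = if a = 0 then (Fintype.card F : k) else 0 := by
    intro a
    have := AddChar.sum_mulShift (-a) hψ
    simp only [neg_eq_zero] at this
    rw [Nat.cast_ite, Nat.cast_zero] at this
    rw [← this]
    exact Finset.sum_congr rfl fun x _ => by congr 1; ring
  simp [this, hq]

omit hψ hq in
theorem torus_proj (x : F) (r : Fˣ) (v : V) :
    ρ (torus r) (proj ψ ρ x v) = proj ψ ρ (x * ((r⁻¹ : Fˣ) : F) ^ 2) (ρ (torus r) v) := by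
  rw [proj_apply, proj_apply, map_smul, map_sum]
  congr 1
  refine Fintype.sum_equiv (Equiv.mulLeft₀ ((r : F) ^ 2) (by simp)) _ _ fun b => ?_
  rw [map_smul, rep_mul_apply, rep_mul_apply, torus_mul_upper]
  change _ = ψ (-((r : F) ^ 2 * b * (x * ((r⁻¹ : Fˣ) : F) ^ 2))) •
    ρ (upper ((r : F) ^ 2 * b) * torus r) v
  congr 3
  simp only [Units.val_inv_eq_inv_val]
  field_simp

theorem finrank_eq_sum [FiniteDimensional k V] :
    finrank k V = ∑ x, finrank k (LinearMap.range (proj ψ ρ x)) := by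
  rw [← Module.finrank_pi_fintype]
  refine LinearEquiv.finrank_eq (LinearEquiv.ofBijective
    (LinearMap.pi fun x => (proj ψ ρ x).rangeRestrict) ⟨?_, ?_⟩)
  · rw [← LinearMap.ker_eq_bot, LinearMap.ker_eq_bot']
    intro v hv
    rw [← sum_proj (ρ := ρ) hψ hq v]
    refine Finset.sum_eq_zero fun x _ => ?_
    exact congrArg Subtype.val (congr_fun hv x)
  · intro w
    refine ⟨∑ x, (w x : V), ?_⟩
    funext y
    apply Subtype.ext
    change proj ψ ρ y (∑ x, (w x : V)) = w y
    rw [map_sum, Finset.sum_eq_single y]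
    · obtain ⟨v, hv⟩ := (w y).2
      rw [← hv, proj_proj_self hψ hq]
    · intro x _ hxy
      obtain ⟨v, hv⟩ := (w x).2
      rw [← hv, proj_proj_of_ne hψ hxy]
    · simp

omit hψ hq in
theorem finrank_range_proj_mul_sq [FiniteDimensional k V] (x : F) (r : Fˣ) :
    finrank k (LinearMap.range (proj ψ ρ (x * (r : F) ^ 2))) =
      finrank k (LinearMap.range (proj ψ ρ x)) := by
  have key : ∀ (x : F) (r : Fˣ), finrank k (LinearMap.range (proj ψ ρ x)) ≤
      finrank k (LinearMap.range (proj ψ ρ (x * (r : F) ^ 2))) := by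
    intro x r
    have hsub : (LinearMap.range (proj ψ ρ x)).map (ρ (torus r⁻¹)) ≤
        LinearMap.range (proj ψ ρ (x * (r : F) ^ 2)) := by
      rintro _ ⟨_, ⟨v, rfl⟩, rfl⟩
      rw [torus_proj]
      exact ⟨ρ (torus r⁻¹) v, by simp⟩
    have hinj : Function.Injective (ρ (torus r⁻¹)) := by
      refine Function.LeftInverse.injective (g := ρ (torus r)) fun v => ?_
      rw [rep_mul_apply, torus_mul_torus]
      simp
    rw [LinearEquiv.finrank_eq (Submodule.equivMapOfInjective _ hinj _)]
    exact Submodule.finrank_mono hsub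
  refine le_antisymm ?_ (key x r)
  have := key (x * (r : F) ^ 2) r⁻¹
  rwa [mul_assoc, ← mul_pow, Units.mul_inv, one_pow, mul_one] at this

end Projections

end SLTwo

namespace SLTwo

open Module

section PrincipalSeries

variable {F k V V' : Type*} [Field F] [Fintype F] [Field k] [AddCommGroup V]
  [Module k V] [AddCommGroup V'] [Module k V']

/-- A nonzero vector fixed by `upper` and on which `torus` acts through `χ`. -/
structure IsBorelVec (ρ : Representation k (SL2 F) V) (χ : Fˣ →* k) (v : V) : Prop where
  ne_zero : v ≠ 0
  upper : ∀ a, ρ (upper a) v = v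
  torus : ∀ r, ρ (torus r) v = χ r • v

variable {ψ : AddChar F k} {ρ : Representation k (SL2 F) V} {ρ' : Representation k (SL2 F) V'}
  {χ : Fˣ →* k} {v : V} {v' : V'}

theorem sum_eq_zero_add_sum_units {M : Type*} [AddCommMonoid M] [DecidableEq F] (f : F → M) :
    ∑ a, f a = f 0 + ∑ a : Fˣ, f a := by
  rw [← Finset.add_sum_erase _ _ (Finset.mem_univ (0 : F))]
  congr 1
  refine (Finset.sum_bij (fun (a : Fˣ) _ => (a : F)) ?_ ?_ ?_ ?_).symm
  · intro a _; simp
  · intro a _ b _ h; exact Units.ext h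
  · intro b hb
    exact ⟨Units.mk0 b (Finset.ne_of_mem_erase hb), Finset.mem_univ _, rfl⟩
  · intro a _; rfl

omit [Fintype F] in
theorem IsBorelVec.weyl (hv : IsBorelVec ρ χ v) (s : Fˣ) :
    ρ (weyl s) v = χ s⁻¹ • ρ (SLTwo.weyl 1) v := by
  rw [← map_smul, ← hv.torus, rep_mul_apply, weyl_mul_torus]
  simp

omit [Fintype F] in
theorem IsBorelVec.weyl_weyl (hv : IsBorelVec ρ χ v) :
    ρ (SLTwo.weyl 1) (ρ (SLTwo.weyl 1) v) = χ (-1) • v := by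
  rw [rep_mul_apply, weyl_mul_weyl, hv.torus]
  simp

omit [Fintype F] in
theorem IsBorelVec.weyl_upper_weyl (hv : IsBorelVec ρ χ v) (x : Fˣ) :
    ρ (SLTwo.weyl 1) (ρ (SLTwo.upper (x : F)) (ρ (SLTwo.weyl 1) v)) =
      χ (-x) • ρ (SLTwo.upper (-((x⁻¹ : Fˣ) : F))) (ρ (SLTwo.weyl 1) v) := by
  rw [rep_mul_apply, rep_mul_apply, weyl_mul_upper_mul_weyl, ← rep_mul_apply, hv.upper,
    ← rep_mul_apply, hv.weyl, map_smul]
  simp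

omit [Fintype F] in
theorem IsBorelVec.eq_top (hρ : ρ.IsIrred) (hv : IsBorelVec ρ χ v) {S : Submodule k V}
    (h : v ∈ S) (hS : ∀ a, ρ (SLTwo.upper a) (ρ (SLTwo.weyl 1) v) ∈ S) : S = ⊤ := by
  rw [eq_top_iff, ← span_orbit_eq_top hρ hv.ne_zero, Submodule.span_le]
  rintro _ ⟨g, rfl⟩
  dsimp only
  rcases bruhat g with ⟨r, b, rfl⟩ | ⟨a, s, b, rfl⟩
  · rw [← rep_mul_apply, hv.upper, hv.torus]
    exact S.smul_mem _ h
  · rw [← rep_mul_apply, hv.upper, ← rep_mul_apply, hv.weyl, map_smul]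
    exact S.smul_mem _ (hS a)

/-- A torus-stable nonzero space of vectors fixed by `upper` contains a Borel vector. -/
theorem exists_isBorelVec [IsAlgClosed k] [FiniteDimensional k V] {S : Submodule k V}
    (hS : S ≠ ⊥) (hU : ∀ w ∈ S, ∀ a, ρ (upper a) w = w)
    (hT : ∀ w ∈ S, ∀ r, ρ (torus r) w ∈ S) : ∃ χ : Fˣ →* k, ∃ w ∈ S, IsBorelVec ρ χ w := by
  obtain ⟨g, hg⟩ := IsCyclic.exists_generator (α := Fˣ)
  have : Nontrivial S := Submodule.nontrivial_iff_ne_bot.2 hS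
  obtain ⟨μ, hμ⟩ := Module.End.exists_eigenvalue
    ((ρ (torus g)).restrict (p := S) (q := S) fun w hw => hT w hw g)
  obtain ⟨w, hw⟩ := hμ.exists_hasEigenvector
  have hw0 : (w : V) ≠ 0 := fun h => hw.2 (Subtype.ext h)
  have hgw : ρ (torus g) (w : V) = μ • (w : V) := congrArg Subtype.val hw.apply_eq_smul
  have hμ0 : μ ≠ 0 := by
    rintro rfl
    apply hw0
    have : ρ (torus g⁻¹) (ρ (torus g) (w : V)) = w := by
      rw [rep_mul_apply, torus_mul_torus]; simp
    rw [← this, hgw]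
    simp
  let K : Subgroup Fˣ :=
    { carrier := {r | ∃ c : k, ρ (torus r) (w : V) = c • (w : V)}
      one_mem' := ⟨1, by simp⟩
      mul_mem' := by
        rintro r s ⟨c, hc⟩ ⟨d, hd⟩
        refine ⟨d * c, ?_⟩
        rw [← torus_mul_torus, ← rep_mul_apply, hd, map_smul, hc, smul_smul]
      inv_mem' := by
        rintro r ⟨c, hc⟩
        have h1 : ρ (torus r⁻¹) (ρ (torus r) (w : V)) = w := by
          rw [rep_mul_apply, torus_mul_torus]; simp
        have hc0 : c ≠ 0 := by
          rintro rfl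
          rw [hc] at h1
          exact hw0 (by simpa using h1.symm)
        refine ⟨c⁻¹, ?_⟩
        rw [eq_inv_smul_iff₀ hc0, ← map_smul, ← hc, h1] }
  have hK : ∀ r, ∃ c : k, ρ (torus r) (w : V) = c • (w : V) := by
    intro r
    have : Subgroup.zpowers g ≤ K := by
      rw [Subgroup.zpowers_le]; exact ⟨μ, hgw⟩
    exact this (hg r)
  choose c hc using hK
  refine ⟨⟨⟨c, ?_⟩, ?_⟩, w, w.2, hw0, hU w w.2, hc⟩
  · have := hc 1
    rw [torus_one, map_one] at this
    refine smul_left_injective k hw0 ?_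
    simpa using this.symm
  · intro r s
    refine smul_left_injective k hw0 ?_
    change c (r * s) • (w : V) = (c r * c s) • (w : V)
    rw [← hc, ← torus_mul_torus, ← rep_mul_apply, hc, map_smul, hc, smul_smul, mul_comm]

omit [Fintype F] in
/-- Matrix coefficients between a Borel vector and an `upper`-invariant functional determine an
irreducible representation. -/
theorem isoRep_of_isBorelVec (hρ : ρ.IsIrred) (hρ' : ρ'.IsIrred) (hv : IsBorelVec ρ χ v)
    (hv' : IsBorelVec ρ' χ v') {l : V →ₗ[k] k} {l' : V' →ₗ[k] k} (hl0 : l ≠ 0) (hl0' : l' ≠ 0)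
    (hl : ∀ a w, l (ρ (upper a) w) = l w) (hl' : ∀ a w, l' (ρ' (upper a) w) = l' w)
    (h1 : l v = l' v') (h2 : l (ρ (weyl 1) v) = l' (ρ' (weyl 1) v')) : IsoRep ρ ρ' := by
  refine isoRep_of_coeff_eq hρ hρ' hv.ne_zero hv'.ne_zero hl0 hl0' fun g => ?_
  rcases bruhat g with ⟨r, b, rfl⟩ | ⟨a, s, b, rfl⟩
  · rw [← rep_mul_apply, hv.upper, hv.torus, ← rep_mul_apply, hv'.upper, hv'.torus, map_smul,
      map_smul, h1]
  · rw [← rep_mul_apply, hv.upper, ← rep_mul_apply, hv.weyl, hl, ← rep_mul_apply, hv'.upper,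
      ← rep_mul_apply, hv'.weyl, hl', map_smul, map_smul, h2]

theorem upper_proj_zero (a : F) (w : V) : ρ (upper a) (proj ψ ρ 0 w) = proj ψ ρ 0 w := by
  rw [upper_proj]; simp

theorem proj_zero_upper (a : F) (w : V) : proj ψ ρ 0 (ρ (upper a) w) = proj ψ ρ 0 w := by
  rw [proj_upper]; simp

variable (hψ : ψ.IsPrimitive) (hq : (Fintype.card F : k) ≠ 0)
include hψ hq

theorem IsBorelVec.proj_zero (hv : IsBorelVec ρ χ v) : proj ψ ρ 0 v = v :=
  proj_eq_self hψ hq fun a => by simp [hv.upper]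

omit hq in
theorem IsBorelVec.proj_ne (hv : IsBorelVec ρ χ v) {x : F} (hx : x ≠ 0) : proj ψ ρ x v = 0 :=
  proj_eq_zero hψ hx.symm fun a => by simp [hv.upper]

theorem IsBorelVec.range_proj_zero_le (hρ : ρ.IsIrred) (hv : IsBorelVec ρ χ v) :
    LinearMap.range (proj ψ ρ 0) ≤ Submodule.span k {v, proj ψ ρ 0 (ρ (SLTwo.weyl 1) v)} := by
  rw [LinearMap.range_eq_map, Submodule.map_le_iff_le_comap, top_le_iff]
  refine hv.eq_top hρ ?_ fun a => ?_
  · rw [Submodule.mem_comap, hv.proj_zero hψ hq]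
    exact Submodule.subset_span (by simp)
  · rw [Submodule.mem_comap, proj_zero_upper]
    exact Submodule.subset_span (by simp)

omit hq in
theorem IsBorelVec.range_proj_le (hρ : ρ.IsIrred) (hv : IsBorelVec ρ χ v) {x : F} (hx : x ≠ 0) :
    LinearMap.range (proj ψ ρ x) ≤ Submodule.span k {proj ψ ρ x (ρ (SLTwo.weyl 1) v)} := by
  rw [LinearMap.range_eq_map, Submodule.map_le_iff_le_comap, top_le_iff]
  refine hv.eq_top hρ ?_ fun a => ?_
  · rw [Submodule.mem_comap, hv.proj_ne hψ hx]
    exact Submodule.zero_mem _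
  · rw [Submodule.mem_comap, proj_upper]
    exact Submodule.smul_mem _ _ (Submodule.subset_span (by simp))

omit hq in
theorem IsBorelVec.finrank_range_proj (hρ : ρ.IsIrred) (hv : IsBorelVec ρ χ v) {x : F}
    (hx : x ≠ 0) (h : proj ψ ρ x (ρ (SLTwo.weyl 1) v) ≠ 0) :
    finrank k (LinearMap.range (proj ψ ρ x)) = 1 := by
  have : LinearMap.range (proj ψ ρ x) =
      Submodule.span k {proj ψ ρ x (ρ (SLTwo.weyl 1) v)} := by
    refine le_antisymm (hv.range_proj_le hψ hρ hx) ?_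
    rw [Submodule.span_singleton_le_iff_mem]
    exact ⟨_, rfl⟩
  rw [this, finrank_span_singleton h]

omit hq in
theorem IsBorelVec.proj_eq_bot (hρ : ρ.IsIrred) (hv : IsBorelVec ρ χ v) {x : F}
    (hx : x ≠ 0) (h : proj ψ ρ x (ρ (SLTwo.weyl 1) v) = 0) :
    finrank k (LinearMap.range (proj ψ ρ x)) = 0 := by
  have := hv.range_proj_le hψ hρ hx
  rw [h, Submodule.span_zero_singleton, le_bot_iff] at this
  rw [this, finrank_bot]

omit hψ in
theorem IsBorelVec.proj_weyl_proj [DecidableEq F] (hv : IsBorelVec ρ χ v) (x y : F) :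
    (Fintype.card F : k) • proj ψ ρ y (ρ (SLTwo.weyl 1) (proj ψ ρ x (ρ (SLTwo.weyl 1) v))) =
      χ (-1) • proj ψ ρ y v + (∑ a : Fˣ, ψ (-(a * x)) * (χ (-a) * ψ (-(a⁻¹ : Fˣ) * y))) •
        proj ψ ρ y (ρ (SLTwo.weyl 1) v) := by
  rw [proj_apply x, map_smul, map_smul, smul_smul, mul_inv_cancel₀ hq, one_smul, map_sum, map_sum,
    sum_eq_zero_add_sum_units]
  congr 1
  · simp [hv.weyl_weyl]
  · rw [Finset.sum_smul]
    refine Finset.sum_congr rfl fun a _ => ?_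
    rw [map_smul, map_smul, hv.weyl_upper_weyl, map_smul, proj_upper, smul_smul, smul_smul,
      mul_assoc]

end PrincipalSeries

end SLTwo

namespace SLTwo

open Module

section PrincipalSeries

variable {F k V V' : Type*} [Field F] [Fintype F] [Field k] [AddCommGroup V]
  [Module k V] [AddCommGroup V'] [Module k V']
  {ψ : AddChar F k} {ρ : Representation k (SL2 F) V} {ρ' : Representation k (SL2 F) V'}
  {χ : Fˣ →* k} {v : V} {v' : V'}

/-- The space of `upper`-fixed vectors is two-dimensional, with `torus` acting through `χ` on some
line of it. -/
def IsPrincipal (ψ : AddChar F k) (ρ : Representation k (SL2 F) V) (χ : Fˣ →* k) : Prop :=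
  ∃ v, IsBorelVec ρ χ v ∧ ∀ c : k, c • v ≠ proj ψ ρ 0 (ρ (weyl 1) v)

variable (hψ : ψ.IsPrimitive) (hq : (Fintype.card F : k) ≠ 0)
include hψ hq

theorem IsBorelVec.exists_functional (hv : IsBorelVec ρ χ v)
    (hc : ∀ c : k, c • v ≠ proj ψ ρ 0 (ρ (SLTwo.weyl 1) v)) :
    ∃ l : V →ₗ[k] k, (∀ a z, l (ρ (SLTwo.upper a) z) = l z) ∧ l v = 0 ∧
      l (ρ (SLTwo.weyl 1) v) = 1 := by
  have hnot : proj ψ ρ 0 (ρ (SLTwo.weyl 1) v) ∉ Submodule.span k {v} := by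
    rw [Submodule.mem_span_singleton]
    rintro ⟨c, h⟩
    exact hc c h
  obtain ⟨f, hf, hf'⟩ := Submodule.exists_le_ker_of_notMem hnot
  refine ⟨(f (proj ψ ρ 0 (ρ (SLTwo.weyl 1) v)))⁻¹ • f.comp (proj ψ ρ 0), ?_, ?_, ?_⟩
  · intro a z
    simp [proj_zero_upper]
  · have : f v = 0 := hf' (Submodule.mem_span_singleton_self v)
    simp [hv.proj_zero hψ hq, this]
  · simp [hf]

theorem IsPrincipal.isoRep (hρ : ρ.IsIrred) (hρ' : ρ'.IsIrred) (h : IsPrincipal ψ ρ χ)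
    (h' : IsPrincipal ψ ρ' χ) : IsoRep ρ ρ' := by
  obtain ⟨v, hv, hc⟩ := h
  obtain ⟨v', hv', hc'⟩ := h'
  obtain ⟨l, hl, hl0, hl1⟩ := hv.exists_functional hψ hq hc
  obtain ⟨l', hl', hl0', hl1'⟩ := hv'.exists_functional hψ hq hc'
  refine isoRep_of_isBorelVec hρ hρ' hv hv' ?_ ?_ hl hl' (hl0.trans hl0'.symm)
    (hl1.trans hl1'.symm)
  · rintro rfl; simp at hl1
  · rintro rfl; simp at hl1'

theorem IsBorelVec.range_eq_of_smul (hρ : ρ.IsIrred) (hv : IsBorelVec ρ χ v) {c : k}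
    (hc : c • v = proj ψ ρ 0 (ρ (SLTwo.weyl 1) v)) :
    LinearMap.range (proj ψ ρ 0) = Submodule.span k {v} := by
  refine le_antisymm ((hv.range_proj_zero_le hψ hq hρ).trans ?_) ?_
  · rw [Submodule.span_le, ← hc]
    rintro x (rfl | rfl)
    · exact Submodule.mem_span_singleton_self _
    · exact Submodule.smul_mem _ _ (Submodule.mem_span_singleton_self _)
  · rw [Submodule.span_singleton_le_iff_mem]
    exact ⟨v, hv.proj_zero hψ hq⟩

omit hψ hq in
theorem IsBorelVec.linearIndependent (hv : IsBorelVec ρ χ v)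
    (hc : ∀ c : k, c • v ≠ proj ψ ρ 0 (ρ (SLTwo.weyl 1) v)) :
    LinearIndependent k ![v, proj ψ ρ 0 (ρ (SLTwo.weyl 1) v)] :=
  (LinearIndependent.pair_iff' hv.ne_zero).2 hc

theorem IsBorelVec.finrank_range_proj_zero (hρ : ρ.IsIrred) (hv : IsBorelVec ρ χ v)
    (hc : ∀ c : k, c • v ≠ proj ψ ρ 0 (ρ (SLTwo.weyl 1) v)) :
    finrank k (LinearMap.range (proj ψ ρ 0)) = 2 := by
  have h1 := finrank_span_eq_card (hv.linearIndependent hc)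
  have h2 : LinearMap.range (proj ψ ρ 0) =
      Submodule.span k (Set.range ![v, proj ψ ρ 0 (ρ (SLTwo.weyl 1) v)]) := by
    rw [Matrix.range_cons, Matrix.range_cons, Matrix.range_empty, Set.union_empty,
      Set.singleton_union]
    refine le_antisymm (hv.range_proj_zero_le hψ hq hρ) ?_
    rw [Submodule.span_le]
    rintro x (rfl | rfl)
    · exact ⟨_, hv.proj_zero hψ hq⟩
    · exact ⟨_, rfl⟩
  rw [h2, h1, Fintype.card_fin]

/-- Once one line generates a two-dimensional space of fixed vectors, every Borel vector does. -/
theorem IsBorelVec.smul_ne_of_finrank (hρ : ρ.IsIrred) (hv : IsBorelVec ρ χ v)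
    (h : finrank k (LinearMap.range (proj ψ ρ 0)) = 2) (c : k) :
    c • v ≠ proj ψ ρ 0 (ρ (SLTwo.weyl 1) v) := by
  intro hc
  rw [hv.range_eq_of_smul hψ hq hρ hc, finrank_span_singleton hv.ne_zero] at h
  omega

omit hψ hq in
theorem IsBorelVec.inv (hv : IsBorelVec ρ χ v)
    (hc : ∀ c : k, c • v ≠ proj ψ ρ 0 (ρ (SLTwo.weyl 1) v)) :
    IsBorelVec ρ (χ.comp (invMonoidHom : Fˣ →* Fˣ)) (proj ψ ρ 0 (ρ (SLTwo.weyl 1) v)) where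
  ne_zero h := hc 0 (by rw [h, zero_smul])
  upper a := upper_proj_zero a _
  torus r := by
    rw [torus_proj, rep_mul_apply, torus_mul_weyl, hv.weyl, map_smul]
    simp

theorem IsPrincipal.inv (hρ : ρ.IsIrred) (h : IsPrincipal ψ ρ χ) :
    IsPrincipal ψ ρ (χ.comp (invMonoidHom : Fˣ →* Fˣ)) := by
  obtain ⟨v, hv, hc⟩ := h
  exact ⟨_, hv.inv hc, (hv.inv hc).smul_ne_of_finrank hψ hq hρ
    (hv.finrank_range_proj_zero hψ hq hρ hc)⟩

theorem IsPrincipal.exists_sq_ne_one [IsAlgClosed k] [FiniteDimensional k V] (hρ : ρ.IsIrred)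
    (h : IsPrincipal ψ ρ χ) : ∃ r, χ r ^ 2 ≠ 1 := by
  by_contra! hχ
  obtain ⟨v, hv, hc⟩ := h
  have h2 := hv.finrank_range_proj_zero hψ hq hρ hc
  have hinv : ∀ r, χ r⁻¹ = χ r := by
    intro r
    have h1 : χ r * χ r⁻¹ = 1 := by rw [← map_mul, mul_inv_cancel, map_one]
    have h0 : χ r ≠ 0 := left_ne_zero_of_mul_eq_one h1
    refine mul_left_cancel₀ h0 ?_
    rw [h1, ← sq, hχ]
  have hall : ∀ w ∈ LinearMap.range (proj ψ ρ 0), w ≠ 0 → IsBorelVec ρ χ w := by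
    intro w hw hw0
    refine ⟨hw0, ?_, ?_⟩
    · obtain ⟨z, rfl⟩ := hw
      exact fun a => upper_proj_zero a z
    · intro r
      obtain ⟨a, b, rfl⟩ := Submodule.mem_span_pair.1 (hv.range_proj_zero_le hψ hq hρ hw)
      rw [map_add, map_smul, map_smul, hv.torus, (hv.inv hc).torus]
      simp only [MonoidHom.comp_apply, invMonoidHom_apply, hinv]
      module
  have : Nontrivial (LinearMap.range (proj ψ ρ 0)) :=
    nontrivial_of_finrank_pos (R := k) (by omega)
  obtain ⟨μ, hμ⟩ := Module.End.exists_eigenvalue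
    (((proj ψ ρ 0).comp (ρ (weyl 1))).restrict (p := LinearMap.range (proj ψ ρ 0))
      (q := LinearMap.range (proj ψ ρ 0)) fun w _ => ⟨_, rfl⟩)
  obtain ⟨w, hw⟩ := hμ.exists_hasEigenvector
  have hw0 : (w : V) ≠ 0 := fun h => hw.2 (Subtype.ext h)
  have hwμ : proj ψ ρ 0 (ρ (weyl 1) (w : V)) = μ • (w : V) :=
    congrArg Subtype.val hw.apply_eq_smul
  exact (hall w w.2 hw0).smul_ne_of_finrank hψ hq hρ h2 μ hwμ.symm

theorem IsPrincipal.finrank_eq [FiniteDimensional k V] (hρ : ρ.IsIrred)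
    (h : IsPrincipal ψ ρ χ) : finrank k V = Fintype.card F + 1 := by
  classical
  obtain ⟨v, hv, hc⟩ := h
  have hne : ∀ x : F, x ≠ 0 → finrank k (LinearMap.range (proj ψ ρ x)) = 1 := by
    intro x hx
    refine hv.finrank_range_proj hψ hρ hx fun h0 => ?_
    have h1 := hv.proj_weyl_proj hq (ψ := ψ) x 0
    rw [h0, map_zero, map_zero, smul_zero, hv.proj_zero hψ hq] at h1
    have h2 := LinearIndependent.pair_iff.1 (hv.linearIndependent hc) _ _ h1.symm
    have h3 : χ (-1) * χ (-1) = 1 := by rw [← map_mul]; simp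
    exact left_ne_zero_of_mul_eq_one h3 h2.1
  rw [finrank_eq_sum hψ hq (ρ := ρ), sum_eq_zero_add_sum_units,
    hv.finrank_range_proj_zero hψ hq hρ hc]
  simp only [hne _ (Units.ne_zero _)]
  rw [Finset.sum_const, Finset.card_univ, Fintype.card_units]
  have := Fintype.card_pos (α := F)
  simp
  omega

omit hq in
theorem sum_units_char [DecidableEq F] {x : F} (hx : x ≠ 0) : ∑ a : Fˣ, ψ (a * x) = -1 := by
  have := AddChar.sum_mulShift x hψ
  rw [if_neg hx, Nat.cast_zero, sum_eq_zero_add_sum_units] at this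
  simp only [zero_mul, AddChar.map_zero_eq_one] at this
  linear_combination this

end PrincipalSeries

end SLTwo

namespace SLTwo

open Module

section Count

variable {F k V : Type*} [Field F] [Fintype F] [Field k] [IsAlgClosed k] [AddCommGroup V]
  [Module k V] [FiniteDimensional k V]
  {ψ : AddChar F k} {χ : Fˣ →* k} {v : V}

open Polynomial in
theorem card_le_of_geom_sum {k : Type*} [Field k] {m d : ℕ} (hm : 0 < m) (hd : 0 < d)
    {ι : Type*} [Fintype ι] (z : ι → k)
    (hz : Function.Injective z) (h1 : ∀ i, z i ^ (d * m) = 1) (h2 : ∀ i, z i ^ d ≠ 1) :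
    Fintype.card ι + d ≤ d * m := by
  classical
  let p : k[X] := ∑ j ∈ Finset.range m, X ^ (d * j)
  have hp : p ≠ 0 := by
    intro h0
    have h1 : p.eval 0 = 1 := by
      rw [eval_finsetSum, Finset.sum_eq_single 0]
      · simp
      · intro j _ hj
        simp [hj, hd.ne']
      · intro h; exact absurd (Finset.mem_range.2 hm) h
    simp [h0] at h1
  have hdeg : p.natDegree ≤ d * (m - 1) := by
    refine natDegree_sum_le_of_forall_le _ _ fun j hj => ?_
    rw [natDegree_X_pow]
    have := Finset.mem_range.1 hj
    exact Nat.mul_le_mul_left _ (by omega)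
  have hroot : ∀ i, p.IsRoot (z i) := by
    intro i
    have := geom_sum_mul (z i ^ d) m
    rw [← pow_mul, h1, sub_self] at this
    rw [IsRoot, eval_finsetSum]
    simp only [eval_pow, eval_X, pow_mul]
    exact (mul_eq_zero.1 this).resolve_right (sub_ne_zero.2 (h2 i))
  have hcard : Fintype.card ι ≤ p.roots.toFinset.card := by
    rw [← Finset.card_univ, ← Finset.card_image_of_injective _ hz]
    refine Finset.card_le_card fun x hx => ?_
    obtain ⟨i, -, rfl⟩ := Finset.mem_image.1 hx
    rw [Multiset.mem_toFinset, mem_roots hp]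
    exact hroot i
  have h3 := Multiset.toFinset_card_le p.roots
  have h4 := card_roots' p
  obtain ⟨m, rfl⟩ := Nat.exists_eq_succ_of_ne_zero hm.ne'
  simp only [Nat.succ_eq_add_one, Nat.add_sub_cancel] at hdeg
  rw [Nat.mul_succ]
  omega

/-- The values at a generator of the torus characters of a family of principal series
representations, together with their inverses, are pairwise distinct. -/
theorem exists_injective_of_isPrincipal (hψ : ψ.IsPrimitive) (hq : (Fintype.card F : k) ≠ 0)
    {ι : Type*} {ρ : ι → Representation k (SL2 F) V}
    (hρ : ∀ i, (ρ i).IsIrred) (hne : ∀ i j, IsoRep (ρ i) (ρ j) → i = j)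
    (h : ∀ i, ∃ χ, IsPrincipal ψ (ρ i) χ) :
    ∃ z : ι ⊕ ι → k, Function.Injective z ∧ (∀ i, z i ^ (Fintype.card F - 1) = 1) ∧
      ∀ i, z i ^ 2 ≠ 1 := by
  classical
  choose χ hχ using h
  obtain ⟨g, hg⟩ := IsCyclic.exists_generator (α := Fˣ)
  have hext : ∀ χ₁ χ₂ : Fˣ →* k, χ₁ g = χ₂ g → χ₁ = χ₂ := by
    intro χ₁ χ₂ h12
    ext r
    obtain ⟨m, rfl⟩ := mem_powers_iff_mem_zpowers.2 (hg r)
    simp [map_pow, h12]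
  let inv : (Fˣ →* k) → (Fˣ →* k) := fun χ => χ.comp (invMonoidHom : Fˣ →* Fˣ)
  let X : ι ⊕ ι → (Fˣ →* k) := Sum.elim χ fun i => inv (χ i)
  have hX : ∀ i, IsPrincipal ψ (ρ (Sum.elim id id i)) (X i) := by
    rintro (i | i)
    · exact hχ i
    · exact (hχ i).inv hψ hq (hρ i)
  have hsq : ∀ i, X i g ^ 2 ≠ 1 := by
    intro i h1
    obtain ⟨r, hr⟩ := (hX i).exists_sq_ne_one hψ hq (hρ _)
    obtain ⟨m, rfl⟩ := mem_powers_iff_mem_zpowers.2 (hg r)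
    apply hr
    simp only [map_pow]
    rw [← pow_mul, mul_comm, pow_mul, h1, one_pow]
  have hself : ∀ i, χ i ≠ inv (χ i) := by
    intro i h1
    apply hsq (.inl i)
    have h2 : χ i g = χ i g⁻¹ := DFunLike.congr_fun h1 g
    change χ i g ^ 2 = 1
    rw [sq]
    nth_rw 2 [h2]
    rw [← map_mul, mul_inv_cancel, map_one]
  refine ⟨fun i => X i g, ?_, ?_, hsq⟩
  · intro i j hij
    have hij := hext _ _ hij
    have h1 : Sum.elim id id i = Sum.elim id id j := by
      refine hne _ _ ((hX i).isoRep hψ hq (hρ _) (hρ _) ?_)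
      rw [hij]
      exact hX j
    rcases i with i | i <;> rcases j with j | j <;> simp only [Sum.elim_inl, Sum.elim_inr, id] at h1
      <;> subst h1
    · rfl
    · exact absurd hij (hself i)
    · exact absurd hij.symm (hself i)
    · rfl
  · intro i
    rw [← map_pow, ← Fintype.card_units, pow_card_eq_one, map_one]

theorem card_isPrincipal_le (hψ : ψ.IsPrimitive) (hq : (Fintype.card F : k) ≠ 0)
    {ι : Type*} [Fintype ι] {ρ : ι → Representation k (SL2 F) V}
    (hρ : ∀ i, (ρ i).IsIrred) (hne : ∀ i j, IsoRep (ρ i) (ρ j) → i = j)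
    (h : ∀ i, ∃ χ, IsPrincipal ψ (ρ i) χ) :
    2 * Fintype.card ι + 2 ≤ Fintype.card F ∧
      (Odd (Fintype.card F) → 2 * Fintype.card ι + 3 ≤ Fintype.card F) := by
  obtain ⟨z, hz, h1, h2⟩ := exists_injective_of_isPrincipal hψ hq hρ hne h
  have hF := Fintype.one_lt_card (α := F)
  constructor
  · have := card_le_of_geom_sum (m := Fintype.card F - 1) (d := 1) (by omega) one_pos z hz
      (by simpa using h1) (fun i hi => h2 i (by rw [pow_one] at hi; rw [hi, one_pow]))
    rw [Fintype.card_sum] at this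
    omega
  · rintro ⟨c, hc⟩
    have := card_le_of_geom_sum (m := c) (d := 2) (by omega) two_pos z hz
      (fun i => by rw [← h1 i, hc]; congr 1) h2
    rw [Fintype.card_sum] at this
    omega

end Count

end SLTwo

namespace SLTwo

open Module

section SquareClasses

variable (F : Type*) [Field F] [Fintype F]

theorem exists_square_classes : ∃ g : Fˣ, (∀ x : Fˣ, x ∈ Subgroup.zpowers g) ∧
    ∀ x : Fˣ, (∃ r : Fˣ, x = r ^ 2) ∨ ∃ r : Fˣ, x = g * r ^ 2 := by
  obtain ⟨g, hg⟩ := IsCyclic.exists_generator (α := Fˣ)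
  refine ⟨g, hg, fun x => ?_⟩
  obtain ⟨m, rfl⟩ := hg x
  rcases Int.even_or_odd' m with ⟨j, rfl | rfl⟩
  · refine Or.inl ⟨g ^ j, ?_⟩
    change g ^ (2 * j) = _
    rw [mul_comm, zpow_mul]; norm_cast
  · refine Or.inr ⟨g ^ j, ?_⟩
    change g ^ (2 * j + 1) = _
    rw [add_comm, zpow_add, zpow_one, mul_comm 2, zpow_mul]; norm_cast

/-- A generator of the unit group; it represents the second square class when there is one. -/
noncomputable def nsq : Fˣ := (exists_square_classes F).choose

variable {F}

theorem mem_zpowers_nsq (x : Fˣ) : x ∈ Subgroup.zpowers (nsq F) :=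
  (exists_square_classes F).choose_spec.1 x

theorem eq_sq_or (x : Fˣ) : (∃ r : Fˣ, x = r ^ 2) ∨ ∃ r : Fˣ, x = nsq F * r ^ 2 :=
  (exists_square_classes F).choose_spec.2 x

theorem two_mul_sum_units [DecidableEq F] {d : F → ℕ}
    (hd : ∀ (x : F) (r : Fˣ), d (x * (r : F) ^ 2) = d x) :
    2 * ∑ x : Fˣ, d x = (Fintype.card F - 1) * (d 1 + d (nsq F)) := by
  have h1 : ∑ x : Fˣ, d x = ∑ x : Fˣ, d (nsq F * x : Fˣ) :=
    (Fintype.sum_equiv (Equiv.mulLeft (nsq F)) _ _ fun x => rfl).symm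
  rw [two_mul]
  nth_rw 2 [h1]
  rw [← Finset.sum_add_distrib, Finset.sum_congr rfl (g := fun _ => d 1 + d (nsq F)),
    Finset.sum_const, Finset.card_univ, Fintype.card_units, smul_eq_mul]
  intro x _
  rcases eq_sq_or x with ⟨r, rfl⟩ | ⟨r, rfl⟩
  · have h1 := hd 1 r
    have h2 := hd (nsq F) r
    rw [one_mul] at h1
    push_cast
    rw [h1, h2]
  · have h1 := hd (nsq F) r
    have h2 := hd 1 (nsq F * r)
    rw [one_mul] at h2
    rw [add_comm (d 1), ← h2, ← h1]
    push_cast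
    congr 2
    ring

end SquareClasses

section Steinberg

variable {F k V V' : Type*} [Field F] [Fintype F] [Field k] [AddCommGroup V]
  [Module k V] [AddCommGroup V'] [Module k V']
  {ψ : AddChar F k} {ρ : Representation k (SL2 F) V} {ρ' : Representation k (SL2 F) V'}
  {χ : Fˣ →* k} {β : k} {v : V}

/-- The space of `upper`-fixed vectors is a line on which `torus` acts through `χ`. -/
def IsLinear (ψ : AddChar F k) (ρ : Representation k (SL2 F) V) (χ : Fˣ →* k) (β : k) : Prop :=
  ∃ v, IsBorelVec ρ χ v ∧ β • v = proj ψ ρ 0 (ρ (weyl 1) v)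

variable (hψ : ψ.IsPrimitive) (hq : (Fintype.card F : k) ≠ 0)
include hψ hq

theorem IsBorelVec.exists_functional_of_smul (hv : IsBorelVec ρ χ v)
    (hβ : β • v = proj ψ ρ 0 (ρ (SLTwo.weyl 1) v)) :
    ∃ l : V →ₗ[k] k, (∀ a z, l (ρ (SLTwo.upper a) z) = l z) ∧ l v = 1 ∧
      l (ρ (SLTwo.weyl 1) v) = β := by
  have hnot : v ∉ (⊥ : Submodule k V) := hv.ne_zero
  obtain ⟨f, hf, -⟩ := Submodule.exists_le_ker_of_notMem hnot
  refine ⟨(f v)⁻¹ • f.comp (proj ψ ρ 0), ?_, ?_, ?_⟩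
  · intro a z
    simp [proj_zero_upper]
  · simp [hv.proj_zero hψ hq, hf]
  · simp [← hβ]
    field_simp

theorem IsLinear.isoRep (hρ : ρ.IsIrred) (hρ' : ρ'.IsIrred) (h : IsLinear ψ ρ χ β)
    (h' : IsLinear ψ ρ' χ β) : IsoRep ρ ρ' := by
  obtain ⟨v, hv, hc⟩ := h
  obtain ⟨v', hv', hc'⟩ := h'
  obtain ⟨l, hl, hl0, hl1⟩ := hv.exists_functional_of_smul hψ hq hc
  obtain ⟨l', hl', hl0', hl1'⟩ := hv'.exists_functional_of_smul hψ hq hc'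
  refine isoRep_of_isBorelVec hρ hρ' hv hv' ?_ ?_ hl hl' (hl0.trans hl0'.symm)
    (hl1.trans hl1'.symm)
  · rintro rfl; simp at hl0
  · rintro rfl; simp at hl0'

theorem isLinear_one_one : IsLinear ψ (1 : Representation k (SL2 F) k) 1 1 := by
  have hv : IsBorelVec (1 : Representation k (SL2 F) k) 1 1 := ⟨one_ne_zero, by simp, by simp⟩
  refine ⟨1, hv, ?_⟩
  have := hv.proj_zero hψ hq
  simpa using this.symm

omit hψ hq [Fintype F] in
theorem isIrred_one : (1 : Representation k (SL2 F) k).IsIrred := fun U _ =>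
  eq_bot_or_eq_top (show Ideal k from U)

theorem IsLinear.finrank_eq_one_of (hρ : ρ.IsIrred) (h : IsLinear ψ ρ 1 1) : finrank k V = 1 := by
  obtain ⟨e, -⟩ := h.isoRep hψ hq hρ isIrred_one (isLinear_one_one hψ hq)
  rw [e.finrank_eq, finrank_self]

theorem IsBorelVec.smul_ne_zero (hv : IsBorelVec ρ χ v)
    (hβ : β • v = proj ψ ρ 0 (ρ (SLTwo.weyl 1) v)) : β ≠ 0 := by
  classical
  rintro rfl
  have h1 := hv.proj_weyl_proj hq (ψ := ψ) 0 0
  rw [← hβ, hv.proj_zero hψ hq, zero_smul, map_zero, map_zero, smul_zero, smul_zero, add_zero] at h1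
  have h3 : χ (-1) * χ (-1) = 1 := by rw [← map_mul]; simp
  exact (smul_eq_zero.1 h1.symm).elim (left_ne_zero_of_mul_eq_one h3) hv.ne_zero

theorem IsBorelVec.sq_eq_one (hv : IsBorelVec ρ χ v)
    (hβ : β • v = proj ψ ρ 0 (ρ (SLTwo.weyl 1) v)) (r : Fˣ) : χ r ^ 2 = 1 := by
  have hβ0 := hv.smul_ne_zero hψ hq hβ
  have h1 : ρ (SLTwo.torus r) (β • v) = χ r⁻¹ • β • v := by
    rw [hβ, torus_proj, rep_mul_apply, torus_mul_weyl, hv.weyl, map_smul]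
    simp
  rw [map_smul, hv.torus, smul_comm] at h1
  have h2 : χ r = χ r⁻¹ := smul_left_injective k (_root_.smul_ne_zero hβ0 hv.ne_zero) h1
  rw [sq]
  nth_rw 2 [h2]
  rw [← map_mul, mul_inv_cancel, map_one]

theorem IsBorelVec.sum_eq [DecidableEq F] (hv : IsBorelVec ρ χ v)
    (hβ : β • v = proj ψ ρ 0 (ρ (SLTwo.weyl 1) v)) {y : F} (hy : y ≠ 0)
    (h : proj ψ ρ y (ρ (SLTwo.weyl 1) v) ≠ 0) :
    ∑ b : Fˣ, χ b * ψ (b * y) = Fintype.card F * β := by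
  have h1 := hv.proj_weyl_proj hq (ψ := ψ) 0 y
  rw [← hβ, map_smul, map_smul, hv.proj_ne hψ hy, smul_zero, zero_add, smul_smul] at h1
  have h2 := smul_left_injective k h h1
  rw [h2]
  refine Fintype.sum_equiv ((Equiv.inv Fˣ).trans (Equiv.neg Fˣ)) _ _ fun b => ?_
  have : χ b⁻¹ = χ b := by
    have h3 := hv.sq_eq_one hψ hq hβ b
    have h4 : χ b * χ b⁻¹ = 1 := by rw [← map_mul, mul_inv_cancel, map_one]
    exact mul_left_cancel₀ (left_ne_zero_of_mul_eq_one h4) (by rw [h4, ← sq, h3])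
  simp only [Equiv.trans_apply, Equiv.inv_apply, Equiv.neg_apply, neg_neg]
  rw [this, mul_zero, neg_zero, AddChar.map_zero_eq_one, one_mul, inv_neg, inv_inv,
    Units.val_neg, neg_neg]

theorem IsBorelVec.finrank_range_proj_zero_of_smul (hρ : ρ.IsIrred) (hv : IsBorelVec ρ χ v)
    (hβ : β • v = proj ψ ρ 0 (ρ (SLTwo.weyl 1) v)) :
    finrank k (LinearMap.range (proj ψ ρ 0)) = 1 := by
  rw [hv.range_eq_of_smul hψ hq hρ hβ, finrank_span_singleton hv.ne_zero]

theorem IsLinear.of_one [FiniteDimensional k V] (hρ : ρ.IsIrred) (hV : finrank k V ≠ 1)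
    (h : IsLinear ψ ρ 1 β) : Fintype.card F * β = -1 ∧ finrank k V = Fintype.card F := by
  classical
  have h0 := h
  obtain ⟨v, hv, hβ⟩ := h
  have hne : ∀ x : F, x ≠ 0 → finrank k (LinearMap.range (proj ψ ρ x)) = 1 := by
    intro x hx
    refine hv.finrank_range_proj hψ hρ hx fun hz => ?_
    have h1 := hv.proj_weyl_proj hq (ψ := ψ) x 0
    have h2 := sum_units_char hψ (neg_ne_zero.2 hx)
    simp only [mul_neg] at h2
    rw [hz, map_zero, map_zero, smul_zero, hv.proj_zero hψ hq, ← hβ] at h1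
    simp only [MonoidHom.one_apply, one_smul, mul_zero, AddChar.map_zero_eq_one, mul_one,
      h2, neg_one_smul] at h1
    have h3 : (1 - β) • v = 0 := by rw [sub_smul, one_smul, sub_eq_add_neg, ← h1]
    have h4 : β = 1 := ((sub_eq_zero.1 ((smul_eq_zero.1 h3).resolve_right hv.ne_zero))).symm
    rw [h4] at h0
    exact hV (h0.finrank_eq_one_of hψ hq hρ)
  constructor
  · rw [← hv.sum_eq hψ hq hβ one_ne_zero]
    · simpa using sum_units_char hψ (one_ne_zero (α := F))
    · intro hz
      have := hne 1 one_ne_zero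
      rw [hv.proj_eq_bot hψ hρ one_ne_zero hz] at this
      exact absurd this (by norm_num)
  · rw [finrank_eq_sum hψ hq (ρ := ρ), sum_eq_zero_add_sum_units,
      hv.finrank_range_proj_zero_of_smul hψ hq hρ hβ]
    simp only [hne _ (Units.ne_zero _)]
    rw [Finset.sum_const, Finset.card_univ, Fintype.card_units]
    have := Fintype.card_pos (α := F)
    simp
    omega

omit hψ hq in
theorem map_nsq_of_ne_one (hχ : χ ≠ 1) (hsq : ∀ r, χ r ^ 2 = 1) : χ (nsq F) = -1 := by
  rcases mul_self_eq_one_iff.1 ((sq _).symm.trans (hsq (nsq F))) with h | h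
  · refine absurd ?_ hχ
    ext r
    obtain ⟨m, rfl⟩ := mem_powers_iff_mem_zpowers.2 (mem_zpowers_nsq r)
    simp [h]
  · exact h

theorem IsLinear.of_ne_one [DecidableEq F] [FiniteDimensional k V] (hρ : ρ.IsIrred)
    (hV : finrank k V ≠ 1) (hχ : χ ≠ 1) (h : IsLinear ψ ρ χ β) :
    (∀ r, χ r ^ 2 = 1) ∧ 2 * finrank k V = Fintype.card F + 1 ∧
      (Fintype.card F * β = ∑ b : Fˣ, χ b * ψ b ∨ Fintype.card F * β = -∑ b : Fˣ, χ b * ψ b) := by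
  obtain ⟨v, hv, hβ⟩ := h
  have hsq := hv.sq_eq_one hψ hq hβ
  refine ⟨hsq, ?_⟩
  have hg := map_nsq_of_ne_one hχ hsq
  set G := ∑ b : Fˣ, χ b * ψ b with hG
  set d : F → ℕ := fun x => finrank k (LinearMap.range (proj ψ ρ x)) with hd
  have hd2 : ∀ (x : F) (r : Fˣ), d (x * (r : F) ^ 2) = d x := finrank_range_proj_mul_sq
  have hsum := two_mul_sum_units hd2
  have hfin : finrank k V = 1 + ∑ x : Fˣ, d x := by
    rw [finrank_eq_sum hψ hq (ρ := ρ), sum_eq_zero_add_sum_units,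
      hv.finrank_range_proj_zero_of_smul hψ hq hρ hβ]
  have hle : ∀ y : Fˣ, d y = 0 ∨ (d y = 1 ∧ χ y * G = Fintype.card F * β) := by
    intro y
    by_cases hz : proj ψ ρ y (ρ (SLTwo.weyl 1) v) = 0
    · exact Or.inl (hv.proj_eq_bot hψ hρ y.ne_zero hz)
    · refine Or.inr ⟨hv.finrank_range_proj hψ hρ y.ne_zero hz, ?_⟩
      rw [← hv.sum_eq hψ hq hβ y.ne_zero hz, hG, Finset.mul_sum]
      refine Fintype.sum_equiv (Equiv.mulRight y⁻¹) _ _ fun b => ?_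
      have : χ y⁻¹ = χ y := by
        have h4 : χ y * χ y⁻¹ = 1 := by rw [← map_mul, mul_inv_cancel, map_one]
        exact mul_left_cancel₀ (left_ne_zero_of_mul_eq_one h4) (by rw [h4, ← sq, hsq])
      simp [this]
      ring
  have h1 := hle 1
  have h2 := hle (nsq F)
  rw [map_one, one_mul, Units.val_one] at h1
  rw [hg, neg_one_mul] at h2
  have hF := Fintype.one_lt_card (α := F)
  have hβ0 := hv.smul_ne_zero hψ hq hβ
  have hk : (2 : k) ≠ 0 := by
    intro h2
    apply hχ
    ext r
    have h3 : χ r ^ 2 - 1 = (χ r - 1) ^ 2 := by linear_combination (-1 + χ r) * h2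
    rw [hsq, sub_self] at h3
    simpa using sub_eq_zero.1 (pow_eq_zero_iff two_ne_zero |>.1 h3.symm)
  rcases h1 with h1 | ⟨h1, h1'⟩ <;> rcases h2 with h2 | ⟨h2, h2'⟩ <;> rw [h1, h2] at hsum
  · exfalso
    apply hV
    omega
  · exact ⟨by omega, Or.inr h2'.symm⟩
  · exact ⟨by omega, Or.inl h1'.symm⟩
  · exfalso
    rw [← h1'] at h2'
    have hG0 : G = 0 := by
      have : 2 * G = 0 := by linear_combination -h2'
      exact (mul_eq_zero.1 this).resolve_left hk
    rw [hG0] at h1'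
    exact mul_ne_zero hq hβ0 h1'.symm

omit hψ hq in
theorem exists_isPrincipal_or_isLinear [IsAlgClosed k] [FiniteDimensional k V]
    (h : proj ψ ρ 0 ≠ 0) :
    ∃ χ, IsPrincipal ψ ρ χ ∨ ∃ β, IsLinear ψ ρ χ β := by
  obtain ⟨χ, w, -, hw⟩ := exists_isBorelVec (ρ := ρ) (S := LinearMap.range (proj ψ ρ 0))
    (fun h0 => h (LinearMap.range_eq_bot.1 h0)) (by
      rintro _ ⟨z, rfl⟩ a
      exact upper_proj_zero a z) (by
      rintro _ ⟨z, rfl⟩ r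
      refine ⟨ρ (torus r) z, ?_⟩
      rw [torus_proj, zero_mul])
  refine ⟨χ, ?_⟩
  by_cases hc : ∀ c : k, c • w ≠ proj ψ ρ 0 (ρ (weyl 1) w)
  · exact Or.inl ⟨w, hw, hc⟩
  · push Not at hc
    obtain ⟨c, hc⟩ := hc
    exact Or.inr ⟨c, w, hw, hc⟩

end Steinberg

section Counts

variable {F k V ι : Type*} [Field F] [Fintype F] [Field k] [AddCommGroup V]
  [Module k V] [FiniteDimensional k V] [Fintype ι] {ψ : AddChar F k}
  {ρ : ι → Representation k (SL2 F) V}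

theorem card_isLinear_one_le (hψ : ψ.IsPrimitive) (hq : (Fintype.card F : k) ≠ 0)
    (hρ : ∀ i, (ρ i).IsIrred) (hne : ∀ i j, IsoRep (ρ i) (ρ j) → i = j) (hV : finrank k V ≠ 1)
    (h : ∀ i, ∃ β, IsLinear ψ (ρ i) 1 β) : Fintype.card ι ≤ 1 := by
  rw [Fintype.card_le_one_iff]
  intro i j
  obtain ⟨β, hi⟩ := h i
  obtain ⟨β', hj⟩ := h j
  have h1 := (hi.of_one hψ hq (hρ i) hV).1
  rw [← (hj.of_one hψ hq (hρ j) hV).1] at h1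
  rw [mul_left_cancel₀ hq h1] at hi
  exact hne i j (hi.isoRep hψ hq (hρ i) (hρ j) hj)

theorem card_isLinear_le_two (hψ : ψ.IsPrimitive) (hq : (Fintype.card F : k) ≠ 0)
    (hρ : ∀ i, (ρ i).IsIrred) (hne : ∀ i j, IsoRep (ρ i) (ρ j) → i = j) (hV : finrank k V ≠ 1)
    (h : ∀ i, ∃ χ β, χ ≠ 1 ∧ IsLinear ψ (ρ i) χ β) : Fintype.card ι ≤ 2 := by
  classical
  choose χ β hχ hl using h
  have h1 := fun i => (hl i).of_ne_one hψ hq (hρ i) hV (hχ i)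
  have hχχ : ∀ i j, χ i = χ j := by
    intro i j
    ext r
    obtain ⟨m, rfl⟩ := mem_powers_iff_mem_zpowers.2 (mem_zpowers_nsq r)
    simp [map_nsq_of_ne_one (hχ i) (h1 i).1, map_nsq_of_ne_one (hχ j) (h1 j).1]
  have hinj : Function.Injective fun i =>
      decide (Fintype.card F * β i = ∑ b : Fˣ, χ i b * ψ b) := by
    intro i j hij
    simp only [decide_eq_decide] at hij
    have hβ : β i = β j := by
      apply mul_left_cancel₀ hq
      by_cases hc : Fintype.card F * β i = ∑ b : Fˣ, χ i b * ψ b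
      · rw [hc, hij.1 hc, hχχ i j]
      · rw [(h1 i).2.2.resolve_left hc, (h1 j).2.2.resolve_left (fun h => hc (hij.2 h)), hχχ i j]
    refine hne i j ((hl i).isoRep hψ hq (hρ i) (hρ j) ?_)
    rw [hβ, hχχ i j]
    exact hl j
  simpa using Fintype.card_le_of_injective _ hinj

end Counts

end SLTwo

namespace SLTwo

open Module

section Commutative

variable {G k V : Type*} [Group G] [Field k] [IsAlgClosed k] [AddCommGroup V]
  [Module k V] [FiniteDimensional k V] {σ : Representation k G V}

/-- If the compressions of a group action to the range of an endomorphism commute, then on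
an irreducible module the endomorphism has rank at most one. -/
theorem finrank_range_le_one_of_comm (hσ : σ.IsIrred) {E : V →ₗ[k] V}
    (hc : ∀ g h v, E (σ g (E (σ h (E v)))) = E (σ h (E (σ g (E v))))) :
    finrank k (LinearMap.range E) ≤ 1 := by
  by_cases hE0 : LinearMap.range E = ⊥
  · rw [hE0]; simp
  have hsc : ∀ g, ∃ μ : k, ∀ v, E (σ g (E v)) = μ • E v := by
    intro g
    have : Nontrivial (LinearMap.range E) := Submodule.nontrivial_iff_ne_bot.2 hE0
    obtain ⟨μ, hμ⟩ := Module.End.exists_eigenvalue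
      ((E.comp (σ g)).restrict (p := LinearMap.range E) (q := LinearMap.range E)
        fun w _ => ⟨_, rfl⟩)
    obtain ⟨⟨_, w, rfl⟩, hw⟩ := hμ.exists_hasEigenvector
    have hw0 : E w ≠ 0 := fun h => hw.2 (Subtype.ext h)
    have hw1 : E (σ g (E w)) = μ • E w := congrArg Subtype.val hw.apply_eq_smul
    refine ⟨μ, fun v => ?_⟩
    have hv : v ∈ Submodule.span k (Set.range fun g => σ g (E w)) := by
      rw [span_orbit_eq_top hσ hw0]; trivial
    induction hv using Submodule.span_induction with
    | mem x hx =>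
      obtain ⟨h, rfl⟩ := hx
      dsimp only
      rw [hc, hw1, map_smul, map_smul]
    | zero => simp
    | add x y _ _ hx hy => simp only [map_add, hx, hy, smul_add]
    | smul a x _ hx => simp only [map_smul, hx, smul_comm μ a]
  obtain ⟨_, ⟨w, rfl⟩, hw0⟩ := Submodule.exists_mem_ne_zero_of_ne_bot hE0
  refine finrank_le_one (⟨E w, w, rfl⟩ : LinearMap.range E) ?_
  rintro ⟨_, v, rfl⟩
  have hv : v ∈ Submodule.span k (Set.range fun g => σ g (E w)) := by
    rw [span_orbit_eq_top hσ hw0]; trivial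
  suffices ∃ c : k, c • E w = E v from this.imp fun c hc => Subtype.ext hc
  induction hv using Submodule.span_induction with
  | mem x hx =>
    obtain ⟨h, rfl⟩ := hx
    exact (hsc h).imp fun c hc => (hc w).symm
  | zero => exact ⟨0, by simp⟩
  | add x y _ _ hx hy =>
    obtain ⟨a, ha⟩ := hx
    obtain ⟨b, hb⟩ := hy
    exact ⟨a + b, by rw [add_smul, ha, hb, map_add]⟩
  | smul a x _ hx =>
    obtain ⟨b, hb⟩ := hx
    exact ⟨a * b, by rw [mul_smul, hb, map_smul]⟩

end Commutative

section GelfandGraev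

variable {F k V : Type*} [Field F] [Fintype F] [Field k] [AddCommGroup V]
  [Module k V] {ψ : AddChar F k} {ρ : Representation k (SL2 F) V}

omit [Fintype F] in
theorem torus_comm {r : Fˣ} (hr : (r : F) ^ 2 = 1) (g : SL2 F) : torus r * g = g * torus r := by
  have hi : (r : F)⁻¹ = r := inv_eq_of_mul_eq_one_left (by rw [← sq, hr])
  apply SL2.ext <;> simp [mul_entry, torus_val, hi, mul_comm]

variable (hψ : ψ.IsPrimitive) (hq : (Fintype.card F : k) ≠ 0)
include hψ hq

omit hψ hq in
theorem torus_proj_of_sq {r : Fˣ} (hr : (r : F) ^ 2 = 1) (x : F) (v : V) :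
    ρ (torus r) (proj ψ ρ x v) = proj ψ ρ x (ρ (torus r) v) := by
  have h : ((r⁻¹ : Fˣ) : F) ^ 2 = 1 := by
    rw [Units.val_inv_eq_inv_val, inv_pow, hr, inv_one]
  rw [torus_proj, h, mul_one]

omit hq in
theorem proj_torus_proj_of_sq_ne {r : Fˣ} (hr : (r : F) ^ 2 ≠ 1) {x : F} (hx : x ≠ 0) (v : V) :
    proj ψ ρ x (ρ (torus r) (proj ψ ρ x v)) = 0 := by
  rw [torus_proj, proj_proj_of_ne hψ]
  intro h
  have h1 := mul_left_cancel₀ hx (h.trans (mul_one x).symm)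
  apply hr
  rw [Units.val_inv_eq_inv_val, inv_pow, inv_eq_one] at h1
  exact h1

theorem proj_torus_comm (r : Fˣ) (g : SL2 F) {x : F} (hx : x ≠ 0) (v : V) :
    proj ψ ρ x (ρ (torus r) (proj ψ ρ x (ρ g (proj ψ ρ x v)))) =
      proj ψ ρ x (ρ g (proj ψ ρ x (ρ (torus r) (proj ψ ρ x v)))) := by
  by_cases hr : (r : F) ^ 2 = 1
  · rw [torus_proj_of_sq hr, proj_proj_self hψ hq, rep_mul_apply, torus_comm hr, ← rep_mul_apply,
      torus_proj_of_sq hr, proj_proj_self hψ hq]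
  · rw [proj_torus_proj_of_sq_ne hψ hr hx, proj_torus_proj_of_sq_ne hψ hr hx, map_zero, map_zero]

omit hψ hq in
theorem proj_weyl_proj_weyl_proj [DecidableEq F] (s r : Fˣ) (x : F) (v : V) :
    proj ψ ρ x (ρ (weyl s) (proj ψ ρ x (ρ (weyl r) (proj ψ ρ x v)))) =
      (Fintype.card F : k)⁻¹ • (proj ψ ρ x (ρ (torus (-(s * r⁻¹))) (proj ψ ρ x v)) +
        ∑ a : Fˣ, (ψ (-(a * x)) * (ψ (-((s ^ 2 * a⁻¹ : Fˣ) : F) * x) *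
          ψ (-((r ^ 2 * a⁻¹ : Fˣ) : F) * x))) •
            proj ψ ρ x (ρ (weyl (-(s * r * a⁻¹))) (proj ψ ρ x v))) := by
  rw [proj_apply x (ρ (weyl r) _), map_smul, map_smul, map_sum, map_sum,
    sum_eq_zero_add_sum_units]
  congr 2
  · simp [rep_mul_apply, weyl_mul_weyl]
  · refine Finset.sum_congr rfl fun a _ => ?_
    rw [map_smul, map_smul, rep_mul_apply, rep_mul_apply, ← mul_assoc, weyl_mul_upper_mul_weyl,
      ← rep_mul_apply, ← rep_mul_apply, upper_proj, map_smul, map_smul, map_smul, proj_upper,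
      smul_smul, smul_smul]
    congr 1
    ring

omit hq in
theorem proj_weyl_comm (s r : Fˣ) {x : F} (hx : x ≠ 0) (v : V) :
    proj ψ ρ x (ρ (weyl s) (proj ψ ρ x (ρ (weyl r) (proj ψ ρ x v)))) =
      proj ψ ρ x (ρ (weyl r) (proj ψ ρ x (ρ (weyl s) (proj ψ ρ x v)))) := by
  classical
  rw [proj_weyl_proj_weyl_proj, proj_weyl_proj_weyl_proj]
  congr 2
  · have hi : (-(r * s⁻¹))⁻¹ = -(s * r⁻¹) := by rw [inv_neg, mul_inv, inv_inv, mul_comm]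
    by_cases hr : ((-(r * s⁻¹) : Fˣ) : F) ^ 2 = 1
    · have : -(s * r⁻¹) = -(r * s⁻¹) := by
        rw [← hi]
        apply inv_eq_of_mul_eq_one_left
        exact Units.ext (by rw [Units.val_mul, ← sq, hr, Units.val_one])
      rw [this]
    · rw [proj_torus_proj_of_sq_ne hψ hr hx, proj_torus_proj_of_sq_ne hψ _ hx]
      rw [← hi, Units.val_inv_eq_inv_val, inv_pow, Ne, inv_eq_one]
      exact hr
  · refine Finset.sum_congr rfl fun a _ => ?_
    rw [mul_comm r s, mul_comm (ψ (-((s ^ 2 * a⁻¹ : Fˣ) : F) * x))]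

theorem proj_comm (g h : SL2 F) {x : F} (hx : x ≠ 0) (v : V) :
    proj ψ ρ x (ρ g (proj ψ ρ x (ρ h (proj ψ ρ x v)))) =
      proj ψ ρ x (ρ h (proj ψ ρ x (ρ g (proj ψ ρ x v)))) := by
  have ht : ∀ (r : Fˣ) (b : F) (g : SL2 F),
      proj ψ ρ x (ρ (torus r * upper b) (proj ψ ρ x (ρ g (proj ψ ρ x v)))) =
      proj ψ ρ x (ρ g (proj ψ ρ x (ρ (torus r * upper b) (proj ψ ρ x v)))) := by
    intro r b g
    simp only [← rep_mul_apply, upper_proj, map_smul]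
    rw [proj_torus_comm hψ hq r g hx]
  rcases bruhat g with ⟨r, b, rfl⟩ | ⟨a, s, b, rfl⟩
  · exact ht r b h
  rcases bruhat h with ⟨r, b, rfl⟩ | ⟨a', s', b', rfl⟩
  · exact (ht _ _ _).symm
  simp only [← rep_mul_apply, upper_proj, map_smul, proj_upper, smul_smul]
  rw [proj_weyl_comm hψ s s' hx]
  congr 1
  ring

theorem finrank_range_proj_le_one [IsAlgClosed k] [FiniteDimensional k V] (hρ : ρ.IsIrred) {x : F}
    (hx : x ≠ 0) : finrank k (LinearMap.range (proj ψ ρ x)) ≤ 1 :=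
  finrank_range_le_one_of_comm hρ fun g h => proj_comm hψ hq g h hx

/-- Dimensions of the irreducible representations without `upper`-fixed vectors. -/
theorem finrank_of_proj_zero [IsAlgClosed k] [FiniteDimensional k V] (hρ : ρ.IsIrred)
    (hV : finrank k V ≠ 0) (h0 : proj ψ ρ 0 = 0) :
    (finrank k V = Fintype.card F - 1 ∧ proj ψ ρ 1 ≠ 0) ∨
      (2 * finrank k V = Fintype.card F - 1 ∧
        (proj ψ ρ 1 ≠ 0 ∧ proj ψ ρ (nsq F) = 0 ∨ proj ψ ρ 1 = 0 ∧ proj ψ ρ (nsq F) ≠ 0)) := by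
  classical
  have hsum := two_mul_sum_units (d := fun x => finrank k (LinearMap.range (proj ψ ρ x)))
    finrank_range_proj_mul_sq
  have hfin : finrank k V = ∑ x : Fˣ, finrank k (LinearMap.range (proj ψ ρ x)) := by
    rw [finrank_eq_sum hψ hq (ρ := ρ), sum_eq_zero_add_sum_units, h0]
    simp
  have hd : ∀ x : F, x ≠ 0 → finrank k (LinearMap.range (proj ψ ρ x)) = 0 ∧ proj ψ ρ x = 0 ∨
      finrank k (LinearMap.range (proj ψ ρ x)) = 1 ∧ proj ψ ρ x ≠ 0 := by
    intro x hx
    by_cases h : proj ψ ρ x = 0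
    · exact Or.inl ⟨by rw [h]; simp, h⟩
    · refine Or.inr ⟨le_antisymm (finrank_range_proj_le_one hψ hq hρ hx) ?_, h⟩
      rw [Nat.one_le_iff_ne_zero, Ne, Submodule.finrank_eq_zero, LinearMap.range_eq_bot]
      exact h
  have h1 := hd 1 one_ne_zero
  have h2 := hd (nsq F) (Units.ne_zero _)
  rw [← hfin] at hsum
  rcases h1 with ⟨h1, h1'⟩ | ⟨h1, h1'⟩ <;> rcases h2 with ⟨h2, h2'⟩ | ⟨h2, h2'⟩ <;>
    simp only [h1, h2] at hsum
  · omega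
  · exact Or.inr ⟨by omega, Or.inr ⟨h1', h2'⟩⟩
  · exact Or.inr ⟨by omega, Or.inl ⟨h1', h2'⟩⟩
  · exact Or.inl ⟨by omega, h1'⟩

end GelfandGraev

end SLTwo

namespace SLTwo

open Module

section CuspidalFunctions

variable {F k : Type*} [Field F] [Fintype F] [DecidableEq F] [Field k]

/-- Functions with the transformation behaviour of the diagonal matrix coefficient of a
cuspidal representation at a vector on which `upper a` acts as `ψ a`. -/
def cuspidalFn (ψ : AddChar F k) : Submodule k (SL2 F → k) where
  carrier := {φ | (∀ a b g, φ (upper a * g * upper b) = ψ (a + b) * φ g) ∧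
    (∀ r : Fˣ, (r : F) ^ 2 ≠ 1 → φ (torus r) = 0) ∧
    ∀ g h, ∑ x : F, φ (g * upper x * h) = 0}
  add_mem' := by
    rintro φ φ' ⟨h1, h2, h3⟩ ⟨h1', h2', h3'⟩
    refine ⟨fun a b g => ?_, fun r hr => ?_, fun g h => ?_⟩
    · simp only [Pi.add_apply, h1, h1', mul_add]
    · simp only [Pi.add_apply, h2 r hr, h2' r hr, add_zero]
    · simp only [Pi.add_apply, Finset.sum_add_distrib, h3, h3', add_zero]
  zero_mem' := by simp
  smul_mem' := by
    rintro c φ ⟨h1, h2, h3⟩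
    refine ⟨fun a b g => ?_, fun r hr => ?_, fun g h => ?_⟩
    · simp only [Pi.smul_apply, h1, smul_eq_mul]; ring
    · simp only [Pi.smul_apply, h2 r hr, smul_zero]
    · simp only [Pi.smul_apply, ← Finset.smul_sum, h3, smul_zero]

/-- The Fourier transform along the elements `weyl s`. -/
def weylFourier (ψ : AddChar F k) (c : F) : (SL2 F → k) →ₗ[k] k :=
  ∑ s : Fˣ, ψ (s * c) • LinearMap.proj (weyl s)

variable {ψ : AddChar F k}

theorem weylFourier_apply (c : F) (φ : SL2 F → k) :
    weylFourier ψ c φ = ∑ s : Fˣ, ψ (s * c) * φ (weyl s) := by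
  simp [weylFourier, LinearMap.sum_apply]

theorem weylFourier_add_inv {φ : SL2 F → k} (hφ : φ ∈ cuspidalFn ψ) (r : Fˣ) :
    weylFourier ψ (r + (r : F)⁻¹) φ = -φ (torus (-r⁻¹)) := by
  have h := hφ.2.2 (weyl 1) (weyl r)
  rw [sum_eq_zero_add_sum_units, upper_zero, mul_one, weyl_mul_weyl, one_mul] at h
  rw [eq_neg_iff_add_eq_zero, add_comm, ← h, weylFourier_apply]
  congr 1
  refine Fintype.sum_equiv (((Equiv.inv Fˣ).trans (Equiv.mulLeft r)).trans (Equiv.neg Fˣ)) _ _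
    fun y => ?_
  rw [weyl_mul_upper_mul_weyl, hφ.1]
  simp only [Equiv.trans_apply, Equiv.inv_apply, Equiv.neg_apply, Equiv.coe_mulLeft]
  congr 2
  · simp
    field_simp
    ring
  · congr 1
    simp

variable (hψ : ψ.IsPrimitive)
include hψ

theorem sum_weylFourier (s : Fˣ) (φ : SL2 F → k) :
    ∑ c, ψ (c * -s) * weylFourier ψ c φ = Fintype.card F * φ (weyl s) := by
  simp only [weylFourier_apply, Finset.mul_sum]
  rw [Finset.sum_comm, Finset.sum_eq_single s]
  · simp only [← mul_assoc, ← AddChar.map_add_eq_mul]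
    simp [mul_comm]
  · intro t _ ht
    simp only [← mul_assoc, ← AddChar.map_add_eq_mul, ← Finset.sum_mul]
    have h1 : ∀ c : F, c * -(s : F) + t * c = c * (t - s) := fun c => by ring
    simp only [h1]
    rw [AddChar.sum_mulShift _ hψ, if_neg]
    · simp
    · rw [sub_eq_zero]
      exact fun h => ht (Units.ext h)
  · simp

theorem sum_weylFourier_zero (φ : SL2 F → k) : ∑ c, weylFourier ψ c φ = 0 := by
  simp only [weylFourier_apply]
  rw [Finset.sum_comm]
  refine Finset.sum_eq_zero fun s _ => ?_
  rw [← Finset.sum_mul]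
  simp only [mul_comm (s : F)]
  rw [AddChar.sum_mulShift _ hψ, if_neg s.ne_zero]
  simp

variable (hq : (Fintype.card F : k) ≠ 0)
include hq

theorem eq_zero_of_mem_cuspidalFn {φ : SL2 F → k} (hφ : φ ∈ cuspidalFn ψ)
    (hF : ∀ c, weylFourier ψ c φ = 0) : φ = 0 := by
  have hw : ∀ s, φ (weyl s) = 0 := by
    intro s
    have := sum_weylFourier hψ s φ
    simp only [hF, mul_zero, Finset.sum_const_zero] at this
    exact (mul_eq_zero.1 this.symm).resolve_left hq
  have ht : ∀ r, φ (torus r) = 0 := by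
    intro r
    by_cases hr : (r : F) ^ 2 = 1
    · have := weylFourier_add_inv hφ (-r⁻¹)
      rwa [hF, eq_comm, neg_eq_zero, inv_neg, inv_inv, neg_neg] at this
    · exact hφ.2.1 r hr
  ext g
  rcases bruhat g with ⟨r, b, rfl⟩ | ⟨a, s, b, rfl⟩
  · have := hφ.1 0 b (torus r)
    rw [upper_zero, one_mul] at this
    rw [this, ht, mul_zero, Pi.zero_apply]
  · rw [hφ.1, hw, mul_zero, Pi.zero_apply]

end CuspidalFunctions

section Split

variable (F : Type*) [Field F] [Fintype F] [DecidableEq F]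

/-- Traces of the elements of the split torus. -/
def splitTraces : Finset F := Finset.univ.image fun r : Fˣ => (r : F) + (r : F)⁻¹

theorem card_le_two_mul_splitTraces : Fintype.card F ≤ 2 * (splitTraces F).card := by
  have h1 : ((Finset.univ : Finset Fˣ).erase 1).card ≤ 2 * ((splitTraces F).erase 2).card := by
    refine Finset.card_le_mul_card_image_of_maps_to (f := fun r : Fˣ => (r : F) + (r : F)⁻¹)
      ?_ 2 ?_
    · intro r hr
      refine Finset.mem_erase.2 ⟨fun h => ?_, Finset.mem_image_of_mem _ (Finset.mem_univ r)⟩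
      refine (Finset.mem_erase.1 hr).1 (Units.ext ?_)
      have h0 := r.ne_zero
      field_simp at h
      have h2 : ((r : F) - 1) ^ 2 = 0 := by linear_combination h
      exact sub_eq_zero.1 (pow_eq_zero_iff two_ne_zero |>.1 h2)
    · intro c _
      by_cases hc : ∃ r : Fˣ, (r : F) + (r : F)⁻¹ = c
      · obtain ⟨r, rfl⟩ := hc
        refine (Finset.card_le_card (t := {r, r⁻¹}) fun s hs => ?_).trans Finset.card_le_two
        have hs := (Finset.mem_filter.1 hs).2
        have h0 := r.ne_zero
        have h0' := s.ne_zero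
        field_simp at hs
        have h2 : ((s : F) - r) * (s * r - 1) = 0 := by linear_combination hs
        rw [Finset.mem_insert, Finset.mem_singleton]
        rcases mul_eq_zero.1 h2 with h | h
        · exact Or.inl (Units.ext (sub_eq_zero.1 h))
        · exact Or.inr (eq_inv_of_mul_eq_one_left (Units.ext (sub_eq_zero.1 h)))
      · rw [Finset.filter_eq_empty_iff.2 fun r _ h => hc ⟨r, h⟩]
        simp
  have h2 : (2 : F) ∈ splitTraces F :=
    Finset.mem_image.2 ⟨1, Finset.mem_univ _, by norm_num⟩
  rw [Finset.card_erase_of_mem (Finset.mem_univ _), Finset.card_erase_of_mem h2,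
    Finset.card_univ, Fintype.card_units] at h1
  have := Finset.card_pos.2 ⟨_, h2⟩
  omega

end Split

section CuspidalDimension

variable {F k : Type*} [Field F] [Fintype F] [DecidableEq F] [Field k] {ψ : AddChar F k}
  (hψ : ψ.IsPrimitive) (hq : (Fintype.card F : k) ≠ 0)
include hψ hq

theorem eq_zero_of_weylFourier_nonsplit {φ : SL2 F → k} (hφ : φ ∈ cuspidalFn ψ)
    (hF : ∀ c, c ∉ (splitTraces F).erase (-2) → weylFourier ψ c φ = 0) : φ = 0 := by
  have h2 : ∀ c, c ≠ 2 → weylFourier ψ c φ = 0 := by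
    intro c hc
    by_cases h : c ∈ (splitTraces F).erase (-2)
    · obtain ⟨h1, h⟩ := Finset.mem_erase.1 h
      obtain ⟨r, -, rfl⟩ := Finset.mem_image.1 h
      rw [weylFourier_add_inv hφ, hφ.2.1, neg_zero]
      intro hr
      rw [Units.val_neg, neg_sq, Units.val_inv_eq_inv_val, inv_pow, inv_eq_one,
        sq, mul_self_eq_one_iff] at hr
      rcases hr with hr | hr
      · apply hc; rw [hr]; norm_num
      · apply h1; rw [hr]; norm_num
    · exact hF c h
  refine eq_zero_of_mem_cuspidalFn hψ hq hφ fun c => ?_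
  by_cases hc : c = 2
  · subst hc
    rw [← sum_weylFourier_zero hψ φ, Finset.sum_eq_single 2 (fun c _ => h2 c) (by simp)]
  · exact h2 c hc

theorem two_mul_card_le_of_linearIndependent {ι : Type*} [Fintype ι] {φ : ι → SL2 F → k}
    (hφ : ∀ i, φ i ∈ cuspidalFn ψ) (hli : LinearIndependent k φ) :
    2 * Fintype.card ι ≤ Fintype.card F + 2 := by
  let Θ : (SL2 F → k) →ₗ[k] ({c // c ∉ (splitTraces F).erase (-2)} → k) :=
    LinearMap.pi fun c => weylFourier ψ c
  have hd : Disjoint (Submodule.span k (Set.range φ)) (LinearMap.ker Θ) := by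
    rw [Submodule.disjoint_def]
    intro f hf hf'
    refine eq_zero_of_weylFourier_nonsplit hψ hq
      (Submodule.span_le.2 (Set.range_subset_iff.2 hφ) hf) fun c hc => ?_
    exact congrFun (LinearMap.mem_ker.1 hf') ⟨c, hc⟩
  have h1 := (hli.map hd).fintype_card_le_finrank
  have h2 := card_le_two_mul_splitTraces F
  have h3 := Finset.pred_card_le_card_erase (s := splitTraces F) (a := -2)
  have h4 : ((splitTraces F).erase (-2)).card ≤ Fintype.card F := Finset.card_le_univ _
  rw [Module.finrank_fintype_fun_eq_card, Fintype.card_subtype_compl, Fintype.card_coe] at h1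
  omega

end CuspidalDimension

end SLTwo

namespace SLTwo

open Module

section Whittaker

variable {F k V : Type*} [Field F] [Fintype F] [Field k] [AddCommGroup V]
  [Module k V] {ψ : AddChar F k} {ρ : Representation k (SL2 F) V}

/-- `proj ψ ρ 1` is the rank one idempotent `z ↦ l z • v`. -/
structure IsWhittaker (ψ : AddChar F k) (ρ : Representation k (SL2 F) V) (v : V)
    (l : V →ₗ[k] k) : Prop where
  apply_self : l v = 1
  proj_eq : ∀ z, proj ψ ρ 1 z = l z • v

theorem exists_isWhittaker [IsAlgClosed k] [FiniteDimensional k V] (hψ : ψ.IsPrimitive)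
    (hq : (Fintype.card F : k) ≠ 0) (hρ : ρ.IsIrred) (h1 : proj ψ ρ 1 ≠ 0) :
    ∃ v l, IsWhittaker ψ ρ v l := by
  obtain ⟨z, hz⟩ := DFunLike.ne_iff.1 h1
  have hz0 : proj ψ ρ 1 z ≠ 0 := hz
  have hr := finrank_range_proj_le_one hψ hq hρ (one_ne_zero (α := F))
  obtain ⟨⟨v, hv⟩, hv'⟩ := (finrank_le_one_iff).1 hr
  have hspan : ∀ y, ∃ c : k, c • v = proj ψ ρ 1 y := fun y =>
    (hv' ⟨proj ψ ρ 1 y, y, rfl⟩).imp fun c hc => congrArg Subtype.val hc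
  have hv0 : v ≠ 0 := by
    rintro rfl
    obtain ⟨c, hc⟩ := hspan z
    exact hz0 (by rw [← hc, smul_zero])
  obtain ⟨f, hf, -⟩ := Submodule.exists_le_ker_of_notMem (p := (⊥ : Submodule k V))
    (v := v) (by simpa using hv0)
  obtain ⟨y, rfl⟩ := hv
  refine ⟨proj ψ ρ 1 y, (f (proj ψ ρ 1 y))⁻¹ • f.comp (proj ψ ρ 1), ?_, fun w => ?_⟩
  · simp [proj_proj_self hψ hq, hf]
  · obtain ⟨c, hc⟩ := hspan w
    simp [← hc]
    congr 1
    field_simp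

namespace IsWhittaker

variable {v : V} {l : V →ₗ[k] k} (hv : IsWhittaker ψ ρ v l)
include hv

theorem ne_zero : v ≠ 0 := fun h => by simpa [h] using hv.apply_self

theorem functional_ne_zero : l ≠ 0 := fun h => by simpa [h] using hv.apply_self

theorem upper (a : F) : ρ (SLTwo.upper a) v = ψ a • v := by
  have h : proj ψ ρ 1 v = v := by rw [hv.proj_eq, hv.apply_self, one_smul]
  rw [← h, upper_proj, mul_one]

theorem functional_upper (a : F) (z : V) : l (ρ (SLTwo.upper a) z) = ψ a * l z := by
  apply smul_left_injective k hv.ne_zero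
  dsimp only
  rw [← hv.proj_eq, proj_upper, mul_one, hv.proj_eq, smul_smul]

theorem coeff_mem (hψ : ψ.IsPrimitive) (hq : (Fintype.card F : k) ≠ 0) (h0 : proj ψ ρ 0 = 0) :
    (fun g => l (ρ g v)) ∈ cuspidalFn ψ := by
  refine ⟨fun a b g => ?_, fun r hr => ?_, fun g h => ?_⟩
  · dsimp only
    rw [mul_assoc, ← rep_mul_apply, hv.functional_upper, ← rep_mul_apply, hv.upper, map_smul,
      map_smul, smul_eq_mul, AddChar.map_add_eq_mul, mul_assoc]
  · have h := proj_torus_proj_of_sq_ne (ρ := ρ) hψ hr one_ne_zero v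
    rw [hv.proj_eq, hv.proj_eq, hv.apply_self, one_smul] at h
    exact (smul_eq_zero.1 h).resolve_right hv.ne_zero
  · have h1 := LinearMap.congr_fun h0 (ρ h v)
    rw [proj_apply, LinearMap.zero_apply] at h1
    have h2 := (smul_eq_zero.1 h1).resolve_left (inv_ne_zero hq)
    simp only [mul_zero, neg_zero, AddChar.map_zero_eq_one, one_smul] at h2
    simp only [← rep_mul_apply]
    rw [← map_sum, ← map_sum, h2, map_zero, map_zero]

theorem trace_proj_sq (r : Fˣ) (g : SL2 F) [FiniteDimensional k V] :
    LinearMap.trace k V (proj ψ ρ ((r : F) ^ 2) ∘ₗ ρ g) =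
      l (ρ (torus r * g * torus r⁻¹) v) := by
  have h : proj ψ ρ ((r : F) ^ 2) ∘ₗ ρ g =
      (l ∘ₗ ρ (torus r * g)).smulRight (ρ (torus r⁻¹) v) := by
    ext z
    have h1 := torus_proj (ψ := ψ) (ρ := ρ) 1 r⁻¹ (ρ (torus r * g) z)
    rw [inv_inv, one_mul, rep_mul_apply, ← mul_assoc, torus_mul_torus, inv_mul_cancel, torus_one,
      one_mul, hv.proj_eq, map_smul] at h1
    exact h1.symm
  rw [h, LinearMap.trace_smulRight, LinearMap.comp_apply, rep_mul_apply]

end IsWhittaker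

theorem card_cuspidal_le [IsAlgClosed k] [FiniteDimensional k V] (hψ : ψ.IsPrimitive)
    (hq : (Fintype.card F : k) ≠ 0) {ι : Type*} [Fintype ι] {ρ : ι → Representation k (SL2 F) V}
    (hρ : ∀ i, (ρ i).IsIrred) (hne : ∀ i j, IsoRep (ρ i) (ρ j) → i = j)
    (h0 : ∀ i, proj ψ (ρ i) 0 = 0) (h1 : ∀ i, proj ψ (ρ i) 1 ≠ 0) :
    2 * Fintype.card ι ≤ Fintype.card F + 2 := by
  classical
  choose v l hv using fun i => exists_isWhittaker hψ hq (hρ i) (h1 i)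
  refine two_mul_card_le_of_linearIndependent hψ hq (fun i => (hv i).coeff_mem hψ hq (h0 i))
    (linearIndependent_coeff hρ hne ((Fintype.card F : k)⁻¹ • ∑ a : F,
      ψ (-(a * 1)) • MonoidAlgebra.single (upper a) 1) (fun i => (hv i).apply_self) fun i w => ?_)
  rw [← (hv i).proj_eq, proj_apply]
  simp [Representation.asAlgebraHom_single, LinearMap.sum_apply]

end Whittaker

section HalfCuspidal

variable {F k V : Type*} [Field F] [Fintype F] [DecidableEq F] [Field k] [AddCommGroup V]
  [Module k V] {ψ : AddChar F k} {ρ : Representation k (SL2 F) V}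

omit [Fintype F] [DecidableEq F] in
theorem isSquare_unit_iff {x : Fˣ} : IsSquare (x : F) ↔ ∃ r : Fˣ, x = r ^ 2 := by
  constructor
  · rintro ⟨y, hy⟩
    have hy0 : y ≠ 0 := by
      rintro rfl
      simp at hy
    exact ⟨Units.mk0 y hy0, Units.ext (by simp [hy, sq])⟩
  · rintro ⟨r, rfl⟩
    exact ⟨r, by simp [sq]⟩

omit [DecidableEq F] in
theorem not_isSquare_nsq (hodd : Odd (Fintype.card F)) : ¬ IsSquare (nsq F : F) := by
  intro h
  obtain ⟨r, hr⟩ := isSquare_unit_iff.1 h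
  obtain ⟨a, ha⟩ := FiniteField.exists_nonsquare (F := F) fun h2 => by
    have := FiniteField.even_card_of_char_two h2
    rw [Nat.odd_iff] at hodd
    omega
  have ha0 : a ≠ 0 := by
    rintro rfl
    exact ha (IsSquare.zero)
  lift a to Fˣ using ha0.isUnit
  apply ha
  rcases eq_sq_or a with ⟨s, hs⟩ | ⟨s, hs⟩
  · exact isSquare_unit_iff.2 ⟨s, hs⟩
  · exact isSquare_unit_iff.2 ⟨r * s, by rw [hs, hr, mul_pow]⟩

theorem trace_eq_sum_isSquare [FiniteDimensional k V] [DecidablePred (IsSquare : F → Prop)]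
    (hψ : ψ.IsPrimitive)
    (hq : (Fintype.card F : k) ≠ 0) (h0 : proj ψ ρ 0 = 0) (hn : proj ψ ρ (nsq F) = 0)
    {v : V} {l : V →ₗ[k] k} (hv : IsWhittaker ψ ρ v l) (g : SL2 F) (T : Fˣ → k)
    (hT : ∀ r : Fˣ, T (r ^ 2) = l (ρ (torus r * g * torus r⁻¹) v)) :
    LinearMap.trace k V (ρ g) = ∑ x : Fˣ, if IsSquare (x : F) then T x else 0 := by
  have h : ρ g = ∑ x, proj ψ ρ x ∘ₗ ρ g := by
    ext z
    rw [LinearMap.sum_apply]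
    exact (sum_proj hψ hq (ρ g z)).symm
  rw [h, map_sum, sum_eq_zero_add_sum_units, h0, LinearMap.zero_comp, map_zero, zero_add]
  refine Finset.sum_congr rfl fun x _ => ?_
  by_cases hx : IsSquare (x : F)
  · rw [if_pos hx]
    obtain ⟨r, rfl⟩ := isSquare_unit_iff.1 hx
    rw [hT, ← hv.trace_proj_sq, Units.val_pow_eq_pow_val]
  · rw [if_neg hx]
    obtain ⟨r, rfl⟩ := (eq_sq_or x).resolve_left fun h => hx (isSquare_unit_iff.2 h)
    have : proj ψ ρ ((nsq F * r ^ 2 : Fˣ) : F) = 0 := by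
      ext z
      have h1 := torus_proj (ψ := ψ) (ρ := ρ) (nsq F : F) r⁻¹ (ρ (torus r) z)
      rw [hn, rep_mul_apply, torus_mul_torus, inv_inv, inv_mul_cancel, torus_one] at h1
      simpa using h1.symm
    rw [this, LinearMap.zero_comp, map_zero]

omit [Fintype F] [DecidableEq F] in
theorem exists_sl2_entries {a b c d : F} (h : a * d - b * c = 1) :
    ∃ P : SL2 F, P.1 0 0 = a ∧ P.1 0 1 = b ∧ P.1 1 0 = c ∧ P.1 1 1 = d :=
  ⟨⟨!![a, b; c, d], by rw [Matrix.det_fin_two_of, h]⟩, rfl, rfl, rfl, rfl⟩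

omit [Fintype F] [DecidableEq F] in
theorem weyl_mul_upper_neg_two (s : Fˣ) :
    ∃ P : SL2 F, P * upper ((s⁻¹ : Fˣ) : F) = weyl s * upper ((s : F) * -2) * P := by
  have hs := s.ne_zero
  obtain ⟨P, h₀, h₁, h₂, h₃⟩ := exists_sl2_entries
    (show (s : F) * (s : F)⁻¹ - 0 * 1 = 1 by simp)
  refine ⟨P, ?_⟩
  apply SL2.ext <;> simp [mul_entry, upper_val, weyl_val, h₀, h₁, h₂, h₃] <;> ring

omit [DecidableEq F] in
theorem exists_conj_weyl_mul_upper (hodd : Odd (Fintype.card F)) {c : F} (h2 : c ≠ 2)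
    (h2' : c ≠ -2) (s : Fˣ) :
    ∃ P : SL2 F, P * (weyl 1 * upper c) = weyl s * upper ((s : F) * c) * P := by
  have h20 : (2 : F) ≠ 0 := by
    intro h
    have : ringChar F = 2 := by
      exact CharP.ringChar_of_prime_eq_zero Nat.prime_two (by exact_mod_cast h)
    have := FiniteField.even_card_of_char_two this
    rw [Nat.odd_iff] at hodd
    omega
  have hc : 1 - (c / 2) ^ 2 ≠ 0 := by
    intro h
    have h3 : (c - 2) * (c + 2) = 0 := by
      field_simp at h
      linear_combination -h
    rcases mul_eq_zero.1 h3 with h | h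
    · exact h2 (sub_eq_zero.1 h)
    · exact h2' (eq_neg_of_add_eq_zero_left h)
  obtain ⟨x, y, hxy⟩ := FiniteField.exists_root_sum_quadratic
    (f := (Polynomial.X : Polynomial F) ^ 2)
    (g := Polynomial.C (1 - (c / 2) ^ 2) * Polynomial.X ^ 2 - Polynomial.C (s : F))
    (Polynomial.degree_X_pow 2) (by
      rw [Polynomial.degree_sub_eq_left_of_degree_lt, Polynomial.degree_C_mul_X_pow _ hc]
      · rfl
      · rw [Polynomial.degree_C_mul_X_pow _ hc, Polynomial.degree_C s.ne_zero]
        norm_num) (Nat.odd_iff.1 hodd)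
  simp only [Polynomial.eval_pow, Polynomial.eval_X, Polynomial.eval_sub, Polynomial.eval_mul,
    Polynomial.eval_C] at hxy
  have hs := s.ne_zero
  have hdet : (y + c * (x - c / 2 * y)) * (y / s) -
      (x - c / 2 * y) * (-(x - c / 2 * y) / s) = 1 := by
    field_simp
    field_simp at hxy
    linear_combination hxy
  obtain ⟨P, h₀, h₁, h₂, h₃⟩ := exists_sl2_entries hdet
  refine ⟨P, ?_⟩
  apply SL2.ext <;> simp [mul_entry, upper_val, weyl_val, h₀, h₁, h₂, h₃] <;> field_simp <;> ring

/-- Twist by the quadratic character of the upper right entry. -/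
noncomputable def signTwist (φ : SL2 F → k) (g : SL2 F) : k :=
  open scoped Classical in if IsSquare (g.1 0 1) then φ g else -φ g

omit [Fintype F] [DecidableEq F] in
theorem trace_rep_eq_of_conj {P g h : SL2 F} (hP : P * g = h * P) :
    LinearMap.trace k V (ρ g) = LinearMap.trace k V (ρ h) := by
  have : h = P * g * P⁻¹ := by rw [hP, mul_inv_cancel_right]
  rw [this, map_mul, LinearMap.trace_mul_comm, ← map_mul, inv_mul_cancel_left]

theorem weylFourier_signTwist [FiniteDimensional k V] (hodd : Odd (Fintype.card F))
    (hψ : ψ.IsPrimitive)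
    (hq : (Fintype.card F : k) ≠ 0) (h0 : proj ψ ρ 0 = 0) (hn : proj ψ ρ (nsq F) = 0)
    {v : V} {l : V →ₗ[k] k} (hv : IsWhittaker ψ ρ v l) (c : F) :
    weylFourier ψ c (signTwist fun g => l (ρ g v)) =
      LinearMap.trace k V (ρ (weyl 1 * upper c)) -
        LinearMap.trace k V (ρ (weyl (nsq F) * upper ((nsq F : F) * c))) := by
  classical
  have key : ∀ s : Fˣ, LinearMap.trace k V (ρ (weyl s * upper ((s : F) * c))) =
      ∑ x : Fˣ, if IsSquare (x : F) then ψ ((s * x : Fˣ) * c) * l (ρ (weyl (s * x)) v) else 0 := by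
    intro s
    refine trace_eq_sum_isSquare hψ hq h0 hn hv _ _ fun r => ?_
    rw [← mul_assoc, torus_mul_weyl, mul_assoc, upper_mul_torus, ← mul_assoc, weyl_mul_torus,
      ← rep_mul_apply, hv.upper, map_smul, map_smul, smul_eq_mul, inv_inv]
    congr 2
    · push_cast
      ring
    · congr 3
      rw [mul_comm r s, mul_assoc, sq]
  have hns := not_isSquare_nsq hodd
  have key1 := key 1
  rw [Units.val_one, one_mul] at key1
  simp only [one_mul] at key1
  rw [key1, key]
  have hsq : ∀ x : Fˣ, IsSquare ((nsq F * x : Fˣ) : F) ↔ ¬ IsSquare (x : F) := by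
    intro x
    constructor
    · intro h h'
      apply hns
      have := h.div h'
      rwa [Units.val_mul, mul_div_cancel_right₀ _ x.ne_zero] at this
    · intro h
      obtain ⟨r, rfl⟩ := (eq_sq_or x).resolve_left fun h' => h (isSquare_unit_iff.2 h')
      exact isSquare_unit_iff.2 ⟨nsq F * r, by rw [mul_pow, ← mul_assoc, sq (nsq F)]⟩
  rw [weylFourier_apply, Fintype.sum_equiv (Equiv.mulLeft (nsq F))
    (fun x => if IsSquare (x : F) then ψ ((nsq F * x : Fˣ) * c) * l (ρ (weyl (nsq F * x)) v) else 0)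
    (fun y => if IsSquare (y : F) then 0 else ψ (y * c) * l (ρ (weyl y) v)) fun x => ?_,
    ← Finset.sum_sub_distrib]
  · refine Finset.sum_congr rfl fun x _ => ?_
    by_cases hx : IsSquare (x : F) <;> simp [signTwist, weyl_val, hx]
  · rw [Equiv.coe_mulLeft]
    by_cases hx : IsSquare (x : F)
    · rw [if_pos hx, if_neg fun h => (hsq x).1 h hx]
    · rw [if_neg hx, if_pos ((hsq x).2 hx)]

theorem weylFourier_signTwist_of_ne [FiniteDimensional k V] (hodd : Odd (Fintype.card F))
    (hψ : ψ.IsPrimitive)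
    (hq : (Fintype.card F : k) ≠ 0) (h0 : proj ψ ρ 0 = 0) (hn : proj ψ ρ (nsq F) = 0)
    {v : V} {l : V →ₗ[k] k} (hv : IsWhittaker ψ ρ v l) {c : F} (h2 : c ≠ 2) (h2' : c ≠ -2) :
    weylFourier ψ c (signTwist fun g => l (ρ g v)) = 0 := by
  obtain ⟨P, hP⟩ := exists_conj_weyl_mul_upper hodd h2 h2' (nsq F)
  rw [weylFourier_signTwist hodd hψ hq h0 hn hv, trace_rep_eq_of_conj hP, sub_self]

theorem weylFourier_signTwist_neg_two [FiniteDimensional k V] (hodd : Odd (Fintype.card F))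
    [DecidablePred (IsSquare : F → Prop)] (hψ : ψ.IsPrimitive)
    (hq : (Fintype.card F : k) ≠ 0) (h0 : proj ψ ρ 0 = 0) (hn : proj ψ ρ (nsq F) = 0)
    {v : V} {l : V →ₗ[k] k} (hv : IsWhittaker ψ ρ v l) :
    weylFourier ψ (-2) (signTwist fun g => l (ρ g v)) =
      (∑ x : Fˣ, if IsSquare (x : F) then ψ x else 0) -
        ∑ x : Fˣ, if IsSquare (x : F) then ψ (x * ((nsq F)⁻¹ : Fˣ)) else 0 := by
  have key : ∀ s : Fˣ, LinearMap.trace k V (ρ (weyl s * upper ((s : F) * -2))) =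
      ∑ x : Fˣ, if IsSquare (x : F) then ψ (x * (s⁻¹ : Fˣ)) else 0 := by
    intro s
    obtain ⟨P, hP⟩ := weyl_mul_upper_neg_two s
    rw [← trace_rep_eq_of_conj hP]
    refine trace_eq_sum_isSquare hψ hq h0 hn hv _ _ fun r => ?_
    rw [mul_assoc, upper_mul_torus, ← mul_assoc, torus_mul_torus, mul_inv_cancel, torus_one,
      one_mul, hv.upper, map_smul, hv.apply_self, smul_eq_mul, mul_one, inv_inv]
    simp
  have key1 := key 1
  rw [Units.val_one, one_mul] at key1
  rw [weylFourier_signTwist hodd hψ hq h0 hn hv, key, key1]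
  simp

/-- At most one irreducible representation has the upper unipotents acting exactly through the
characters `ψ (a * x)` with `x` a nonzero square. -/
theorem isoRep_of_proj_nsq_eq_zero [IsAlgClosed k] [FiniteDimensional k V]
    {ρ' : Representation k (SL2 F) V} (hodd : Odd (Fintype.card F)) (hψ : ψ.IsPrimitive)
    (hq : (Fintype.card F : k) ≠ 0) (hρ : ρ.IsIrred) (hρ' : ρ'.IsIrred)
    (h0 : proj ψ ρ 0 = 0) (h1 : proj ψ ρ 1 ≠ 0) (hn : proj ψ ρ (nsq F) = 0)
    (h0' : proj ψ ρ' 0 = 0) (h1' : proj ψ ρ' 1 ≠ 0) (hn' : proj ψ ρ' (nsq F) = 0) :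
    IsoRep ρ ρ' := by
  classical
  obtain ⟨v, l, hv⟩ := exists_isWhittaker hψ hq hρ h1
  obtain ⟨v', l', hv'⟩ := exists_isWhittaker hψ hq hρ' h1'
  refine isoRep_of_coeff_eq hρ hρ' hv.ne_zero hv'.ne_zero hv.functional_ne_zero
    hv'.functional_ne_zero ?_
  set φ := fun g => l (ρ g v) with hφ
  set φ' := fun g => l' (ρ' g v') with hφ'
  have hs : ∀ c, weylFourier ψ c (signTwist φ - signTwist φ') = 0 := by
    have hs1 : ∀ c, c ≠ 2 → weylFourier ψ c (signTwist φ - signTwist φ') = 0 := by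
      intro c hc
      rw [map_sub]
      by_cases hc' : c = -2
      · subst hc'
        rw [weylFourier_signTwist_neg_two hodd hψ hq h0 hn hv,
          weylFourier_signTwist_neg_two hodd hψ hq h0' hn' hv', sub_self]
      · rw [weylFourier_signTwist_of_ne hodd hψ hq h0 hn hv hc hc',
          weylFourier_signTwist_of_ne hodd hψ hq h0' hn' hv' hc hc', sub_self]
    intro c
    by_cases hc : c = 2
    · subst hc
      rw [← sum_weylFourier_zero hψ (signTwist φ - signTwist φ'),
        Finset.sum_eq_single 2 (fun c _ => hs1 c) (by simp)]
    · exact hs1 c hc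
  have hw : ∀ s, φ (weyl s) = φ' (weyl s) := by
    intro s
    have h2 := sum_weylFourier hψ s (signTwist φ - signTwist φ')
    simp only [hs, mul_zero, Finset.sum_const_zero] at h2
    have h3 := (mul_eq_zero.1 h2.symm).resolve_left hq
    rw [Pi.sub_apply, sub_eq_zero, signTwist, signTwist] at h3
    split_ifs at h3
    · exact h3
    · exact neg_injective h3
  have hz : φ - φ' = 0 := by
    refine eq_zero_of_mem_cuspidalFn hψ hq
      ((cuspidalFn ψ).sub_mem (hv.coeff_mem hψ hq h0) (hv'.coeff_mem hψ hq h0')) fun c => ?_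
    rw [weylFourier_apply]
    refine Finset.sum_eq_zero fun s _ => ?_
    rw [Pi.sub_apply, hw, sub_self, mul_zero]
  exact fun g => sub_eq_zero.1 (congrFun hz g)

end HalfCuspidal

end SLTwo

namespace SLTwo

open Module

section FieldBound

variable {F k V : Type*} [Field F] [Fintype F] [Field k] [AddCommGroup V]
  [Module k V]

theorem exists_isPrimitive (F k : Type*) [Field F] [Fintype F] [Field k] [IsAlgClosed k]
    (hq : (Fintype.card F : k) ≠ 0) : ∃ ψ : AddChar F k, ψ.IsPrimitive := by
  have hchar : ringChar k ≠ ringChar F := by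
    intro h
    obtain ⟨n, hp, hn⟩ := FiniteField.card F (ringChar F)
    rw [hn, ← h, Nat.cast_pow, ringChar.Nat.cast_ringChar, zero_pow n.ne_zero] at hq
    exact hq rfl
  let P := AddChar.FiniteField.primitiveChar F k hchar
  have : FiniteDimensional k (CyclotomicField P.n k) :=
    inferInstanceAs (FiniteDimensional k (Polynomial.cyclotomic P.n k).SplittingField)
  let f : CyclotomicField P.n k →ₐ[k] k := IsAlgClosed.lift
  exact ⟨(f : CyclotomicField P.n k →* k).compAddChar P.char,
    P.prim.compMulHom_of_isPrimitive f.injective⟩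

variable {ψ : AddChar F k}

theorem proj_mulShift (ρ : Representation k (SL2 F) V) (y x : F) :
    proj (ψ.mulShift y) ρ x = proj ψ ρ (y * x) := by
  ext v
  simp only [proj_apply, AddChar.mulShift_apply]
  congr 1
  refine Finset.sum_congr rfl fun a _ => ?_
  congr 2
  ring

omit [Fintype F] in
theorem isPrimitive_mulShift (hψ : ψ.IsPrimitive) {y : F} (hy : y ≠ 0) :
    (ψ.mulShift y).IsPrimitive := fun a ha => by
  rw [AddChar.mulShift_mulShift]
  exact hψ (mul_ne_zero hy ha)

theorem proj_eq_zero_iff_finrank [FiniteDimensional k V] {ρ : Representation k (SL2 F) V} {x : F} :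
    proj ψ ρ x = 0 ↔ finrank k (LinearMap.range (proj ψ ρ x)) = 0 := by
  rw [Submodule.finrank_eq_zero, LinearMap.range_eq_bot]

variable [IsAlgClosed k] [FiniteDimensional k V] {ι : Type*} [Fintype ι]
  {ρ : ι → Representation k (SL2 F) V}

theorem card_half_cuspidal_le (hψ : ψ.IsPrimitive) (hq : (Fintype.card F : k) ≠ 0)
    (hodd : Odd (Fintype.card F)) (hρ : ∀ i, (ρ i).IsIrred)
    (hne : ∀ i j, IsoRep (ρ i) (ρ j) → i = j) (h0 : ∀ i, proj ψ (ρ i) 0 = 0)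
    (h : ∀ i, proj ψ (ρ i) 1 ≠ 0 ∧ proj ψ (ρ i) (nsq F) = 0 ∨
      proj ψ (ρ i) 1 = 0 ∧ proj ψ (ρ i) (nsq F) ≠ 0) : Fintype.card ι ≤ 2 := by
  classical
  have hn : (nsq F : F) ≠ 0 := (nsq F).ne_zero
  rw [← Fintype.card_bool]
  refine Fintype.card_le_of_injective (fun i => decide (proj ψ (ρ i) 1 = 0)) fun i j hij => ?_
  replace hij : proj ψ (ρ i) 1 = 0 ↔ proj ψ (ρ j) 1 = 0 := by simpa using hij
  apply hne
  by_cases h1 : proj ψ (ρ i) 1 = 0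
  · have key : ∀ i, proj ψ (ρ i) 1 = 0 → proj (ψ.mulShift (nsq F)) (ρ i) 0 = 0 ∧
        proj (ψ.mulShift (nsq F)) (ρ i) 1 ≠ 0 ∧ proj (ψ.mulShift (nsq F)) (ρ i) (nsq F) = 0 := by
      intro i hi
      simp only [proj_mulShift, mul_zero, mul_one, h0, true_and]
      refine ⟨by simpa [hi] using h i, ?_⟩
      rw [proj_eq_zero_iff_finrank, ← one_mul ((nsq F : F) * _), ← sq,
        finrank_range_proj_mul_sq, ← proj_eq_zero_iff_finrank, hi]
    obtain ⟨a0, a1, a2⟩ := key i h1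
    obtain ⟨b0, b1, b2⟩ := key j (hij.1 h1)
    exact isoRep_of_proj_nsq_eq_zero hodd (isPrimitive_mulShift hψ hn) hq (hρ i) (hρ j)
      a0 a1 a2 b0 b1 b2
  · have key : ∀ i, proj ψ (ρ i) 1 ≠ 0 → proj ψ (ρ i) (nsq F) = 0 := fun i hi => by
      simpa [hi] using h i
    exact isoRep_of_proj_nsq_eq_zero hodd hψ hq (hρ i) (hρ j) (h0 i) h1 (key i h1)
      (h0 j) (mt hij.2 h1) (key j (mt hij.2 h1))

/-- The number of irreducible representations of `SL₂(F)` of a given dimension in characteristic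
not dividing `card F`. -/
theorem card_irred_le (hq : (Fintype.card F : k) ≠ 0) (h5 : 5 < Fintype.card F)
    (hV : 1 < finrank k V) (hρ : ∀ i, (ρ i).IsIrred) (hne : ∀ i j, IsoRep (ρ i) (ρ j) → i = j) :
    Fintype.card ι = 0 ∨
      (finrank k V = Fintype.card F + 1 ∧ 2 * Fintype.card ι + 2 ≤ Fintype.card F ∧
        (Odd (Fintype.card F) → 2 * Fintype.card ι + 3 ≤ Fintype.card F)) ∨
      (finrank k V = Fintype.card F ∧ Fintype.card ι ≤ 1) ∨
      (finrank k V + 1 = Fintype.card F ∧ 2 * Fintype.card ι ≤ Fintype.card F + 2) ∨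
      (2 * finrank k V + 1 = Fintype.card F ∧ Fintype.card ι ≤ 2) ∨
      (2 * finrank k V = Fintype.card F + 1 ∧ Fintype.card ι ≤ 2) := by
  classical
  obtain ⟨ψ, hψ⟩ := exists_isPrimitive F k hq
  have hV1 : finrank k V ≠ 1 := by omega
  have hV0 : finrank k V ≠ 0 := by omega
  have cls : ∀ i, (∃ χ, IsPrincipal ψ (ρ i) χ) ∧ finrank k V = Fintype.card F + 1 ∨
      (∃ β, IsLinear ψ (ρ i) 1 β) ∧ finrank k V = Fintype.card F ∨
      (∃ χ β, χ ≠ 1 ∧ IsLinear ψ (ρ i) χ β) ∧ 2 * finrank k V = Fintype.card F + 1 ∨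
      (proj ψ (ρ i) 0 = 0 ∧ proj ψ (ρ i) 1 ≠ 0) ∧ finrank k V + 1 = Fintype.card F ∨
      (proj ψ (ρ i) 0 = 0 ∧ (proj ψ (ρ i) 1 ≠ 0 ∧ proj ψ (ρ i) (nsq F) = 0 ∨
        proj ψ (ρ i) 1 = 0 ∧ proj ψ (ρ i) (nsq F) ≠ 0)) ∧
        2 * finrank k V + 1 = Fintype.card F := by
    intro i
    by_cases h0 : proj ψ (ρ i) 0 = 0
    · rcases finrank_of_proj_zero hψ hq (hρ i) hV0 h0 with ⟨h, h1⟩ | ⟨h, h1⟩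
      · exact .inr (.inr (.inr (.inl ⟨⟨h0, h1⟩, by omega⟩)))
      · exact .inr (.inr (.inr (.inr ⟨⟨h0, h1⟩, by omega⟩)))
    · obtain ⟨χ, h | ⟨β, h⟩⟩ := exists_isPrincipal_or_isLinear h0
      · exact .inl ⟨⟨χ, h⟩, h.finrank_eq hψ hq (hρ i)⟩
      · by_cases hχ : χ = 1
        · subst hχ
          exact .inr (.inl ⟨⟨β, h⟩, (h.of_one hψ hq (hρ i) hV1).2⟩)
        · exact .inr (.inr (.inl ⟨⟨χ, β, hχ, h⟩, (h.of_ne_one hψ hq (hρ i) hV1 hχ).2.1⟩))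
  rcases isEmpty_or_nonempty ι with hι | ⟨⟨i₀⟩⟩
  · exact .inl Fintype.card_eq_zero
  right
  rcases cls i₀ with h | h | h | h | h
  · refine .inl ⟨h.2, card_isPrincipal_le hψ hq hρ hne fun i => ?_⟩
    rcases cls i with h' | h' | h' | h' | h' <;>
      first | exact h'.1 | (have := h.2; have := h'.2; omega)
  · refine .inr (.inl ⟨h.2, card_isLinear_one_le hψ hq hρ hne hV1 fun i => ?_⟩)
    rcases cls i with h' | h' | h' | h' | h' <;>
      first | exact h'.1 | (have := h.2; have := h'.2; omega)
  · refine .inr (.inr (.inr (.inr ⟨h.2, card_isLinear_le_two hψ hq hρ hne hV1 fun i => ?_⟩)))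
    rcases cls i with h' | h' | h' | h' | h' <;>
      first | exact h'.1 | (have := h.2; have := h'.2; omega)
  · have : ∀ i, proj ψ (ρ i) 0 = 0 ∧ proj ψ (ρ i) 1 ≠ 0 := fun i => by
      rcases cls i with h' | h' | h' | h' | h' <;>
        first | exact h'.1 | (have := h.2; have := h'.2; omega)
    exact .inr (.inr (.inl ⟨h.2, card_cuspidal_le hψ hq hρ hne (fun i => (this i).1)
      fun i => (this i).2⟩))
  · have : ∀ i, proj ψ (ρ i) 0 = 0 ∧ (proj ψ (ρ i) 1 ≠ 0 ∧ proj ψ (ρ i) (nsq F) = 0 ∨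
        proj ψ (ρ i) 1 = 0 ∧ proj ψ (ρ i) (nsq F) ≠ 0) := fun i => by
      rcases cls i with h' | h' | h' | h' | h' <;>
        first | exact h'.1 | (have := h.2; have := h'.2; omega)
    exact .inr (.inr (.inr (.inl ⟨h.2, card_half_cuspidal_le hψ hq
      ⟨finrank k V, h.2.symm⟩ hρ hne (fun i => (this i).1) fun i => (this i).2⟩)))

end FieldBound

end SLTwo

namespace SLTwo

section BilinearForm

variable {F M : Type*} [Field F] [AddCommGroup M] {B : F →+ F →+ M}

theorem eq_zero_of_exists_square (hsq : ∀ s x y : F, s ≠ 0 → B (s ^ 2 * x) (s ^ 2 * y) = B x y)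
    {s r : F} (hs : s ≠ 0) (hr : r ≠ 0) (h : s ^ 2 + 1 = r ^ 2) (h3 : s ^ 4 + s ^ 2 + 1 ≠ 0) :
    B = 0 := by
  have key : ∀ x y, B x (s ^ 2 * y) + B (s ^ 2 * x) y = -B x y := by
    intro x y
    have h1 := hsq r x y hr
    rw [← h, add_mul, add_mul, one_mul, one_mul, map_add, map_add, AddMonoidHom.add_apply,
      AddMonoidHom.add_apply, hsq s x y hs] at h1
    have h2 : B x (s ^ 2 * y) + B (s ^ 2 * x) y + B x y = 0 := by
      rw [← sub_eq_zero] at h1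
      rw [← h1]
      abel
    exact eq_neg_of_add_eq_zero_left h2
  have h4 : ∀ x y, B x ((s ^ 4 + s ^ 2 + 1) * y) = 0 := by
    intro x y
    have h5 := hsq s x (s ^ 2 * y / s ^ 2) hs
    have h6 := key x (s ^ 2 * y)
    have h7 : B (s ^ 2 * x) (s ^ 2 * y) = B x y := hsq s x y hs
    rw [h7] at h6
    rw [add_mul, add_mul, one_mul, map_add, map_add, show s ^ 4 * y = s ^ 2 * (s ^ 2 * y) by ring]
    rw [eq_neg_iff_add_eq_zero] at h6
    rw [← h6]
    abel
  ext x y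
  have h5 := h4 x ((s ^ 4 + s ^ 2 + 1)⁻¹ * y)
  rwa [mul_inv_cancel_left₀ h3] at h5

theorem eq_zero_of_card_prime [Fintype F] (hp : (Fintype.card F).Prime) (hB : ∀ x, B x x = 0) :
    B = 0 := by
  have := Fact.mk hp
  ext x y
  obtain ⟨m, rfl⟩ := mem_zmultiples_of_prime_card (Nat.card_eq_fintype_card (α := F))
    (g' := x) (one_ne_zero (α := F))
  obtain ⟨n, rfl⟩ := mem_zmultiples_of_prime_card (Nat.card_eq_fintype_card (α := F))
    (g' := y) (one_ne_zero (α := F))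
  change B (m • 1) (n • 1) = 0
  rw [map_zsmul, map_zsmul, AddMonoidHom.zsmul_apply, hB, smul_zero, smul_zero]

open Polynomial in
theorem exists_ne_root [Fintype F] {p : F[X]} (hp : p ≠ 0) (h : p.natDegree < Fintype.card F) :
    ∃ x, p.eval x ≠ 0 := by
  by_contra! h0
  exact hp (eq_zero_of_natDegree_lt_card_of_eval_eq_zero p Function.injective_id
    (fun x => h0 x) h)

open Polynomial in
theorem eq_zero_of_two_ne_zero [Fintype F] (h2 : (2 : F) ≠ 0) (h13 : 13 < Fintype.card F)
    (hsq : ∀ s x y : F, s ≠ 0 → B (s ^ 2 * x) (s ^ 2 * y) = B x y) : B = 0 := by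
  obtain ⟨m, hm⟩ := exists_ne_root (F := F)
    (p := X * (X ^ 2 - 1) * (X ^ 2 + 1) * (16 * X ^ 4 + 4 * X ^ 2 * (X ^ 2 - 1) ^ 2 +
      (X ^ 2 - 1) ^ 4)) (Monic.ne_zero (by monicity!)) (lt_of_le_of_lt (by compute_degree) h13)
  simp only [eval_mul, eval_add, eval_sub, eval_pow, eval_X, eval_one, eval_ofNat, mul_ne_zero_iff,
    ne_eq] at hm
  obtain ⟨⟨⟨h0, h1⟩, h3⟩, h4⟩ := hm
  refine eq_zero_of_exists_square hsq (s := 2 * m / (m ^ 2 - 1)) (r := (m ^ 2 + 1) / (m ^ 2 - 1))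
    (div_ne_zero (mul_ne_zero h2 h0) h1) (div_ne_zero h3 h1) (by field_simp; ring) ?_
  intro h
  apply h4
  field_simp at h
  linear_combination h

open Polynomial in
theorem eq_zero_of_two_eq_zero [Fintype F] (h2 : (2 : F) = 0) (h6 : 6 < Fintype.card F)
    (hsq : ∀ s x y : F, s ≠ 0 → B (s ^ 2 * x) (s ^ 2 * y) = B x y) : B = 0 := by
  obtain ⟨s, hs⟩ := exists_ne_root (F := F) (p := X * (X + 1) * (X ^ 4 + X ^ 2 + 1))
    (Monic.ne_zero (by monicity!))
    (lt_of_le_of_lt (by compute_degree) h6)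
  simp only [eval_mul, eval_add, eval_pow, eval_X, eval_one, mul_ne_zero_iff] at hs
  obtain ⟨⟨h0, h1⟩, h3⟩ := hs
  exact eq_zero_of_exists_square hsq h0 h1 (by linear_combination -s * h2) h3

theorem eq_zero_of_isPrimePow [Fintype F] (h5 : 5 < Fintype.card F) (h9 : Fintype.card F ≠ 9)
    (hB : ∀ x, B x x = 0)
    (hsq : ∀ s x y : F, s ≠ 0 → B (s ^ 2 * x) (s ^ 2 * y) = B x y) : B = 0 := by
  by_cases hp : (Fintype.card F).Prime
  · exact eq_zero_of_card_prime hp hB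
  · have h := FiniteField.isPrimePow_card F
    have : Fintype.card F ≠ 6 := fun h' => by
      rw [h'] at h; revert h; rw [isPrimePow_nat_iff_bounded]; decide
    have : Fintype.card F ≠ 10 := fun h' => by
      rw [h'] at h; revert h; rw [isPrimePow_nat_iff_bounded]; decide
    have : Fintype.card F ≠ 12 := fun h' => by
      rw [h'] at h; revert h; rw [isPrimePow_nat_iff_bounded]; decide
    by_cases h2 : (2 : F) = 0
    · exact eq_zero_of_two_eq_zero h2 (by omega) hsq
    · refine eq_zero_of_two_ne_zero h2 ?_ hsq
      have h8 : Fintype.card F ≠ 8 := fun h8 => by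
        have := FiniteField.cast_card_eq_zero F
        rw [h8] at this
        exact h2 (by simpa using (show (2 : F) ^ 3 = 0 by rw [← this]; norm_num))
      by_contra! h13
      generalize Fintype.card F = n at *
      interval_cases n <;> first | omega | (exact hp (by norm_num))

end BilinearForm

end SLTwo

namespace SLTwo

open Subgroup
open scoped commutatorElement

section Transfer

variable {D S : Type*} [Group D] [Group S] [Finite D]

theorem pow_index_mem_commutator (hD : commutator D = ⊤) (N : Subgroup D) {z : D}
    (hz : z ∈ center D) : z ^ N.index ∈ ⁅N, N⁆ := by
  have hz' : ∀ (k : ℕ) (g : D), g⁻¹ * z ^ k * g ∈ N → g⁻¹ * z ^ k * g = z ^ k := fun k g _ => by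
    rw [mul_assoc, ← (mem_center_iff.1 (pow_mem hz k) g), inv_mul_cancel_left]
  have h := MonoidHom.transfer_eq_pow (Abelianization.of (G := N)) z hz'
  have h1 : MonoidHom.transfer (Abelianization.of (G := N)) z = 1 := by
    have := Abelianization.commutator_subset_ker (MonoidHom.transfer (Abelianization.of (G := N)))
    rw [hD] at this
    exact this (mem_top z)
  rw [h1, eq_comm, ← MonoidHom.mem_ker, Abelianization.ker_of] at h
  rw [← map_subtype_commutator]
  exact ⟨_, h, rfl⟩

theorem pow_index_eq_one (hD : commutator D = ⊤) {A : Subgroup D}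
    (hA : ∀ a ∈ A, ∀ b ∈ A, a * b = b * a) {z : D} (hz : z ∈ center D) : z ^ A.index = 1 := by
  have h := pow_index_mem_commutator hD A hz
  have : ⁅A, A⁆ ≤ ⊥ := commutator_le.2 fun a ha b hb =>
    mem_bot.2 (commutatorElement_eq_one_iff_mul_comm.2 (hA a ha b hb))
  exact mem_bot.1 (this h)

omit [Finite D] in
theorem exists_comap_zpowers {f : D →* S} (hf : Function.Surjective f) (hker : f.ker ≤ center D)
    (c : S) : ∃ a₀, f a₀ = c ∧
      ∀ a ∈ (zpowers c).comap f, ∃ n : ℤ, ∃ z ∈ center D, a = a₀ ^ n * z := by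
  obtain ⟨a₀, rfl⟩ := hf c
  refine ⟨a₀, rfl, fun a ⟨n, hn⟩ => ⟨n, (a₀ ^ n)⁻¹ * a, hker ?_, by group⟩⟩
  rw [MonoidHom.mem_ker, map_mul, map_inv, map_zpow, ← hn]
  exact inv_mul_cancel _

omit [Finite D] in
theorem comap_zpowers_comm {f : D →* S} (hf : Function.Surjective f) (hker : f.ker ≤ center D)
    (c : S) : ∀ a ∈ (zpowers c).comap f, ∀ b ∈ (zpowers c).comap f, a * b = b * a := by
  obtain ⟨a₀, -, h⟩ := exists_comap_zpowers hf hker c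
  intro a ha b hb
  obtain ⟨m, z, hz, rfl⟩ := h a ha
  obtain ⟨n, y, hy, rfl⟩ := h b hb
  have h1 : Commute (a₀ ^ m) (a₀ ^ n) := (Commute.refl a₀).zpow_zpow m n
  have h2 : ∀ g, Commute g z := fun g => mem_center_iff.1 hz g
  have h3 : ∀ g, Commute g y := fun g => mem_center_iff.1 hy g
  exact ((h1.mul_right (h3 _)).mul_left (((h2 _).symm).mul_right (h3 _)))

theorem pow_index_zpowers_eq_one (hD : commutator D = ⊤) {f : D →* S}
    (hf : Function.Surjective f) (hker : f.ker ≤ center D) (c : S) {z : D} (hz : z ∈ center D) :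
    z ^ (zpowers c).index = 1 := by
  rw [← index_comap_of_surjective _ hf]
  exact pow_index_eq_one hD (comap_zpowers_comm hf hker c) hz

/-- The union of the cosets `K` and `K * w`, for `w` normalizing `K` with `w ^ 2 ∈ K`. -/
def cosetUnion (K : Subgroup S) (w : S) (hw : ∀ h, h ∈ K ↔ w * h * w⁻¹ ∈ K) (hw2 : w * w ∈ K) :
    Subgroup S where
  carrier := {g | g ∈ K ∨ g * w⁻¹ ∈ K}
  one_mem' := .inl K.one_mem
  mul_mem' := by
    rintro a b (ha | ha) (hb | hb)
    · exact .inl (K.mul_mem ha hb)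
    · exact .inr (by rw [mul_assoc]; exact K.mul_mem ha hb)
    · exact .inr (by
        have := K.mul_mem ha ((hw b).1 hb)
        convert this using 1
        group)
    · exact .inl (by
        have := K.mul_mem (K.mul_mem ha ((hw _).1 hb)) hw2
        convert this using 1
        group)
  inv_mem' := by
    rintro a (ha | ha)
    · exact .inl (K.inv_mem ha)
    · refine .inr ((hw _).2 ?_)
      have := K.mul_mem (K.inv_mem ha) (K.inv_mem hw2)
      rw [show w * (a⁻¹ * w⁻¹) * w⁻¹ = (a * w⁻¹)⁻¹ * (w * w)⁻¹ by group]
      exact this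

theorem index_eq_two_mul_index_cosetUnion {K : Subgroup S} {w : S}
    {hw : ∀ h, h ∈ K ↔ w * h * w⁻¹ ∈ K} {hw2 : w * w ∈ K} (hwK : w ∉ K) :
    K.index = 2 * (cosetUnion K w hw hw2).index := by
  have hle : K ≤ cosetUnion K w hw hw2 := fun x hx => .inl hx
  rw [← relIndex_mul_index hle, relIndex_eq_two_iff.2]
  refine ⟨w⁻¹, inv_mem (.inr (by rw [mul_inv_cancel]; exact K.one_mem)), ?_⟩
  rintro b (hb | hb)
  · exact .inr ⟨hb, fun h => hwK (inv_mem_iff.1 ((mul_mem_cancel_left hb).1 h))⟩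
  · exact .inl ⟨hb, fun h => hwK (inv_mem_iff.1 ((mul_mem_cancel_left h).1 hb))⟩

theorem exists_zpowers_of_odd (hD : commutator D = ⊤) {f : D →* S}
    (hf : Function.Surjective f) (hker : f.ker ≤ center D) {c w : S}
    (hw : ∀ h, h ∈ zpowers c ↔ w * h * w⁻¹ ∈ zpowers c) (hw2 : w * w ∈ zpowers c)
    (hwc : w ∉ zpowers c) {m : ℕ} (hm : Odd m) (hidx : (zpowers c).index = 2 * m) :
    ∃ b : D, ∀ z ∈ center D, z ^ 2 = 1 → z ∈ zpowers b := by
  obtain ⟨W, rfl⟩ := hf w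
  obtain ⟨a₀, ha₀, hA⟩ := exists_comap_zpowers hf hker c
  have hcomm := comap_zpowers_comm hf hker c
  set A := (zpowers c).comap f with hAdef
  have hWA : ∀ a, a ∈ A ↔ W * a * W⁻¹ ∈ A := fun a => by
    rw [hAdef, mem_comap, mem_comap, hw (f a), map_mul, map_mul, map_inv]
  have hθ : ∀ a ∈ A, ⁅a, W⁆ ∈ zpowers ⁅a₀, W⁆ := by
    intro a ha
    obtain ⟨n, z, hz, rfl⟩ := hA a ha
    refine ⟨n, ?_⟩
    have h0 : a₀ ∈ A := by rw [hAdef, mem_comap, ha₀]; exact mem_zpowers c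
    have h1 : Commute a₀ (W * a₀⁻¹ * W⁻¹) := hcomm _ h0 _ ((hWA _).1 (inv_mem h0))
    have h2 : ⁅a₀, W⁆ = a₀ * (W * a₀⁻¹ * W⁻¹) := by rw [commutatorElement_def]; group
    have h3 : W * (a₀ ^ n)⁻¹ * W⁻¹ = (W * a₀⁻¹ * W⁻¹) ^ n := by rw [conj_zpow, inv_zpow]
    have h4 : z * W * z⁻¹ = W := by rw [← mem_center_iff.1 hz W, mul_inv_cancel_right]
    change ⁅a₀, W⁆ ^ n = _
    rw [h2, h1.mul_zpow, ← h3, commutatorElement_def, mul_inv_rev]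
    calc _ = a₀ ^ n * W * (a₀ ^ n)⁻¹ * W⁻¹ := by group
      _ = a₀ ^ n * (z * W * z⁻¹) * (a₀ ^ n)⁻¹ * W⁻¹ := by rw [h4]
      _ = _ := by group
  set N := (cosetUnion (zpowers c) (f W) hw hw2).comap f with hN
  have hmem : ∀ g ∈ N, g ∈ A ∨ g * W⁻¹ ∈ A := by
    rintro g (hg | hg)
    · exact .inl hg
    · refine .inr ?_
      rw [hAdef, mem_comap, map_mul, map_inv]
      exact hg
  have hcom : ⁅N, N⁆ ≤ zpowers ⁅a₀, W⁆ := by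
    refine commutator_le.2 fun g hg g' hg' => ?_
    have h1 : ∀ a ∈ A, ∀ a' ∈ A, ⁅a * W, a'⁆ = ⁅a', W⁆⁻¹ := by
      intro a ha a' ha'
      have := hcomm _ ha _ ((hWA _).1 ha')
      rw [commutatorElement_inv, commutatorElement_def, commutatorElement_def]
      calc _ = a * (W * a' * W⁻¹) * a⁻¹ * a'⁻¹ := by group
        _ = _ := by rw [this]; group
    rcases hmem g hg with ha | ha <;> rcases hmem g' hg' with ha' | ha'
    · rw [commutatorElement_eq_one_iff_mul_comm.2 (hcomm _ ha _ ha')]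
      exact one_mem _
    · have h2 := h1 _ ha' _ ha
      rw [inv_mul_cancel_right] at h2
      rw [← commutatorElement_inv g' g, h2, inv_inv]
      exact hθ _ ha
    · have h2 := h1 _ ha _ ha'
      rw [inv_mul_cancel_right] at h2
      rw [h2]
      exact inv_mem (hθ _ ha')
    · obtain ⟨a, rfl⟩ : ∃ a, g = a * W := ⟨g * W⁻¹, by group⟩
      obtain ⟨a', rfl⟩ : ∃ a, g' = a * W := ⟨g' * W⁻¹, by group⟩
      rw [mul_inv_cancel_right] at ha ha'
      have h3 := hcomm _ ((hWA _).1 (mul_mem ha' (inv_mem ha))) _ (inv_mem ha')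
      have : ⁅a * W, a' * W⁆ = ⁅a * a'⁻¹, W⁆ := by
        rw [commutatorElement_def, commutatorElement_def]
        calc _ = a * ((W * (a' * a⁻¹) * W⁻¹) * a'⁻¹) := by group
          _ = _ := by rw [h3]; group
      rw [this]
      exact hθ _ (mul_mem ha (inv_mem ha'))
  refine ⟨⁅a₀, W⁆, fun z hz hz2 => hcom ?_⟩
  have h := pow_index_mem_commutator hD N hz
  rw [hN, index_comap_of_surjective _ hf] at h
  have h2 := index_eq_two_mul_index_cosetUnion (hw := hw) (hw2 := hw2) hwc
  rw [show (cosetUnion (zpowers c) (f W) hw hw2).index = m by omega] at h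
  obtain ⟨j, rfl⟩ := hm
  rwa [pow_succ, pow_mul, hz2, one_pow, one_mul] at h

theorem eq_of_sq_eq_one_of_mem_zpowers {b x y : D} (hx : x ∈ zpowers b) (hy : y ∈ zpowers b)
    (hx2 : x ^ 2 = 1) (hy2 : y ^ 2 = 1) (hx1 : x ≠ 1) (hy1 : y ≠ 1) : x = y := by
  classical
  by_contra hxy
  have := Fintype.ofFinite (zpowers b)
  have h := IsCyclic.card_pow_eq_one_le (α := zpowers b) (n := 2) two_pos
  have h3 : ({1, ⟨x, hx⟩, ⟨y, hy⟩} : Finset (zpowers b)) ⊆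
      Finset.univ.filter fun a => a ^ 2 = 1 := by
    intro a ha
    simp only [Finset.mem_insert, Finset.mem_singleton] at ha
    rcases ha with rfl | rfl | rfl <;> simp [Subtype.ext_iff, hx2, hy2]
  have h4 := Finset.card_le_card h3
  have h5 : ({1, ⟨x, hx⟩, ⟨y, hy⟩} : Finset (zpowers b)).card = 3 :=
    Finset.card_eq_three.2 ⟨1, ⟨x, hx⟩, ⟨y, hy⟩, by simpa [Subtype.ext_iff] using hx1.symm,
      by simpa [Subtype.ext_iff] using hy1.symm, by simpa [Subtype.ext_iff] using hxy, rfl⟩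
  omega

end Transfer

end SLTwo

namespace SLTwo

open Subgroup Module

open scoped MatrixGroups

section Tori

variable {F : Type*} [Field F]

/-- The subgroup generated by `c` is normalized but not contained in by `w`, and `w ^ 2` lies
in it. -/
structure IsTorusPair {S : Type*} [Group S] (c w : S) : Prop where
  conj_mem : ∀ h, h ∈ zpowers c → w * h * w⁻¹ ∈ zpowers c
  mul_self_mem : w * w ∈ zpowers c
  notMem : w ∉ zpowers c

theorem IsTorusPair.mem_iff {S : Type*} [Group S] {c w : S} (h : IsTorusPair c w) (g : S) :
    g ∈ zpowers c ↔ w * g * w⁻¹ ∈ zpowers c := by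
  refine ⟨h.conj_mem g, fun hg => ?_⟩
  have := mul_mem (mul_mem (inv_mem h.mul_self_mem) (h.conj_mem _ hg)) h.mul_self_mem
  rwa [show (w * w)⁻¹ * (w * (w * g * w⁻¹) * w⁻¹) * (w * w) = g by group] at this

theorem exists_isTorusPair {Γ S : Type*} [Group Γ] [Group S] [IsCyclic Γ] {θ : Γ →* S}
    (hθ : Function.Injective θ) {w : S} (hw : ∀ u, ∃ u', w * θ u = θ u' * w)
    (hw2 : ∃ u, w * w = θ u) (hwn : ∀ u, w ≠ θ u) :
    ∃ c, IsTorusPair c w ∧ Nat.card (zpowers c) = Nat.card Γ := by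
  obtain ⟨u₀, hu₀⟩ := IsCyclic.exists_generator (α := Γ)
  have hr : zpowers (θ u₀) = θ.range := by
    ext g
    constructor
    · rintro ⟨n, rfl⟩
      exact ⟨u₀ ^ n, map_zpow _ _ _⟩
    · rintro ⟨u, rfl⟩
      obtain ⟨n, rfl⟩ := hu₀ u
      exact ⟨n, (map_zpow _ _ _).symm⟩
  refine ⟨θ u₀, ⟨?_, ?_, ?_⟩, ?_⟩
  · rw [hr]
    rintro _ ⟨u, rfl⟩
    obtain ⟨u', hu'⟩ := hw u
    exact ⟨u', by rw [hu', mul_inv_cancel_right]⟩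
  · rw [hr]
    obtain ⟨u, hu⟩ := hw2
    exact ⟨u, hu.symm⟩
  · rw [hr]
    rintro ⟨u, hu⟩
    exact hwn u hu.symm
  · rw [hr]
    exact Nat.card_congr (MonoidHom.ofInjective hθ).toEquiv.symm

/-- The torus as a homomorphism. -/
def torusHom (F : Type*) [Field F] : Fˣ →* SL2 F where
  toFun := torus
  map_one' := torus_one
  map_mul' r s := (torus_mul_torus r s).symm

variable [Fintype F]

theorem exists_split_torus (F : Type*) [Field F] [Fintype F] : ∃ c w : SL2 F, IsTorusPair c w ∧
    Nat.card (zpowers c) = Fintype.card F - 1 := by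
  have hinj : Function.Injective (torusHom F) := by
    intro r s h
    have := congrArg (fun g : SL2 F => g.1 0 0) h
    simpa [torusHom, torus_val, Units.ext_iff] using this
  obtain ⟨c, hc, h⟩ := exists_isTorusPair hinj (w := weyl 1)
    (fun u => ⟨u⁻¹, by simp [torusHom, weyl_mul_torus, torus_mul_weyl]⟩)
    ⟨-1, by simp [torusHom, weyl_mul_weyl]⟩ (fun u hu => by
      have := congrArg (fun g : SL2 F => g.1 0 1) hu
      simp [torusHom, torus_val, weyl_val] at this)
  refine ⟨c, _, hc, ?_⟩
  rw [h, Nat.card_units, Nat.card_eq_fintype_card]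

theorem exists_nonsplit_torus (F : Type*) [Field F] [Fintype F] : ∃ c w : SL2 F, IsTorusPair c w ∧
    Nat.card (zpowers c) = Fintype.card F + 1 := by
  obtain ⟨p, hp⟩ := CharP.exists F
  have := Fact.mk (CharP.char_is_prime F p)
  let E := FiniteField.Extension F p 2
  have hE : finrank F E = 2 := FiniteField.finrank_extension F p 2
  have : Finite E := Module.finite_of_finite F
  let b : Basis (Fin 2) F E := finBasisOfFinrankEq F E hE
  let sl : {f : E →ₗ[F] E // LinearMap.det f = 1} → SL2 F := fun f =>
    ⟨LinearMap.toMatrix b b f.1, by rw [LinearMap.det_toMatrix, f.2]⟩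
  have sl_mul : ∀ f g, sl f * sl g = sl ⟨f.1 * g.1, by rw [map_mul, f.2, g.2, one_mul]⟩ :=
    fun f g => Subtype.ext (LinearMap.toMatrix_mul b f.1 g.1).symm
  have sl_inj : ∀ f g, sl f = sl g → f.1 = g.1 := fun f g h =>
    (LinearMap.toMatrix b b).injective (congrArg Subtype.val h)
  let Γ := (Units.map (Algebra.norm F (S := E))).ker
  have hΓ : ∀ u : Γ, LinearMap.det (Algebra.lmul F E (u : Eˣ)) = 1 := fun u =>
    congrArg Units.val u.2
  let θ : Γ →* SL2 F := MonoidHom.mk' (fun u => sl ⟨Algebra.lmul F E (u : Eˣ), hΓ u⟩) fun u v => by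
    rw [sl_mul]
    exact congrArg sl (Subtype.ext <| map_mul (Algebra.lmul F E) _ _)
  have hθ : Function.Injective θ := fun u v h => by
    have := congrArg (fun f : E →ₗ[F] E => f 1) (sl_inj _ _ h)
    exact Subtype.ext (Units.ext (by simpa using this))
  let σ : E ≃ₐ[F] E := FiniteField.Extension.frob F p 2
  have hσ : ∀ x, σ (σ x) = x := fun x => by
    have := Fintype.ofFinite E
    change FiniteField.Extension.frob F p 2 (FiniteField.Extension.frob F p 2 x) = x
    rw [FiniteField.Extension.frob_apply, FiniteField.Extension.frob_apply, ← pow_mul, ← sq,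
      ← FiniteField.natCard_extension F p 2, Nat.card_eq_fintype_card]
    exact FiniteField.pow_card x
  let s : E →ₗ[F] E := σ.toLinearMap
  have hs : LinearMap.det s ≠ 0 := by
    have : s * s = 1 := LinearMap.ext hσ
    intro h
    have := congrArg LinearMap.det this
    simp [h] at this
  obtain ⟨a, ha⟩ := FiniteField.norm_surjective F E (LinearMap.det s)⁻¹
  have ha0 : a ≠ 0 := by
    rintro rfl
    rw [Algebra.norm_zero] at ha
    exact inv_ne_zero hs ha.symm
  have hw : LinearMap.det (Algebra.lmul F E a * s) = 1 := by
    rw [map_mul, ← Algebra.norm_apply, ha, inv_mul_cancel₀ hs]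
  have hsl : ∀ x, s * Algebra.lmul F E x = Algebra.lmul F E (σ x) * s := fun x =>
    LinearMap.ext fun y => map_mul σ x y
  have hnorm : ∀ x, Algebra.norm F (σ x) = Algebra.norm F x := fun x => by
    have := congrArg LinearMap.det (hsl x)
    rw [map_mul, map_mul, mul_comm] at this
    exact (mul_right_cancel₀ hs this).symm
  have hmk : ∀ x : E, Algebra.norm F x = 1 → ∃ u : Γ, ((u : Eˣ) : E) = x := fun x hx => by
    have hx0 : x ≠ 0 := by
      rintro rfl
      rw [Algebra.norm_zero] at hx
      exact zero_ne_one hx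
    exact ⟨⟨Units.mk0 x hx0, MonoidHom.mem_ker.2 (Units.ext hx)⟩, rfl⟩
  obtain ⟨c, hc, h⟩ := exists_isTorusPair hθ (w := sl ⟨_, hw⟩) (fun u => by
      obtain ⟨u', hu'⟩ := hmk (σ (u : Eˣ)) ((hnorm _).trans (hΓ u))
      refine ⟨u', ?_⟩
      change _ * sl _ = sl _ * _
      rw [sl_mul, sl_mul]
      refine congrArg sl (Subtype.ext ?_)
      change Algebra.lmul F E a * s * Algebra.lmul F E (u : Eˣ) =
        Algebra.lmul F E (u' : Eˣ) * (Algebra.lmul F E a * s)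
      rw [mul_assoc, hsl, hu', ← mul_assoc, ← mul_assoc, ← map_mul, ← map_mul, mul_comm a]) (by
      have h1 : (Algebra.lmul F E a * s) * (Algebra.lmul F E a * s) =
          Algebra.lmul F E (a * σ a) := by
        rw [mul_assoc, ← mul_assoc s, hsl, map_mul]
        refine LinearMap.ext fun y => ?_
        simp [s, hσ, mul_assoc]
      obtain ⟨u, hu⟩ := hmk (a * σ a) (by
        rw [Algebra.norm_apply]
        change LinearMap.det (Algebra.lmul F E (a * σ a)) = 1
        rw [← h1, map_mul, hw, one_mul])
      refine ⟨u, ?_⟩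
      change _ = sl _
      rw [sl_mul]
      exact congrArg sl (Subtype.ext <| h1.trans (congrArg _ hu.symm))) (fun u hu => by
      have h1 := sl_inj _ _ hu
      have h2 : ∀ x, a * σ x = (u : Eˣ) * x := fun x => congrArg (fun f : E →ₗ[F] E => f x) h1
      have h3 : σ = 1 := by
        ext x
        have h4 := h2 1
        rw [map_one, mul_one, mul_one] at h4
        have h5 := h2 x
        rw [← h4] at h5
        exact mul_left_cancel₀ ha0 h5
      have h6 := FiniteField.natCard_algEquiv_extension F p 2
      have h7 : Subsingleton (E ≃ₐ[F] E) := ⟨fun g g' => by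
        obtain ⟨i, -, rfl⟩ := FiniteField.Extension.exists_frob_pow_eq F p 2 g
        obtain ⟨j, -, rfl⟩ := FiniteField.Extension.exists_frob_pow_eq F p 2 g'
        change σ ^ i = σ ^ j
        rw [h3, one_pow, one_pow]⟩
      have := Nat.card_of_subsingleton (1 : E ≃ₐ[F] E)
      have h8 := this.symm.trans h6
      omega)
  refine ⟨c, _, hc, ?_⟩
  rw [h]
  have h1 : Nat.card Γ * Γ.index = _ := Γ.card_mul_index
  rw [Subgroup.index_ker, MonoidHom.range_eq_top.2 (FiniteField.unitsMap_norm_surjective F E),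
    Subgroup.card_top, Nat.card_units, Nat.card_units, FiniteField.natCard_extension,
    Nat.card_eq_fintype_card (α := F)] at h1
  have h2 : 1 < Fintype.card F := Fintype.one_lt_card
  obtain ⟨m, hm⟩ : ∃ m, Fintype.card F = m + 2 := ⟨_, (Nat.sub_add_cancel h2).symm⟩
  rw [hm] at h1 ⊢
  refine Nat.eq_of_mul_eq_mul_right (show 0 < m + 2 - 1 by omega) (h1.trans ?_)
  rw [show m + 2 - 1 = m + 1 by omega]
  zify [show 1 ≤ (m + 2) ^ 2 by nlinarith]
  ring

theorem card_SL2 : Nat.card (SL2 F) =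
    Fintype.card F * ((Fintype.card F - 1) * (Fintype.card F + 1)) := by
  have h1 : (Matrix.SpecialLinearGroup.toGL : SL2 F →* GL (Fin 2) F).range =
      (Matrix.GeneralLinearGroup.det : GL (Fin 2) F →* Fˣ).ker := by
    ext g
    rw [MonoidHom.mem_ker, Units.ext_iff, Matrix.GeneralLinearGroup.val_det_apply]
    refine ⟨?_, fun h => ⟨⟨g.1, h⟩, Units.ext rfl⟩⟩
    rintro ⟨h, rfl⟩
    exact h.2
  have h2 : Function.Surjective (Matrix.GeneralLinearGroup.det : GL (Fin 2) F →* Fˣ) := fun u =>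
    ⟨Matrix.GeneralLinearGroup.mkOfDetNeZero !![(u : F), 0; 0, 1] (by simp),
      Units.ext (by simp [Matrix.GeneralLinearGroup.mkOfDetNeZero])⟩
  have h3 := (Matrix.GeneralLinearGroup.det : GL (Fin 2) F →* Fˣ).ker.card_mul_index
  rw [index_ker, MonoidHom.range_eq_top.2 h2, card_top, ← h1, Matrix.card_GL_field,
    ← Nat.card_congr
      (MonoidHom.ofInjective Matrix.SpecialLinearGroup.toGL_injective).toEquiv,
    Nat.card_units, Fin.prod_univ_two, Nat.card_eq_fintype_card (α := F)] at h3
  have h4 : 1 < Fintype.card F := Fintype.one_lt_card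
  obtain ⟨m, hm⟩ : ∃ m, Fintype.card F = m + 2 := ⟨_, (Nat.sub_add_cancel h4).symm⟩
  rw [hm] at h3 ⊢
  refine Nat.eq_of_mul_eq_mul_right (show 0 < m + 2 - 1 by omega) (h3.trans ?_)
  rw [show m + 2 - 1 = m + 1 by omega]
  simp only [Fin.val_zero, Fin.val_one, pow_zero, pow_one]
  zify [show 1 ≤ (m + 2) ^ 2 by nlinarith, show (m + 2) ≤ (m + 2) ^ 2 by nlinarith]
  ring

end Tori

end SLTwo

namespace SLTwo

open Subgroup
open scoped commutatorElement IsMulCommutative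

section CentralCommutator

variable {D S : Type*} [Group D] [Group S]

theorem conj_eq_of_mem_center {z : D} (hz : z ∈ center D) (g : D) : g * z * g⁻¹ = z := by
  rw [mem_center_iff.1 hz g, mul_inv_cancel_right]

theorem commutatorElement_congr_left {f : D →* S} (hker : f.ker ≤ center D) {a a' : D} (b : D)
    (h : f a = f a') : ⁅a, b⁆ = ⁅a', b⁆ := by
  have hz : a'⁻¹ * a ∈ center D := hker (by rw [MonoidHom.mem_ker, map_mul, map_inv, h,
    inv_mul_cancel])
  obtain ⟨z, rfl⟩ : ∃ z, a = a' * z := ⟨_, (mul_inv_cancel_left a' a).symm⟩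
  rw [inv_mul_cancel_left] at hz
  have h1 : z * b * z⁻¹ = b := by rw [← mem_center_iff.1 hz, mul_inv_cancel_right]
  calc a' * z * b * (a' * z)⁻¹ * b⁻¹ = a' * (z * b * z⁻¹) * a'⁻¹ * b⁻¹ := by group
    _ = a' * b * a'⁻¹ * b⁻¹ := by rw [h1]

theorem commutatorElement_congr {f : D →* S} (hker : f.ker ≤ center D) {a a' b b' : D}
    (ha : f a = f a') (hb : f b = f b') : ⁅a, b⁆ = ⁅a', b'⁆ := by
  rw [commutatorElement_congr_left hker b ha, ← commutatorElement_inv,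
    commutatorElement_congr_left hker a' hb, commutatorElement_inv]

theorem commutatorElement_mem_center {f : D →* S} (hker : f.ker ≤ center D) {a b : D}
    (h : f a * f b = f b * f a) : ⁅a, b⁆ ∈ center D :=
  hker (by rw [MonoidHom.mem_ker, map_commutatorElement,
    commutatorElement_eq_one_iff_mul_comm.2 h])

theorem mul_commutatorElement {a b c : D} (h : ⁅b, c⁆ ∈ center D) :
    ⁅a * b, c⁆ = ⁅a, c⁆ * ⁅b, c⁆ := by
  calc ⁅a * b, c⁆ = a * ⁅b, c⁆ * a⁻¹ * ⁅a, c⁆ := by simp only [commutatorElement_def]; group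
    _ = ⁅a, c⁆ * ⁅b, c⁆ := by rw [conj_eq_of_mem_center h, mem_center_iff.1 h]

theorem commutatorElement_mul {a b c : D} (hb : ⁅c, b⁆ ∈ center D) :
    ⁅c, a * b⁆ = ⁅c, a⁆ * ⁅c, b⁆ := by
  have h : ⁅b, c⁆ ∈ center D := by
    rw [← commutatorElement_inv]
    exact inv_mem hb
  rw [← commutatorElement_inv, mul_commutatorElement h, mul_inv_rev, commutatorElement_inv,
    commutatorElement_inv, ← mem_center_iff.1 hb]

end CentralCommutator

section Unipotent

variable {F D : Type*} [Field F] [Group D] {f : D →* SL2 F}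

/-- The commutator of lifts of `upper x` and `upper y` to a central extension. -/
noncomputable def upperForm (hf : Function.Surjective f) (hker : f.ker ≤ center D) :
    F →+ F →+ Additive (center D) :=
  have hσ : ∀ x, f (Function.surjInv hf x) = x := Function.surjInv_eq hf
  have hc : ∀ x y : F, ⁅Function.surjInv hf (upper x), Function.surjInv hf (upper y)⁆ ∈
      center D := fun x y => commutatorElement_mem_center hker (by
    rw [hσ, hσ, upper_mul_upper, upper_mul_upper, add_comm])
  AddMonoidHom.mk' (fun x => AddMonoidHom.mk' (fun y =>
    Additive.ofMul (⟨_, hc x y⟩ : center D)) fun y y' => by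
      refine Subtype.ext ?_
      change ⁅_, _⁆ = ⁅_, _⁆ * ⁅_, _⁆
      rw [← commutatorElement_mul (hc x y')]
      exact commutatorElement_congr hker rfl (by rw [map_mul, hσ, hσ, hσ, upper_mul_upper]))
    fun x x' => by
      ext y
      change ⁅_, _⁆ = ⁅_, _⁆ * ⁅_, _⁆
      rw [← mul_commutatorElement (hc x' y)]
      exact commutatorElement_congr hker (by rw [map_mul, hσ, hσ, hσ, upper_mul_upper]) rfl

theorem coe_upperForm (hf : Function.Surjective f) (hker : f.ker ≤ center D) {x y : F} {a b : D}
    (ha : f a = upper x) (hb : f b = upper y) :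
    ((upperForm hf hker x y).toMul : D) = ⁅a, b⁆ :=
  commutatorElement_congr hker ((Function.surjInv_eq hf _).trans ha.symm)
    ((Function.surjInv_eq hf _).trans hb.symm)

/-- The upper unitriangular matrices. -/
def upperSubgroup (F : Type*) [Field F] : Subgroup (SL2 F) where
  carrier := Set.range upper
  one_mem' := ⟨0, upper_zero⟩
  mul_mem' := by
    rintro _ _ ⟨a, rfl⟩ ⟨b, rfl⟩
    exact ⟨_, (upper_mul_upper a b).symm⟩
  inv_mem' := by
    rintro _ ⟨a, rfl⟩
    exact ⟨_, (upper_inv a).symm⟩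

variable [Fintype F]

theorem comap_upperSubgroup_comm (hf : Function.Surjective f) (hker : f.ker ≤ center D)
    (h5 : 5 < Fintype.card F) (h9 : Fintype.card F ≠ 9) :
    ∀ a ∈ (upperSubgroup F).comap f, ∀ b ∈ (upperSubgroup F).comap f, a * b = b * a := by
  rintro a ⟨x, hx⟩ b ⟨y, hy⟩
  rw [← commutatorElement_eq_one_iff_mul_comm, ← coe_upperForm hf hker hx.symm hy.symm,
    eq_zero_of_isPrimePow h5 h9 (B := upperForm hf hker)]
  · rfl
  · intro x
    obtain ⟨a, ha⟩ := hf (upper x)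
    refine Additive.toMul.injective (Subtype.ext ?_)
    rw [coe_upperForm hf hker ha ha, commutatorElement_self]
    rfl
  · intro s x y hs
    obtain ⟨r, hr⟩ := hf (torus (Units.mk0 s hs))
    obtain ⟨a, ha⟩ := hf (upper x)
    obtain ⟨b, hb⟩ := hf (upper y)
    have hconj : ∀ (z : F) (c : D), f c = upper z → f (r * c * r⁻¹) = upper (s ^ 2 * z) := by
      intro z c hc
      rw [map_mul, map_mul, map_inv, hc, hr, torus_mul_upper, mul_inv_cancel_right,
        Units.val_mk0]
    refine Additive.toMul.injective (Subtype.ext ?_)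
    rw [coe_upperForm hf hker (hconj x a ha) (hconj y b hb), coe_upperForm hf hker ha hb,
      ← conjugate_commutatorElement]
    refine conj_eq_of_mem_center (commutatorElement_mem_center hker ?_) r
    rw [ha, hb, upper_mul_upper, upper_mul_upper, add_comm]

theorem card_upperSubgroup : Nat.card (upperSubgroup F) = Fintype.card F := by
  rw [← Nat.card_eq_fintype_card]
  refine (Nat.card_congr (Equiv.ofInjective upper fun a b h => ?_)).symm
  simpa [upper_val] using congrArg (fun g : SL2 F => g.1 0 1) h

end Unipotent

section Multiplier

variable {F D : Type*} [Field F] [Fintype F] [Group D] [Finite D] {f : D →* SL2 F}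

theorem pow_card_sub_one_mul_eq_one (hD : commutator D = ⊤) (hf : Function.Surjective f)
    (hker : f.ker ≤ center D) (h5 : 5 < Fintype.card F) (h9 : Fintype.card F ≠ 9) {z : D}
    (hz : z ∈ center D) : z ^ ((Fintype.card F - 1) * (Fintype.card F + 1)) = 1 := by
  have h := pow_index_eq_one hD (comap_upperSubgroup_comm hf hker h5 h9) hz
  rw [index_comap_of_surjective _ hf] at h
  have h1 := (upperSubgroup F).card_mul_index
  rw [card_upperSubgroup, card_SL2] at h1
  rwa [Nat.eq_of_mul_eq_mul_left (by omega) h1] at h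

theorem index_of_card_eq_sub_one {c : SL2 F}
    (hc : Nat.card (zpowers c) = Fintype.card F - 1) :
    (zpowers c).index = Fintype.card F * (Fintype.card F + 1) := by
  have h1 := (zpowers c).card_mul_index
  have : 1 < Fintype.card F := Fintype.one_lt_card
  rw [hc, card_SL2, mul_left_comm] at h1
  exact Nat.eq_of_mul_eq_mul_left (by omega) h1

theorem index_of_card_eq_add_one {c : SL2 F}
    (hc : Nat.card (zpowers c) = Fintype.card F + 1) :
    (zpowers c).index = Fintype.card F * (Fintype.card F - 1) := by
  have h1 := (zpowers c).card_mul_index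
  rw [hc, card_SL2, mul_comm (_ - 1), mul_left_comm] at h1
  exact Nat.eq_of_mul_eq_mul_left (by omega) h1

theorem orderOf_dvd_two (hD : commutator D = ⊤) (hf : Function.Surjective f)
    (hker : f.ker ≤ center D) (h5 : 5 < Fintype.card F) (h9 : Fintype.card F ≠ 9) {z : D}
    (hz : z ∈ center D) : z ^ 2 = 1 ∧ (Even (Fintype.card F) → z = 1) := by
  obtain ⟨c, -, -, hc⟩ := exists_split_torus F
  obtain ⟨c', -, -, hc'⟩ := exists_nonsplit_torus F
  have h1 := pow_index_zpowers_eq_one hD hf hker c hz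
  have h2 := pow_index_zpowers_eq_one hD hf hker c' hz
  have h3 := pow_card_sub_one_mul_eq_one hD hf hker h5 h9 hz
  rw [index_of_card_eq_sub_one hc, ← orderOf_dvd_iff_pow_eq_one] at h1
  rw [index_of_card_eq_add_one hc', ← orderOf_dvd_iff_pow_eq_one] at h2
  rw [← orderOf_dvd_iff_pow_eq_one] at h3
  obtain ⟨m, hm⟩ : ∃ m, Fintype.card F = m + 1 := ⟨_, (Nat.sub_add_cancel (by omega)).symm⟩
  rw [hm, Nat.add_sub_cancel] at h2 h3
  rw [hm] at h1 ⊢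
  have hcop : Nat.Coprime (orderOf z) (m + 1) := by
    refine Nat.Coprime.coprime_dvd_left h3 (Nat.Coprime.mul_left ?_ ?_)
    · simp
    · simp
  have h4 : orderOf z ∣ m := hcop.dvd_of_dvd_mul_left h2
  have h5 : orderOf z ∣ m + 1 + 1 := hcop.dvd_of_dvd_mul_left h1
  have h6 : orderOf z ∣ 2 := (Nat.dvd_add_right h4).1 h5
  refine ⟨orderOf_dvd_iff_pow_eq_one.1 h6, fun he => orderOf_eq_one_iff.1 ?_⟩
  have := Nat.Coprime.coprime_dvd_right he.two_dvd hcop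
  exact Nat.Coprime.eq_one_of_dvd this h6

theorem exists_zpowers_of_card_odd (hD : commutator D = ⊤) (hf : Function.Surjective f)
    (hker : f.ker ≤ center D) (ho : Odd (Fintype.card F)) :
    ∃ b : D, ∀ z ∈ center D, z ^ 2 = 1 → z ∈ zpowers b := by
  obtain ⟨r, hr⟩ := ho
  rcases Nat.even_or_odd' r with ⟨j, rfl | rfl⟩
  · obtain ⟨c, w, hcw, hc⟩ := exists_split_torus F
    refine exists_zpowers_of_odd hD hf hker hcw.mem_iff hcw.mul_self_mem hcw.notMem
      (m := (2 * (2 * j) + 1) * (2 * j + 1)) ?_ ?_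
    · exact Odd.mul ⟨_, rfl⟩ ⟨_, rfl⟩
    · rw [index_of_card_eq_sub_one hc, hr]
      ring
  · obtain ⟨c, w, hcw, hc⟩ := exists_nonsplit_torus F
    refine exists_zpowers_of_odd hD hf hker hcw.mem_iff hcw.mul_self_mem hcw.notMem
      (m := (2 * (2 * j + 1) + 1) * (2 * j + 1)) ?_ ?_
    · exact Odd.mul ⟨_, rfl⟩ ⟨_, rfl⟩
    · rw [index_of_card_eq_add_one hc, hr, Nat.add_sub_cancel]
      ring

/-- A perfect extension of `SL2 F` that is central over the adjoint group is trivial. -/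
theorem injective_of_perfect (hD : commutator D = ⊤) (hf : Function.Surjective f)
    (hZ : ∀ z, f z ∈ center (SL2 F) → z ∈ center D) (h5 : 5 < Fintype.card F)
    (h9 : Fintype.card F ≠ 9) : Function.Injective f := by
  have hker : f.ker ≤ center D := fun z hz => hZ z (by
    rw [MonoidHom.mem_ker.1 hz]
    exact one_mem _)
  rw [injective_iff_map_eq_one]
  intro z hz
  have hzc := hker hz
  rcases Nat.even_or_odd (Fintype.card F) with he | ho
  · exact (orderOf_dvd_two hD hf hker h5 h9 hzc).2 he
  obtain ⟨b, hb⟩ := exists_zpowers_of_card_odd hD hf hker ho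
  obtain ⟨y, hy⟩ := hf (-1)
  have hm1 : (-1 : SL2 F) ≠ 1 := by
    intro h
    have h1 : (-1 : F) = 1 := by simpa using congrArg (fun g : SL2 F => g.1 0 0) h
    have h2 : ringChar F = 2 := by
      by_contra h2
      exact Ring.neg_one_ne_one_of_char_ne_two h2 h1
    have := FiniteField.even_card_of_char_two h2
    rw [Nat.odd_iff] at ho
    omega
  have hyc : y ∈ center D := hZ y (by
    rw [hy, mem_center_iff]
    intro g
    rw [mul_neg, neg_mul, one_mul, mul_one])
  by_contra hz1
  refine hm1 ?_
  rw [← hy, ← hz]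
  have hz2 := (orderOf_dvd_two hD hf hker h5 h9 hzc).1
  have hy2 := (orderOf_dvd_two hD hf hker h5 h9 hyc).1
  refine congrArg f (eq_of_sq_eq_one_of_mem_zpowers (hb _ hyc hy2) (hb _ hzc hz2) hy2 hz2 ?_ hz1)
  rintro rfl
  exact hm1 (by rw [← hy, map_one])

end Multiplier

end SLTwo

namespace SLTwo

open Subgroup
open scoped commutatorElement

section Perfect

variable {P H : Type*} [Group P] [Group H]

theorem map_commutator_eq_top {g : P →* H} (hg : Function.Surjective g)
    (hH : commutator H = ⊤) : (commutator P).map g = ⊤ := by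
  rw [commutator_def, map_commutator, ← MonoidHom.range_eq_map, MonoidHom.range_eq_top.2 hg,
    ← commutator_def, hH]

theorem commutator_commutator_eq_top {g : P →* H} (hg : Function.Surjective g)
    (hker : g.ker ≤ center P) (hH : commutator H = ⊤) : commutator (commutator P) = ⊤ := by
  apply map_injective (commutator P).subtype_injective
  rw [map_subtype_commutator, ← MonoidHom.range_eq_map, range_subtype]
  refine le_antisymm (commutator_le_left _ _) ?_
  rw [commutator_def, commutator_le]
  have h : ∀ a, ∃ a' ∈ commutator P, g a' = g a := fun a => by
    have : g a ∈ (commutator P).map g := by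
      rw [map_commutator_eq_top hg hH]
      exact mem_top _
    exact this
  intro a _ b _
  obtain ⟨a', ha', ha⟩ := h a
  obtain ⟨b', hb', hb⟩ := h b
  rw [commutatorElement_congr hker ha.symm hb.symm]
  exact commutator_mem_commutator ha' hb'

end Perfect

theorem exists_pow_two_ne_one {F : Type*} [Field F] [Fintype F] (h5 : 5 < Fintype.card F) :
    ∃ a : F, a ≠ 0 ∧ a ^ 2 ≠ 1 := by
  classical
  by_contra! h
  have : (Finset.univ : Finset F) ⊆ {0, 1, -1} := fun a _ => by
    by_cases ha : a = 0
    · simp [ha]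
    · simpa [ha] using mul_self_eq_one_iff.1 ((sq a).symm.trans (h a ha))
  have h1 := (Finset.card_le_card this).trans Finset.card_le_three
  rw [Finset.card_univ] at h1
  omega

/-- The adjoint quotients determine a perfect central extension up to a quotient of `SL2 F`. -/
theorem exists_surjective {F H : Type*} [Field F] [Fintype F] [Group H] [Finite H]
    (hH : commutator H = ⊤) (e : H ⧸ center H ≃* SL2 F ⧸ center (SL2 F))
    (h5 : 5 < Fintype.card F) (h9 : Fintype.card F ≠ 9) :
    ∃ π : SL2 F →* H, Function.Surjective π := by
  let P : Subgroup (H × SL2 F) := MonoidHom.eqLocus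
    (e.toMonoidHom.comp ((QuotientGroup.mk' _).comp (MonoidHom.fst H (SL2 F))))
    ((QuotientGroup.mk' _).comp (MonoidHom.snd H (SL2 F)))
  have hP : ∀ h s, (h, s) ∈ P ↔ e (QuotientGroup.mk h) = QuotientGroup.mk s := fun h s => Iff.rfl
  let g : P →* H := (MonoidHom.fst H (SL2 F)).comp P.subtype
  let f : P →* SL2 F := (MonoidHom.snd H (SL2 F)).comp P.subtype
  have hg : Function.Surjective g := fun h => by
    obtain ⟨s, hs⟩ := QuotientGroup.mk_surjective (e (QuotientGroup.mk h))
    exact ⟨⟨(h, s), (hP h s).2 hs.symm⟩, rfl⟩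
  have hf : Function.Surjective f := fun s => by
    obtain ⟨h, hh⟩ := QuotientGroup.mk_surjective (e.symm (QuotientGroup.mk s))
    exact ⟨⟨(h, s), (hP h s).2 (by rw [hh, e.apply_symm_apply])⟩, rfl⟩
  have hc : ∀ x : P, g x ∈ center H ↔ f x ∈ center (SL2 F) := fun x => by
    rw [← QuotientGroup.eq_one_iff, ← QuotientGroup.eq_one_iff, ← (hP (g x) (f x)).1 x.2,
      map_eq_one_iff e e.injective]
  have hcen : ∀ x : P, f x ∈ center (SL2 F) → x ∈ center P := fun x hx =>
    mem_center_iff.2 fun y => Subtype.ext (Prod.ext (mem_center_iff.1 ((hc x).2 hx) (g y))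
      (mem_center_iff.1 hx (f y)))
  have hker : g.ker ≤ center P := fun x hx => hcen x ((hc x).1 (by
    rw [MonoidHom.mem_ker.1 hx]
    exact one_mem _))
  have hS : commutator (SL2 F) = ⊤ := by
    obtain ⟨a, ha, ha2⟩ := exists_pow_two_ne_one h5
    exact Matrix.SL2.commutator_eq_top ha ha2
  let f' : commutator P →* SL2 F := f.comp (commutator P).subtype
  have hf' : Function.Surjective f' := by
    rw [← MonoidHom.range_eq_top, MonoidHom.range_comp, range_subtype,
      map_commutator_eq_top hf hS]
  have hg' : Function.Surjective (g.comp (commutator P).subtype) := by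
    rw [← MonoidHom.range_eq_top, MonoidHom.range_comp, range_subtype,
      map_commutator_eq_top hg hH]
  have hinj : Function.Injective f' := injective_of_perfect
    (commutator_commutator_eq_top hg hker hH) hf' (fun z hz => mem_center_iff.2 fun y =>
      Subtype.ext (mem_center_iff.1 (hcen _ hz) y)) h5 h9
  let E : commutator P ≃* SL2 F := MulEquiv.ofBijective f' ⟨hinj, hf'⟩
  exact ⟨(g.comp (commutator P).subtype).comp E.symm.toMonoidHom,
    hg'.comp E.symm.surjective⟩

end SLTwo

namespace SLTwo

open Module

section Family

/-- The number of isomorphism classes of faithful irreducible representations of dimension `n`. -/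
noncomputable def numIrred (k H : Type*) [Field k] [Group H] (n : ℕ) : ℕ :=
  Nat.card (Quotient (repIsoSetoid k H n fun ρ => Function.Injective ρ ∧ ρ.IsIrred))

/-- The constraints satisfied by the number `N` of the classes of `n`-dimensional irreducible
representations of `SL2` of a field with `Q` elements. -/
def ClassBound (n Q N : ℕ) : Prop :=
  N = 0 ∨ (n = Q + 1 ∧ 2 * N + 2 ≤ Q ∧ (Odd Q → 2 * N + 3 ≤ Q)) ∨ (n = Q ∧ N ≤ 1) ∨
    (n + 1 = Q ∧ 2 * N ≤ Q + 2) ∨ (2 * n + 1 = Q ∧ N ≤ 2) ∨ (2 * n = Q + 1 ∧ N ≤ 2)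

variable {k : Type*} [Field k] {n : ℕ} {t : Type*} {H : t → Type*} [∀ i, Group (H i)]

theorem ker_eq_of_isoRep {G H H' V V' : Type*} [Group G] [Group H] [Group H'] [AddCommGroup V]
    [Module k V] [AddCommGroup V'] [Module k V'] {π : G →* H} {π' : G →* H'}
    {ρ : Representation k H V} {ρ' : Representation k H' V'} (hρ : Function.Injective ρ)
    (hρ' : Function.Injective ρ') (h : IsoRep (ρ.comp π) (ρ'.comp π')) : π.ker = π'.ker := by
  obtain ⟨e, he⟩ := h
  ext g
  rw [MonoidHom.mem_ker, MonoidHom.mem_ker, ← map_eq_one_iff ρ hρ, ← map_eq_one_iff ρ' hρ']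
  constructor
  · intro hg
    ext v
    obtain ⟨v, rfl⟩ := e.surjective v
    have h1 : e (ρ (π g) v) = ρ' (π' g) (e v) := he g v
    rw [← h1, hg]
    rfl
  · intro hg
    ext v
    have h1 : e (ρ (π g) v) = ρ' (π' g) (e v) := he g v
    rw [hg] at h1
    exact e.injective h1

theorem classBound_sum_numIrred [IsAlgClosed k] (hn : 1 < n) [DecidableEq t] (s : Finset t)
    (hpair : ∀ i j, i ≠ j → IsEmpty (H i ≃* H j)) {F : Type*} [Field F] [Fintype F]
    (hq : (Fintype.card F : k) ≠ 0) (h5 : 5 < Fintype.card F)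
    (hπ : ∀ i ∈ s, ∃ π : SL2 F →* H i, Function.Surjective π) :
    ClassBound n (Fintype.card F) (∑ i ∈ s, numIrred k (H i) n) := by
  choose! π hπ using fun i : s => hπ i i.2
  have hinj : ∀ i : s, ∃ j : Fin (numIrred k (H i) n) → Quotient (repIsoSetoid k (H i) n
      fun ρ => Function.Injective ρ ∧ ρ.IsIrred), Function.Injective j := fun i => by
    rcases finite_or_infinite (Quotient (repIsoSetoid k (H i) n
      fun ρ => Function.Injective ρ ∧ ρ.IsIrred)) with h | h
    · exact ⟨_, (Finite.equivFin _).symm.injective⟩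
    · have : IsEmpty (Fin (numIrred k (H i) n)) := by
        rw [numIrred, Nat.card_eq_zero_of_infinite]
        infer_instance
      exact ⟨isEmptyElim, Function.injective_of_subsingleton _⟩
  choose j hj using hinj
  have hcard : Fintype.card (Σ i : s, Fin (numIrred k (H i) n)) =
      ∑ i ∈ s, numIrred k (H i) n := by
    rw [Fintype.card_sigma]
    simp only [Fintype.card_fin]
    exact Finset.sum_coe_sort s fun i => numIrred k (H i) n
  have hfr : finrank k (Fin n → k) = n := by simp
  have h := card_irred_le (k := k) (V := Fin n → k) (F := F)
    (ι := Σ i : s, Fin (numIrred k (H i) n))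
    (ρ := fun x => ((j x.1 x.2).out.1).comp (π x.1)) hq h5 (by rwa [hfr]) ?_ ?_
  · rwa [hcard, hfr] at h
  · intro x U hU
    refine (j x.1 x.2).out.2.2 U fun h v hv => ?_
    obtain ⟨g, rfl⟩ := hπ x.1 h
    exact hU g v hv
  · rintro ⟨i, x⟩ ⟨i', x'⟩ h
    obtain rfl : i = i' := by
      by_contra hne
      refine (hpair i i' fun h => hne (Subtype.ext h)).false ?_
      exact (QuotientGroup.quotientKerEquivOfSurjective _ (hπ i)).symm.trans
        ((QuotientGroup.quotientMulEquivOfEq (ker_eq_of_isoRep (j i x).out.2.1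
          (j i' x').out.2.1 h)).trans (QuotientGroup.quotientKerEquivOfSurjective _ (hπ i')))
    congr 1
    apply hj i
    rw [← Quotient.out_equiv_out]
    obtain ⟨e, he⟩ := h
    refine ⟨e, fun h v => ?_⟩
    obtain ⟨g, rfl⟩ := hπ i h
    exact he g v

end Family

section Arithmetic

theorem eq_or_sq_dvd_of_isPrimePow {p Q : ℕ} (hp : p.Prime) (hQ : IsPrimePow Q) (h : p ∣ Q) :
    Q = p ∨ p ^ 2 ∣ Q := by
  obtain ⟨r, m, hr, hm, rfl⟩ := hQ
  obtain rfl := (Nat.prime_dvd_prime_iff_eq hp hr.nat_prime).1 (hp.dvd_of_dvd_pow h)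
  rcases Nat.lt_or_ge m 2 with h2 | h2
  · exact .inl (by rw [show m = 1 by omega, pow_one])
  · exact .inr (pow_dvd_pow _ h2)

theorem not_six_dvd_of_isPrimePow {Q : ℕ} (hQ : IsPrimePow Q) (h2 : 2 ∣ Q) (h3 : 3 ∣ Q) :
    False := by
  obtain ⟨r, m, hr, hm, rfl⟩ := hQ
  have e2 := (Nat.prime_dvd_prime_iff_eq Nat.prime_two hr.nat_prime).1
    (Nat.prime_two.dvd_of_dvd_pow h2)
  have e3 := (Nat.prime_dvd_prime_iff_eq Nat.prime_three hr.nat_prime).1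
    (Nat.prime_three.dvd_of_dvd_pow h3)
  omega

/-- Necessary conditions for being a prime power other than `2, 3, 4, 5, 9`. -/
def Admissible (Q : ℕ) : Prop :=
  5 < Q ∧ (2 ∣ Q → 4 ∣ Q) ∧ (3 ∣ Q → 9 ∣ Q) ∧ (2 ∣ Q → ¬ 3 ∣ Q)

theorem admissible_of_isPrimePow {Q : ℕ} (hQ : IsPrimePow Q)
    (h : Q ∉ ({2, 3, 4, 5, 9} : Set ℕ)) : Admissible Q := by
  simp only [Set.mem_insert_iff, Set.mem_singleton_iff, not_or] at h
  refine ⟨?_, fun h2 => ?_, fun h3 => ?_, fun h2 h3 => not_six_dvd_of_isPrimePow hQ h2 h3⟩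
  · have := hQ.one_lt
    omega
  · rcases eq_or_sq_dvd_of_isPrimePow Nat.prime_two hQ h2 with h' | h' <;> omega
  · rcases eq_or_sq_dvd_of_isPrimePow Nat.prime_three hQ h3 with h' | h' <;> omega

theorem sum_le_of_admissible {n a b c d e : ℕ} (hn : 1 < n)
    (ha : a = 0 ∨ (Admissible (n - 1) ∧ 2 * a + 2 ≤ n - 1 ∧ (Odd (n - 1) → 2 * a + 3 ≤ n - 1)))
    (hb : b = 0 ∨ (Admissible n ∧ b ≤ 1))
    (hc : c = 0 ∨ (Admissible (n + 1) ∧ 2 * c ≤ n + 3))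
    (hd : d = 0 ∨ (Admissible (2 * n + 1) ∧ d ≤ 2))
    (he : e = 0 ∨ (Admissible (2 * n - 1) ∧ e ≤ 2)) : a + b + c + d + e ≤ n + 3 := by
  simp only [Nat.odd_iff] at ha
  unfold Admissible at *
  have hac : n % 2 = 1 → a = 0 ∨ c = 0 := fun h => by
    rcases ha with ha | ⟨ha, -⟩
    · exact .inl ha
    · rcases hc with hc | ⟨hc, -⟩ <;> omega
  have hb' : n % 2 = 0 → n % 3 = 0 → b = 0 := fun h h' => by
    rcases hb with hb | ⟨hb, -⟩ <;> omega
  have had : n % 3 = 1 → a = 0 ∨ d = 0 := fun h => by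
    rcases ha with ha | ⟨ha, -⟩
    · exact .inl ha
    · rcases hd with hd | ⟨hd, -⟩ <;> omega
  have hce : n % 3 = 2 → c = 0 ∨ e = 0 := fun h => by
    rcases hc with hc | ⟨hc, -⟩
    · exact .inl hc
    · rcases he with he | ⟨he, -⟩ <;> omega
  have ha' : a = 0 ∨ (2 * a + 3 ≤ n ∧ (n % 2 = 0 → 2 * a + 4 ≤ n)) := by
    rcases ha with ha | ⟨⟨h, -⟩, ha⟩ <;> omega
  have hb'' : b = 0 ∨ 5 < n ∧ b ≤ 1 := by
    rcases hb with hb | ⟨⟨h, -⟩, hb⟩ <;> omega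
  have hc' : c = 0 ∨ 5 ≤ n ∧ 2 * c ≤ n + 3 ∧ (n = 5 → c = 0) := by
    rcases hc with hc | ⟨hc, hc'⟩ <;> omega
  have hd' : d ≤ 2 := by rcases hd with hd | ⟨-, hd⟩ <;> omega
  have he' : e ≤ 2 := by rcases he with he | ⟨-, he⟩ <;> omega
  clear ha hb hc hd he
  have h3 : n % 3 = 0 ∨ n % 3 = 1 ∨ n % 3 = 2 := by omega
  rcases Nat.mod_two_eq_zero_or_one n with h2 | h2
  · rcases h3 with h3 | h3 | h3
    · have := hb' h2 h3
      omega
    · rcases had h3 with h | h <;> omega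
    · rcases hce h3 with h | h <;> omega
  · rcases hac h2 with h | h <;> omega

end Arithmetic

end SLTwo

open SLTwo

theorem growth_A1 (ℓ : ℕ) (hℓ : ℓ.Prime)
    (k : Type*) [Field k] [IsAlgClosed k] [CharP k ℓ]
    (n : ℕ) (hn : 1 < n)
    (t : ℕ) (H : Fin t → Type*) [∀ i, Group (H i)] [∀ i, Finite (H i)]
    -- each `H i` is quasisimple:
    (hperf : ∀ i, commutator (H i) = ⊤)
    (hsimple : ∀ i, IsSimpleGroup (H i ⧸ Subgroup.center (H i)))
    -- the `H i` are pairwise non-isomorphic: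
    (hpair : ∀ i j, i ≠ j → IsEmpty (H i ≃* H j))
    -- each `H i ⧸ Z(H i)` is `PSL₂(F_{q i})` with `q i ∉ {2,3,4,5,9}` and `ℓ ∤ q i`:
    (q : Fin t → ℕ) (F : Fin t → Type*) [∀ i, Field (F i)] [∀ i, Fintype (F i)]
    (hq : ∀ i, IsPrimePow (q i) ∧ q i ∉ ({2, 3, 4, 5, 9} : Set ℕ) ∧ ¬ ℓ ∣ q i ∧
      Fintype.card (F i) = q i)
    (hiso : ∀ i, Nonempty ((H i ⧸ Subgroup.center (H i)) ≃*
      (Matrix.SpecialLinearGroup (Fin 2) (F i) ⧸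
        Subgroup.center (Matrix.SpecialLinearGroup (Fin 2) (F i))))) :
    ∑ i : Fin t, Nat.card (Quotient (repIsoSetoid k (H i) n
      (fun ρ => Function.Injective ρ ∧ ρ.IsIrred))) ≤ n + 3 := by
  classical
  set N : Fin t → ℕ := fun i => numIrred k (H i) n
  change ∑ i, N i ≤ n + 3
  let S : ℕ → ℕ := fun Q => ∑ i with q i = Q, N i
  have hS : ∀ Q, S Q = 0 ∨ (Admissible Q ∧ ClassBound n Q (S Q)) := fun Q => by
    rcases (Finset.univ.filter fun i => q i = Q).eq_empty_or_nonempty with h | ⟨i₀, hi₀⟩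
    · exact .inl (by simp only [S, h, Finset.sum_empty])
    obtain rfl : q i₀ = Q := (Finset.mem_filter.1 hi₀).2
    have hadm := fun i => admissible_of_isPrimePow (hq i).1 (hq i).2.1
    refine .inr ⟨hadm i₀, ?_⟩
    have h5 : ∀ i, 5 < Fintype.card (F i) := fun i => by
      rw [(hq i).2.2.2]
      exact (hadm i).1
    have h9 : ∀ i, Fintype.card (F i) ≠ 9 := fun i h => by
      rw [(hq i).2.2.2] at h
      exact (hq i).2.1 (by simp [h])
    have hk : (Fintype.card (F i₀) : k) ≠ 0 := by
      rw [(hq i₀).2.2.2, Ne, CharP.cast_eq_zero_iff k ℓ]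
      exact (hq i₀).2.2.1
    have h := classBound_sum_numIrred (k := k) hn (Finset.univ.filter fun i => q i = q i₀) hpair
      hk (h5 i₀) fun i hi => by
        obtain ⟨π, hπ⟩ := exists_surjective (hperf i) (hiso i).some (h5 i) (h9 i)
        let e : F i₀ ≃+* F i := FiniteField.ringEquivOfCardEq (by
          rw [(hq i).2.2.2, (hq i₀).2.2.2, (Finset.mem_filter.1 hi).2])
        refine ⟨π.comp (Matrix.SpecialLinearGroup.map e.toRingHom), hπ.comp fun A =>
          ⟨Matrix.SpecialLinearGroup.map e.symm.toRingHom A, ?_⟩⟩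
        ext a b
        exact e.apply_symm_apply _
    rwa [(hq i₀).2.2.2] at h
  have hle : ∀ i, N i ≤ S (q i) := fun i =>
    Finset.single_le_sum (f := N) (fun _ _ => Nat.zero_le _) (by simp)
  have hsum : ∑ i, N i ≤ S (n - 1) + S n + S (n + 1) + S (2 * n + 1) + S (2 * n - 1) := by
    simp only [S, Finset.sum_filter]
    rw [← Finset.sum_add_distrib, ← Finset.sum_add_distrib, ← Finset.sum_add_distrib,
      ← Finset.sum_add_distrib]
    refine Finset.sum_le_sum fun i _ => ?_
    have h1 := hle i
    have h2 := hS (q i)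
    unfold ClassBound at h2
    by_cases h0 : N i = 0
    · omega
    have h3 : q i = n - 1 ∨ q i = n ∨ q i = n + 1 ∨ q i = 2 * n + 1 ∨ q i = 2 * n - 1 := by omega
    rcases h3 with h | h | h | h | h <;> rw [if_pos h] <;> omega
  refine hsum.trans (sum_le_of_admissible hn ?_ ?_ ?_ ?_ ?_)
  · exact (hS (n - 1)).imp_right fun ⟨h, h'⟩ => by
      rcases h' with h' | ⟨-, h1, h2⟩ | h'
      · have : 5 < n - 1 := h.1
        refine ⟨h, by omega, fun _ => by omega⟩
      · exact ⟨h, h1, h2⟩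
      · omega
  all_goals
    refine (hS _).imp_right fun ⟨h, h'⟩ => ⟨h, ?_⟩
    rcases h' with h' | ⟨h', -⟩ | h' <;> omega
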